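/- arXiv:1008.3854 — 3 statements merged into one kernel-verified Lean document; each statement's English description precedes it below -/
import Mathlib

section
/- For any real c > 0 there exist positive real numbers α_c and β such that for all sufficiently large n ∈ ℕ and for every positive integer N with √n/N < c, one has α_c < −(1/√n)·ln( max_{λ ∈ 𝕐_N^n} (dim E_λ) / N^n ) < β. -/
open MeasureTheory Real Filter Topology
open scoped Classical

noncomputable section

/-- Row lengths of a partition of `n`, `1`-indexed and weakly decreasing
(`rowLen lam i` is the length `λᵢ` of the `i`-th row; it is `0` for `i` beyond
the number of parts). -/
def rowLen {n : ℕ} (lam : Nat.Partition n) (i : ℕ) : ℕ :=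
  ((lam.parts.sort (· ≤ ·)).reverse.getD (i - 1) 0)

/-- Column lengths, i.e. the conjugate partition `λ′ⱼ = #{i : λᵢ ≥ j}`. -/
def colLen {n : ℕ} (lam : Nat.Partition n) (j : ℕ) : ℕ :=
  ((Finset.Icc 1 n).filter (fun i => j ≤ rowLen lam i)).card

/-- The cells `(i, j)` of the Young diagram of `lam`, with `1 ≤ i` and `1 ≤ j ≤ λᵢ`. -/
def cellsOf {n : ℕ} (lam : Nat.Partition n) : Finset (ℕ × ℕ) :=
  (Finset.Icc 1 n ×ˢ Finset.Icc 1 n).filter (fun p => p.2 ≤ rowLen lam p.1)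

/-- The hook length `h_{i,j} = (λᵢ − j) + (λ′ⱼ − i) + 1` of the cell `(i,j)`. -/
def hookLen {n : ℕ} (lam : Nat.Partition n) (i j : ℕ) : ℕ :=
  (rowLen lam i - j) + (colLen lam j - i) + 1

/-- `𝕐_N^n`: Young diagrams with `n` cells and at most `N` rows. -/
def YNN (n N : ℕ) : Finset (Nat.Partition n) :=
  Finset.univ.filter (fun lam => lam.parts.card ≤ N)

/-- `dim E_λ = n! · ∏ (N + c_{i,j}) / (∏ h_{i,j})²`, the dimension of the isotypic
component of `(ℂ^N)^{⊗n}` indexed by `λ` (here the content is `c_{i,j} = j − i`). -/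
def dimE (n N : ℕ) (lam : Nat.Partition n) : ℝ :=
  (n.factorial : ℝ) * (∏ p ∈ cellsOf lam, ((N : ℝ) + (p.2 : ℝ) - (p.1 : ℝ))) /
    (∏ p ∈ cellsOf lam, (hookLen lam p.1 p.2 : ℝ))^2

/-- The probability measure `ℙ_N^n(λ) = dim E_λ / N^n` on `𝕐_N^n`. -/
def PNN (n N : ℕ) (lam : Nat.Partition n) : ℝ := dimE n N lam / (N : ℝ)^n

/-- Monic Charlier polynomials. -/
def chP (a : ℝ) : ℕ → Polynomial ℝ
  | 0 => 1
  | k + 1 => Polynomial.X * (chP a k).comp (Polynomial.X - 1) - Polynomial.C a * chP a k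

lemma chP_monic (a : ℝ) (k : ℕ) : (chP a k).Monic ∧ (chP a k).natDegree = k := by
  induction k with
  | zero => simp [chP]
  | succ k ih =>
    obtain ⟨h1, h2⟩ := ih
    have hx : (Polynomial.X - 1 : Polynomial ℝ) = Polynomial.X - Polynomial.C 1 := by simp
    have hm : ((chP a k).comp (Polynomial.X - 1)).Monic := by
      rw [hx]; exact h1.comp_X_sub_C 1
    have hd : ((chP a k).comp (Polynomial.X - 1)).natDegree = k := by
      rw [hx, Polynomial.natDegree_comp, h2, Polynomial.natDegree_X_sub_C, mul_one]
    have hm2 : (Polynomial.X * (chP a k).comp (Polynomial.X - 1)).Monic := Polynomial.monic_X.mul hm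
    have hd2 : (Polynomial.X * (chP a k).comp (Polynomial.X - 1)).natDegree = k + 1 := by
      rw [Polynomial.Monic.natDegree_mul Polynomial.monic_X hm, hd, Polynomial.natDegree_X, add_comm]
    have hlt : (Polynomial.C a * chP a k).degree <
        (Polynomial.X * (chP a k).comp (Polynomial.X - 1)).degree := by
      rw [Polynomial.degree_eq_natDegree hm2.ne_zero, hd2]
      refine lt_of_le_of_lt Polynomial.degree_le_natDegree ?_
      have := Polynomial.natDegree_C_mul_le a (chP a k)
      exact_mod_cast (by omega : (Polynomial.C a * chP a k).natDegree < k + 1)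
    refine ⟨?_, ?_⟩
    · rw [chP]; exact hm2.sub_of_left hlt
    · rw [chP, Polynomial.natDegree_sub_eq_left_of_natDegree_lt, hd2]
      rw [hd2]
      have := Polynomial.natDegree_C_mul_le a (chP a k)
      omega

lemma chP_diff (a : ℝ) (k : ℕ) :
    (chP a (k+1)).comp (Polynomial.X + 1) = chP a (k+1) + ((k:Polynomial ℝ)+1) * chP a k := by
  have key : ∀ P : Polynomial ℝ, (P.comp (Polynomial.X - 1)).comp (Polynomial.X + 1) = P := by
    intro P; rw [Polynomial.comp_assoc]; simp
  have key2 : ∀ P : Polynomial ℝ, (P.comp (Polynomial.X + 1)).comp (Polynomial.X - 1) = P := by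
    intro P; rw [Polynomial.comp_assoc]; simp
  induction k with
  | zero => simp [chP]; ring
  | succ k ih =>
    have ih' := congrArg (fun P => Polynomial.comp P (Polynomial.X - 1)) ih
    simp only [key2, Polynomial.add_comp, Polynomial.mul_comp, Polynomial.natCast_comp, Polynomial.one_comp] at ih'
    rw [chP]
    simp only [Polynomial.sub_comp, Polynomial.mul_comp, Polynomial.X_comp, key, Polynomial.C_comp, ih]
    have h2 : chP a (k+1) = Polynomial.X * (chP a k).comp (Polynomial.X - 1) - Polynomial.C a * chP a k := rfl
    push_cast
    linear_combination Polynomial.X * ih' - ((k:Polynomial ℝ)+1) * h2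

def pw (a : ℝ) (x : ℕ) : ℝ := Real.exp (-a) * (a ^ x / x.factorial)

lemma pw_pos {a : ℝ} (ha : 0 < a) (x : ℕ) : 0 < pw a x := by unfold pw; positivity

lemma pw_succ (a : ℝ) (x : ℕ) : pw a (x+1) * ((x:ℝ)+1) = a * pw a x := by
  unfold pw
  rw [Nat.factorial_succ, pow_succ]; push_cast
  have : (x.factorial : ℝ) ≠ 0 := by positivity
  field_simp

lemma pw_hasSum (a : ℝ) : HasSum (pw a) 1 := by
  have h := (NormedSpace.expSeries_div_hasSum_exp a).mul_left (Real.exp (-a))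
  rw [← Real.exp_eq_exp_ℝ, ← Real.exp_add] at h
  have e : rexp (-a + a) = 1 := by simp
  rw [e] at h
  exact h

lemma pw_hasSum_X (a : ℝ) (f : ℝ → ℝ) (s : ℝ) (h : HasSum (fun x : ℕ => pw a x * f (x+1)) s) :
    HasSum (fun x : ℕ => pw a x * (x * f x)) (a * s) := by
  have h2 := h.mul_left a
  have := (hasSum_nat_add_iff (f := fun x : ℕ => pw a x * (x * f x)) 1 (g := a * s)).1 ?_
  · simpa using this
  · refine h2.congr_fun ?_
    intro x
    push_cast
    have := pw_succ a x
    linear_combination (f (x+1)) * this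

lemma pw_summable (a : ℝ) : ∀ (m : ℕ) (P : Polynomial ℝ), P.natDegree ≤ m →
    Summable (fun x : ℕ => pw a x * P.eval (x:ℝ)) := by
  intro m
  induction m with
  | zero =>
    intro P hP
    rw [Polynomial.eq_C_of_natDegree_le_zero hP]
    simp only [Polynomial.eval_C]
    exact (pw_hasSum a).summable.mul_right _
  | succ m ih =>
    intro P hP
    have h1 : (P.divX.comp (Polynomial.X + 1)).natDegree ≤ m := by
      have hx : (Polynomial.X + 1 : Polynomial ℝ) = Polynomial.X + Polynomial.C 1 := by simp
      rw [hx, Polynomial.natDegree_comp, Polynomial.natDegree_X_add_C, mul_one, Polynomial.natDegree_divX_eq_natDegree_tsub_one]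
      omega
    obtain ⟨s, hs⟩ := ih _ h1
    have h2 := pw_hasSum_X a (fun x => P.divX.eval x) s (by simpa using hs)
    have h3 := h2.summable.add ((pw_hasSum a).summable.mul_right (P.coeff 0))
    refine h3.congr ?_
    intro x
    conv_rhs => rw [← Polynomial.divX_mul_X_add P]
    simp; ring

def pE (a : ℝ) (P : Polynomial ℝ) : ℝ := ∑' x : ℕ, pw a x * P.eval (x:ℝ)

lemma pE_hasSum (a : ℝ) (P : Polynomial ℝ) : HasSum (fun x : ℕ => pw a x * P.eval (x:ℝ)) (pE a P) :=
  (pw_summable a _ P le_rfl).hasSum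

lemma pE_add (a : ℝ) (P Q : Polynomial ℝ) : pE a (P + Q) = pE a P + pE a Q := by
  refine (pE_hasSum a _).unique (((pE_hasSum a P).add (pE_hasSum a Q)).congr_fun ?_)
  intro x; simp; ring

lemma pE_C_mul (a c : ℝ) (P : Polynomial ℝ) : pE a (Polynomial.C c * P) = c * pE a P := by
  refine (pE_hasSum a _).unique (((pE_hasSum a P).mul_left c).congr_fun ?_)
  intro x; simp; ring

lemma pE_sub (a : ℝ) (P Q : Polynomial ℝ) : pE a (P - Q) = pE a P - pE a Q := by
  refine (pE_hasSum a _).unique (((pE_hasSum a P).sub (pE_hasSum a Q)).congr_fun ?_)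
  intro x; simp; ring

lemma pE_one (a : ℝ) : pE a 1 = 1 := by
  refine (pE_hasSum a _).unique ((pw_hasSum a).congr_fun ?_)
  intro x; simp

lemma pE_X_mul (a : ℝ) (P : Polynomial ℝ) :
    pE a (Polynomial.X * P) = a * pE a (P.comp (Polynomial.X + 1)) := by
  refine (pE_hasSum a _).unique ((pw_hasSum_X a (fun x => P.eval x) _ ((pE_hasSum a (P.comp (Polynomial.X + 1))).congr_fun ?_)).congr_fun ?_)
  · intro x; simp
  · intro x; simp

lemma pE_ch_succ (a : ℝ) (k : ℕ) (G : Polynomial ℝ) :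
    pE a (chP a (k+1) * G) = a * pE a (chP a k * (G.comp (Polynomial.X + 1) - G)) := by
  have key : ∀ P : Polynomial ℝ, (P.comp (Polynomial.X - 1)).comp (Polynomial.X + 1) = P := by
    intro P; rw [Polynomial.comp_assoc]; simp
  rw [chP, sub_mul, pE_sub, mul_assoc, pE_X_mul, Polynomial.mul_comp, key, mul_assoc, pE_C_mul,
    mul_sub, pE_sub]; ring

lemma pE_orth (a : ℝ) : ∀ j k : ℕ, pE a (chP a j * chP a k) = if j = k then a ^ k * k.factorial else 0 := by
  have h0 : ∀ j, pE a (chP a (j+1) * chP a 0) = 0 := by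
    intro j
    rw [pE_ch_succ]
    have : ((chP a 0).comp (Polynomial.X + 1) - chP a 0) = Polynomial.C 0 * 1 := by simp [chP]
    rw [this, mul_left_comm, pE_C_mul]; simp
  intro j
  induction j with
  | zero =>
    intro k
    cases k with
    | zero => simp [chP, pE_one]
    | succ k => rw [mul_comm, h0]; simp
  | succ j ih =>
    intro k
    cases k with
    | zero => rw [h0]; simp
    | succ k =>
      rw [pE_ch_succ, chP_diff]
      have : chP a j * (chP a (k+1) + ((k:Polynomial ℝ)+1) * chP a k - chP a (k+1))
        = Polynomial.C ((k:ℝ)+1) * (chP a j * chP a k) := by simp; ring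
      rw [this, pE_C_mul, ih]
      by_cases h : j = k
      · simp [h, Nat.factorial_succ, pow_succ]; ring
      · simp [h]

lemma pE_shift (a : ℝ) (k : ℕ) : pE a (chP a k * (chP a k).comp (Polynomial.X + 1)) = a ^ k * k.factorial := by
  cases k with
  | zero => simp [chP, pE_one]
  | succ k =>
    rw [chP_diff]
    have : chP a (k+1) * (chP a (k+1) + ((k:Polynomial ℝ)+1) * chP a k) = chP a (k+1) * chP a (k+1)
      + Polynomial.C ((k:ℝ)+1) * (chP a (k+1) * chP a k) := by simp; ring
    rw [this, pE_add, pE_C_mul, pE_orth, pE_orth]; simp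

lemma pE_X_sq {a : ℝ} (ha : 0 < a) (k : ℕ) : pE a (Polynomial.X * (chP a k * chP a k)) = (a ^ k * k.factorial) * (a + k) := by
  rw [pE_X_mul]
  cases k with
  | zero => simp [chP, pE_one]
  | succ k =>
    rw [Polynomial.mul_comp, chP_diff]
    have : (chP a (k+1) + ((k:Polynomial ℝ)+1) * chP a k) * (chP a (k+1) + ((k:Polynomial ℝ)+1) * chP a k) = chP a (k+1) * chP a (k+1)
      + (Polynomial.C (2*((k:ℝ)+1)) * (chP a (k+1) * chP a k) + Polynomial.C (((k:ℝ)+1)^2) * (chP a k * chP a k)) := by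
        have h2 : (Polynomial.C 2 : Polynomial ℝ) = 2 := rfl
        simp [h2]; ring
    rw [this, pE_add, pE_add, pE_C_mul, pE_C_mul, pE_orth, pE_orth, pE_orth]
    simp [Nat.factorial_succ, pow_succ]; ring

def chF (a : ℝ) (k x : ℕ) : ℝ := √(pw a x) * (chP a k).eval (x:ℝ) / √(a ^ k * k.factorial)

lemma chF_orth {a : ℝ} (ha : 0 < a) (j k : ℕ) :
    HasSum (fun x => chF a j x * chF a k x) (if j = k then 1 else 0) := by
  have h := (pE_hasSum a (chP a j * chP a k)).mul_left ((√(a ^ j * j.factorial))⁻¹ * (√(a ^ k * k.factorial))⁻¹)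
  rw [pE_orth] at h
  have e : ((√(a ^ j * j.factorial))⁻¹ * (√(a ^ k * k.factorial))⁻¹) * (if j = k then a ^ k * k.factorial else 0) = if j = k then (1:ℝ) else 0 := by
    split_ifs with hh
    · subst hh
      have : 0 < a ^ j * (j.factorial : ℝ) := by positivity
      rw [← mul_inv, Real.mul_self_sqrt this.le]; field_simp
    · simp
  rw [e] at h
  refine h.congr_fun ?_
  intro x
  have := Real.mul_self_sqrt (pw_pos ha x).le
  simp only [chF, Polynomial.eval_mul]
  conv_rhs => rw [← this]
  simp only [div_eq_mul_inv]; ring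

lemma chF_X {a : ℝ} (ha : 0 < a) (k : ℕ) :
    HasSum (fun x : ℕ => (x:ℝ) * (chF a k x * chF a k x)) (a + k) := by
  have h := (pE_hasSum a (Polynomial.X * (chP a k * chP a k))).mul_left ((√(a ^ k * k.factorial))⁻¹ * (√(a ^ k * k.factorial))⁻¹)
  rw [pE_X_sq ha] at h
  have e : ((√(a ^ k * k.factorial))⁻¹ * (√(a ^ k * k.factorial))⁻¹) * (a ^ k * k.factorial) = 1 := by
    have : 0 < a ^ k * (k.factorial : ℝ) := by positivity
    rw [← mul_inv, Real.mul_self_sqrt this.le]; field_simp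
  rw [← mul_assoc (_ * _) (a ^ k * (k.factorial : ℝ)), e, one_mul] at h
  refine h.congr_fun ?_
  intro x
  have := Real.mul_self_sqrt (pw_pos ha x).le
  simp only [chF, Polynomial.eval_mul, Polynomial.eval_X]
  conv_rhs => rw [← this]
  simp only [div_eq_mul_inv]; ring

lemma chF_shift {a : ℝ} (ha : 0 < a) (k : ℕ) :
    HasSum (fun x : ℕ => √((x:ℝ)+1) * (chF a k x * chF a k (x+1))) (√a) := by
  have h := (pE_hasSum a (chP a k * (chP a k).comp (Polynomial.X + 1))).mul_left ((√(a ^ k * k.factorial))⁻¹ * (√(a ^ k * k.factorial))⁻¹)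
  rw [pE_shift] at h
  have e : ((√(a ^ k * k.factorial))⁻¹ * (√(a ^ k * k.factorial))⁻¹) * (a ^ k * k.factorial) = 1 := by
    have : 0 < a ^ k * (k.factorial : ℝ) := by positivity
    rw [← mul_inv, Real.mul_self_sqrt this.le]; field_simp
  rw [e] at h
  have h := h.mul_left (√a)
  rw [mul_one] at h
  refine h.congr_fun ?_
  intro x
  have : √((x:ℝ)+1) * √(pw a x) * √(pw a (x+1)) = √a * pw a x := by
    have h0 := (pw_pos ha x).le
    rw [← Real.sqrt_mul (by positivity), ← Real.sqrt_mul (by positivity)]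
    rw [show ((x:ℝ)+1) * pw a x * pw a (x+1) = a * (pw a x)^2 by linear_combination (pw a x) * pw_succ a x]
    rw [Real.sqrt_mul ha.le, Real.sqrt_sq h0]
  simp only [chF, Polynomial.eval_mul, Polynomial.eval_comp, Polynomial.eval_add, Polynomial.eval_X, Polynomial.eval_one]
  push_cast
  simp only [div_eq_mul_inv]
  linear_combination (Polynomial.eval (↑x) (chP a k) * (√(a ^ k * ↑k.factorial))⁻¹ * (Polynomial.eval (↑x + 1) (chP a k) * (√(a ^ k * ↑k.factorial))⁻¹)) * this

def chK (a : ℝ) (N x y : ℕ) : ℝ := ∑ k ∈ Finset.range N, chF a k x * chF a k y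

lemma chK_hasSum {a : ℝ} (ha : 0 < a) (N : ℕ) : HasSum (fun x => chK a N x x) N := by
  have := hasSum_sum (s := Finset.range N) (f := fun k x => chF a k x * chF a k x) (a := fun _ => (1:ℝ))
    (fun k _ => by simpa using chF_orth ha k k)
  simpa [chK] using this

lemma chK_hasSum_X {a : ℝ} (ha : 0 < a) (N : ℕ) :
    HasSum (fun x : ℕ => (x:ℝ) * chK a N x x) (N * a + N * (N - 1) / 2) := by
  have := hasSum_sum (s := Finset.range N) (fun k _ => chF_X ha k)
  have e : ∑ k ∈ Finset.range N, (a + (k:ℝ)) = N * a + N * (N - 1) / 2 := by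
    induction N with
    | zero => simp
    | succ N ih => 
      rw [Finset.sum_range_succ, ih (hasSum_sum (fun k _ => chF_X ha k))]; push_cast; ring
  rw [e] at this
  simpa [chK, Finset.mul_sum] using this

lemma chK_hasSum_shift {a : ℝ} (ha : 0 < a) (N : ℕ) :
    HasSum (fun x : ℕ => √((x:ℝ)+1) * chK a N x (x+1)) (N * √a) := by
  have := hasSum_sum (s := Finset.range N) (fun k _ => chF_shift ha k)
  simpa [chK, Finset.mul_sum] using this

lemma ch_parseval {a : ℝ} (ha : 0 < a) (N : ℕ) (u : ℕ → ℝ) :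
    HasSum (fun z => (∑ k ∈ Finset.range N, u k * chF a k z) ^ 2) (∑ k ∈ Finset.range N, u k ^ 2) := by
  have := hasSum_sum (s := Finset.range N) (fun j _ => hasSum_sum (s := Finset.range N)
    (fun k _ => (chF_orth ha j k).mul_left (u j * u k)))
  have e : ∑ j ∈ Finset.range N, ∑ k ∈ Finset.range N, (u j * u k) * (if j = k then (1:ℝ) else 0) = ∑ k ∈ Finset.range N, u k ^ 2 := by
    refine Finset.sum_congr rfl ?_
    intro j hj
    simp only [mul_ite, mul_one, mul_zero, Finset.sum_ite_eq, hj, if_true]; ring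
  rw [e] at this
  refine this.congr_fun ?_
  intro z
  rw [sq, Finset.sum_mul_sum]
  refine Finset.sum_congr rfl fun j _ => Finset.sum_congr rfl fun k _ => ?_
  ring

lemma ch_two_le {a : ℝ} (ha : 0 < a) (N : ℕ) (u : ℕ → ℝ) (x y : ℕ) (hxy : x ≠ y) :
    (∑ k ∈ Finset.range N, u k * chF a k x) ^ 2 + (∑ k ∈ Finset.range N, u k * chF a k y) ^ 2
     ≤ ∑ k ∈ Finset.range N, u k ^ 2 := by
  have := sum_le_hasSum {x, y} (fun i _ => by positivity) (ch_parseval ha N u)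
  rwa [Finset.sum_pair hxy] at this

lemma chK_sq {a : ℝ} (ha : 0 < a) (N x y : ℕ) (hxy : x ≠ y) :
    chK a N x x ^ 2 + chK a N x y ^ 2 ≤ chK a N x x := by
  have := ch_two_le ha N (fun k => chF a k x) x y hxy
  simpa [chK, ← sq] using this

lemma chK_nonneg (a : ℝ) (N x : ℕ) : 0 ≤ chK a N x x :=
  Finset.sum_nonneg fun _ _ => mul_self_nonneg _

lemma chK_le_one {a : ℝ} (ha : 0 < a) (N x : ℕ) : chK a N x x ≤ 1 := by
  have := chK_sq ha N x (x+1) (by omega)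
  nlinarith [chK_nonneg a N x, sq_nonneg (chK a N x (x+1))]

lemma chK_abs_le (a : ℝ) (N x y : ℕ) : 2 * |chK a N x y| ≤ chK a N x x + chK a N y y := by
  rw [chK, chK, chK, ← Finset.sum_add_distrib]
  calc _ ≤ 2 * ∑ k ∈ Finset.range N, |chF a k x * chF a k y| := by gcongr; exact Finset.abs_sum_le_sum_abs _ _
    _ = ∑ k ∈ Finset.range N, 2 * |chF a k x * chF a k y| := by rw [Finset.mul_sum]
    _ ≤ _ := by
      refine Finset.sum_le_sum fun k _ => ?_
      rw [abs_mul]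
      nlinarith [sq_nonneg (|chF a k x| - |chF a k y|), sq_abs (chF a k x), sq_abs (chF a k y)]

lemma chK_two_aux {a : ℝ} (ha : 0 < a) (N x y : ℕ) (hxy : x ≠ y) (σ : ℝ) (hσ : σ ^ 2 = 1) :
    chK a N x x + chK a N y y + 2 * σ * chK a N x y ≤ 2 := by
  have h := ch_two_le ha N (fun k => chF a k x + σ * chF a k y) x y hxy
  have h1 : ∑ k ∈ Finset.range N, (chF a k x + σ * chF a k y) * chF a k x = chK a N x x + σ * chK a N x y := by
    simp only [chK, Finset.mul_sum, ← Finset.sum_add_distrib]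
    exact Finset.sum_congr rfl fun k _ => by ring
  have h2 : ∑ k ∈ Finset.range N, (chF a k x + σ * chF a k y) * chF a k y = chK a N x y + σ * chK a N y y := by
    simp only [chK, Finset.mul_sum, ← Finset.sum_add_distrib]
    exact Finset.sum_congr rfl fun k _ => by ring
  have h3 : ∑ k ∈ Finset.range N, (chF a k x + σ * chF a k y) ^ 2 = chK a N x x + 2 * σ * chK a N x y + chK a N y y := by
    simp only [chK, Finset.mul_sum, ← Finset.sum_add_distrib]
    exact Finset.sum_congr rfl fun k _ => by linear_combination (chF a k y)^2 * hσ
  rw [h1, h2, h3] at h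
  set p := chK a N x x
  set q := chK a N y y
  set r := chK a N x y
  -- U = p + q + 2σ r, f = p + σ r, g = r + σ q, f + σ g = U
  have hU : (p + σ * r) + σ * (r + σ * q) = p + q + 2 * σ * r := by linear_combination q * hσ
  have : (p + q + 2 * σ * r)^2 ≤ 2 * (p + q + 2 * σ * r) := by
    rw [← hU]
    have e : σ ^ 2 * (r + σ * q)^2 = (r + σ * q)^2 := by rw [hσ, one_mul]
    nlinarith [sq_nonneg ((p + σ * r) - σ * (r + σ * q))]
  by_contra hc
  push Not at hc
  nlinarith

lemma chK_two {a : ℝ} (ha : 0 < a) (N x y : ℕ) (hxy : x ≠ y) :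
    2 * |chK a N x y| ≤ (1 - chK a N x x) + (1 - chK a N y y) := by
  have h1 := chK_two_aux ha N x y hxy 1 (by norm_num)
  have h2 := chK_two_aux ha N x y hxy (-1) (by norm_num)
  rcases abs_cases (chK a N x y) with h | h <;> linarith

lemma det_psd_le {N : ℕ} (A : Matrix (Fin N) (Fin N) ℝ) :
    A.det ^ 2 ≤ Real.exp ((∑ i, ∑ k, A i k ^ 2) - N) := by
  have hp : (A.conjTranspose * A).PosSemidef := Matrix.posSemidef_conjTranspose_mul_self A
  have h1 : (A.conjTranspose * A).det = A.det ^ 2 := by simp [sq]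
  have h2 : (A.conjTranspose * A).trace = ∑ i, ∑ k, A i k ^ 2 := by
    simp [Matrix.trace, Matrix.mul_apply, sq]
    exact Finset.sum_comm
  rw [← h1, ← h2, hp.isHermitian.det_eq_prod_eigenvalues, hp.isHermitian.trace_eq_sum_eigenvalues]
  have : (N : ℝ) = ∑ i : Fin N, (1:ℝ) := by simp
  rw [this]
  simp only [RCLike.ofReal_real_eq_id, id]
  rw [← Finset.sum_sub_distrib, Real.exp_sum]
  refine Finset.prod_le_prod (fun i _ => hp.eigenvalues_nonneg i) fun i _ => ?_
  have := Real.add_one_le_exp (hp.isHermitian.eigenvalues i - 1)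
  linarith

lemma chF_det {a : ℝ} (ha : 0 < a) (N : ℕ) (l : Fin N → ℕ) :
    (Matrix.of fun i k : Fin N => chF a k (l i)).det ^ 2 =
      (Matrix.vandermonde fun i => (l i : ℝ)).det ^ 2 * (∏ i, pw a (l i)) / ∏ k ∈ Finset.range N, (a ^ k * k.factorial) := by
  have h1 : (Matrix.of fun i k : Fin N => chF a k (l i)) =
     Matrix.diagonal (fun i => √(pw a (l i))) * (Matrix.of fun i k : Fin N => (chP a k).eval (l i : ℝ)) *
      Matrix.diagonal (fun k : Fin N => (√(a ^ (k:ℕ) * (k:ℕ).factorial))⁻¹) := by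
    ext i k
    simp [chF, Matrix.mul_diagonal, Matrix.diagonal_mul, div_eq_mul_inv]
  rw [h1, Matrix.det_mul, Matrix.det_mul, Matrix.det_diagonal, Matrix.det_diagonal,
    ← Matrix.det_eval_matrixOfPolynomials_eq_det_vandermonde (fun i => (l i : ℝ)) (fun k : Fin N => chP a k) 
      (fun i => (chP_monic a i).2) (fun i => (chP_monic a i).1)]
  have e1 : (∏ i, √(pw a (l i)))^2 = ∏ i, pw a (l i) := by
    rw [← Finset.prod_pow]
    exact Finset.prod_congr rfl fun i _ => Real.sq_sqrt (pw_pos ha _).le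
  have e2 : (∏ k : Fin N, (√(a ^ (k:ℕ) * (k:ℕ).factorial))⁻¹)^2 = (∏ k ∈ Finset.range N, (a ^ k * k.factorial))⁻¹ := by
    rw [← Finset.prod_pow, ← Finset.prod_inv_distrib, ← Fin.prod_univ_eq_prod_range (fun k => (a ^ k * (k.factorial : ℝ))⁻¹)]
    refine Finset.prod_congr rfl fun i _ => ?_
    rw [inv_pow, Real.sq_sqrt (by positivity)]
  rw [mul_pow, mul_pow, e1, e2]; simp only [div_eq_mul_inv]; ring

lemma chK_window {a : ℝ} (ha : 0 < a) (N : ℕ) (l : Fin N → ℕ) (hl : Function.Injective l) (W : Finset ℕ) :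
    ∑ x ∈ W, chK a N x (x+1) ^ 2 ≤ 2 * (N - ∑ i, chK a N (l i) (l i)) := by
  set L := Finset.univ.image l with hL
  have hLs : ∑ i, chK a N (l i) (l i) = ∑ x ∈ L, chK a N x x := by
    rw [hL, Finset.sum_image (fun _ _ _ _ h => hl h)]
  have hLc : (L.card : ℝ) = N := by
    rw [hL, Finset.card_image_of_injective _ hl]; simp
  have h1 : ∑ x ∈ W \ L, chK a N x x ≤ N - ∑ x ∈ L, chK a N x x := by
    have := sum_le_hasSum (L ∪ W \ L) (fun i _ => chK_nonneg a N i) (chK_hasSum ha N)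
    rw [Finset.sum_union Finset.disjoint_sdiff] at this
    linarith
  have h2 : ∑ x ∈ W ∩ L, (1 - chK a N x x) ≤ N - ∑ x ∈ L, chK a N x x := by
    calc _ ≤ ∑ x ∈ L, (1 - chK a N x x) := Finset.sum_le_sum_of_subset_of_nonneg Finset.inter_subset_right
            (fun i _ _ => by linarith [chK_le_one ha N i])
      _ = _ := by rw [Finset.sum_sub_distrib]; simp [hLc]
  rw [hLs, ← Finset.sum_inter_add_sum_sdiff W L]
  have h3 : ∑ x ∈ W ∩ L, chK a N x (x+1) ^ 2 ≤ ∑ x ∈ W ∩ L, (1 - chK a N x x) := by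
    refine Finset.sum_le_sum fun x _ => ?_
    have := chK_sq ha N x (x+1) (by omega)
    nlinarith [chK_le_one ha N x, chK_nonneg a N x]
  have h4 : ∑ x ∈ W \ L, chK a N x (x+1) ^ 2 ≤ ∑ x ∈ W \ L, chK a N x x := by
    refine Finset.sum_le_sum fun x _ => ?_
    have := chK_sq ha N x (x+1) (by omega)
    nlinarith [chK_le_one ha N x, chK_nonneg a N x]
  linarith

def chG (a : ℝ) (N x : ℕ) : ℝ := ((x:ℝ) - N) * chK a N x x + (if x < N then (N:ℝ) - x else 0)

lemma chG_hasSum {a : ℝ} (ha : 0 < a) (N : ℕ) : HasSum (chG a N) (N * a) := by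
  have h1 := (chK_hasSum_X ha N).sub ((chK_hasSum ha N).mul_left (N:ℝ))
  have h2 := hasSum_sum_of_ne_finset_zero (f := fun x : ℕ => if x < N then (N:ℝ) - x else 0) (s := Finset.range N)
    (L := .unconditional ℕ) (by intro b hb; simp at hb; simp [hb])
  have e : ∑ x ∈ Finset.range N, (if x < N then (N:ℝ) - x else 0) = N * (N + 1) / 2 := by
    have : ∑ x ∈ Finset.range N, (if x < N then (N:ℝ) - x else 0) = ∑ x ∈ Finset.range N, ((N:ℝ) - x) :=
      Finset.sum_congr rfl fun x hx => by simp [Finset.mem_range.1 hx]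
    rw [this, Finset.sum_sub_distrib]
    have h3 : ∀ M : ℕ, ∑ x ∈ Finset.range M, (x:ℝ) = M * (M - 1) / 2 := by
      intro M; induction M with
      | zero => simp
      | succ M ih => rw [Finset.sum_range_succ, ih]; push_cast; ring
    rw [h3]; simp; ring
  rw [e] at h2
  have h := h1.add h2
  have e2 : (N * a + N * (N - 1) / 2 - N * N + N * (N + 1) / 2 : ℝ) = N * a := by ring
  rw [e2] at h
  refine h.congr_fun ?_
  intro x
  simp only [chG]; ring

lemma chG_nonneg {a : ℝ} (ha : 0 < a) (N x : ℕ) : 0 ≤ chG a N x := by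
  unfold chG
  have h1 := chK_le_one ha N x
  have h2 := chK_nonneg a N x
  split_ifs with h
  · have : (x:ℝ) < N := by exact_mod_cast h
    nlinarith
  · have : (N:ℝ) ≤ x := by exact_mod_cast not_lt.1 h
    nlinarith

lemma sqrt_tail {c s R m : ℝ} {N : ℝ} (hc : 0 < c) (hs : 1 ≤ s) (hN : 1 ≤ N) (hsN : s < c * N)
    (hR : R = 36 * c + 5) (hm : R * s ≤ m) : √(N + m + 1) ≤ √N / (3 * s) * m := by
  have hR5 : 5 ≤ R := by rw [hR]; linarith
  have hm5 : 5 * s ≤ m := by nlinarith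
  have hm0 : 1 ≤ m := by nlinarith
  apply Real.sqrt_le_iff.2 ⟨by positivity, ?_⟩
  rw [mul_pow, div_pow, Real.sq_sqrt (by linarith), mul_pow, div_mul_eq_mul_div, le_div_iff₀ (by positivity)]
  have h1 : 25 * s ^ 2 ≤ m ^ 2 := by nlinarith
  have h2 : 36 * s ^ 2 ≤ m * N := by
    have h3 : 36 * s ≤ R * N := by rw [hR]; nlinarith
    have : 36 * s * s ≤ R * N * s := by gcongr
    have : R * s * N ≤ m * N := by gcongr
    nlinarith
  have h4 : 36 * s ^ 2 * m ≤ m * N * m := by gcongr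
  have h5 : 25 * s ^ 2 * N ≤ m ^ 2 * N := by gcongr
  have h6 : s ^ 2 * 1 ≤ s ^ 2 * m := by gcongr
  nlinarith

set_option maxHeartbeats 1600000 in
lemma ch_main (c : ℝ) (hc : 0 < c) : ∃ γ : ℝ, 0 < γ ∧ ∀ n N : ℕ, 0 < n → 0 < N → √(n:ℝ) < c * N →
    ∀ l : Fin N → ℕ, Function.Injective l →
      (Matrix.of fun i k : Fin N => chF ((n:ℝ)/N) k (l i)).det ^ 2 ≤ Real.exp (-γ * √(n:ℝ)) := by
  obtain ⟨R, hR⟩ : ∃ R, R = 36 * c + 5 := ⟨_, rfl⟩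
  have hR5 : 5 ≤ R := by rw [hR]; linarith
  refine ⟨1 / (40 * R * (3 + R * c)), by positivity, ?_⟩
  intro n N hn hN hsN l hl
  obtain ⟨s, hs⟩ : ∃ s, s = √(n:ℝ) := ⟨_, rfl⟩
  rw [← hs] at hsN ⊢
  have hn1 : (1:ℝ) ≤ n := by exact_mod_cast hn
  have hN1 : (1:ℝ) ≤ N := by exact_mod_cast hN
  have hs1 : 1 ≤ s := by rw [hs]; exact Real.one_le_sqrt.2 hn1
  have hss : s ^ 2 = n := by rw [hs]; exact Real.sq_sqrt (by linarith)
  obtain ⟨a, ha'⟩ : ∃ a, a = (n:ℝ)/N := ⟨_, rfl⟩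
  rw [← ha']
  have ha : 0 < a := by rw [ha']; positivity
  have hNa : N * a = s ^ 2 := by rw [ha', hss]; field_simp
  have hNsa : N * √a = s * √N := by
    rw [ha', Real.sqrt_div (by positivity), ← hs]
    have := Real.mul_self_sqrt (show (0:ℝ) ≤ N by positivity)
    have h0 : √(N:ℝ) ≠ 0 := by positivity
    field_simp
    linear_combination -this
  -- window
  obtain ⟨M, hM⟩ : ∃ M, M = ⌈R * s⌉₊ := ⟨_, rfl⟩
  have hM1 : R * s ≤ M := by rw [hM]; exact Nat.le_ceil _
  have hM2 : (M:ℝ) < R * s + 1 := by rw [hM]; exact Nat.ceil_lt_add_one (by positivity)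
  have hRs : 5 ≤ R * s := by nlinarith
  set W := Finset.Icc (N - M) (N + M) with hW
  have hWc : (W.card : ℝ) ≤ 5 * R * s := by
    have : W.card ≤ 2 * M + 1 := by rw [hW, Nat.card_Icc]; omega
    have : (W.card : ℝ) ≤ 2 * M + 1 := by exact_mod_cast this
    linarith
  obtain ⟨B, hB⟩ : ∃ B, B = √N * √(3 + R * c) := ⟨_, rfl⟩
  set q := √(N:ℝ) / (3 * s) with hq
  have hq0 : 0 ≤ q := by positivity
  have hpt : ∀ x : ℕ, √((x:ℝ)+1) * chK a N x (x+1) ≤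
      (if x ∈ W then B * |chK a N x (x+1)| else 0) + q / 2 * (chG a N x + 2 * chG a N (x+1)) := by
    intro x
    have g1 := chG_nonneg ha N x
    have g2 := chG_nonneg ha N (x+1)
    have k1 := chK_nonneg a N x
    have k2 := chK_nonneg a N (x+1)
    have k3 := chK_le_one ha N x
    have k4 := chK_le_one ha N (x+1)
    have hle := le_abs_self (chK a N x (x+1))
    have hab := abs_nonneg (chK a N x (x+1))
    by_cases hx : x ∈ W
    · rw [if_pos hx]
      have : √((x:ℝ)+1) ≤ B := by
        rw [hB, ← Real.sqrt_mul (by positivity)]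
        apply Real.sqrt_le_sqrt
        have : x ≤ N + M := (Finset.mem_Icc.1 hx).2
        have : (x:ℝ) ≤ N + M := by exact_mod_cast this
        nlinarith
      have : √((x:ℝ)+1) * chK a N x (x+1) ≤ B * |chK a N x (x+1)| := (mul_le_mul_of_nonneg_left hle (Real.sqrt_nonneg _)).trans (by gcongr)
      have : 0 ≤ q / 2 * (chG a N x + 2 * chG a N (x+1)) := by positivity
      linarith
    · rw [if_neg hx, zero_add]
      have hx' : N + M < x ∨ x + M < N := by
        rw [hW, Finset.mem_Icc] at hx; omega
      rcases hx' with hx' | hx'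
      · have h1 : ((N:ℝ) + M) < x := by exact_mod_cast hx'
        have h2 := sqrt_tail hc hs1 hN1 hsN hR (m := (x:ℝ) - N) (by linarith)
        rw [show (N:ℝ) + ((x:ℝ) - N) + 1 = x + 1 by ring, ← hq] at h2
        have h3 := chK_abs_le a N x (x+1)
        have e1 : chG a N x = ((x:ℝ) - N) * chK a N x x := by
          unfold chG; rw [if_neg (by omega), add_zero]
        have e2 : chG a N (x+1) = ((x:ℝ) + 1 - N) * chK a N (x+1) (x+1) := by
          unfold chG; rw [if_neg (by omega), add_zero]; push_cast; ring
        calc √((x:ℝ)+1) * chK a N x (x+1) ≤ (q * ((x:ℝ) - N)) * |chK a N x (x+1)| := (mul_le_mul_of_nonneg_left hle (Real.sqrt_nonneg _)).trans (by gcongr)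
          _ = q / 2 * (((x:ℝ) - N) * (2 * |chK a N x (x+1)|)) := by ring
          _ ≤ q / 2 * (((x:ℝ) - N) * (chK a N x x + chK a N (x+1) (x+1))) := by
            gcongr; linarith
          _ ≤ _ := by
            gcongr
            rw [e1, e2]
            nlinarith
      · have h1 : (x:ℝ) + M < N := by exact_mod_cast hx'
        have h2 := sqrt_tail hc hs1 hN1 hsN hR (m := (N:ℝ) - x) (by linarith)
        have h2' : √((x:ℝ)+1) ≤ q * ((N:ℝ) - x) := by
          refine le_trans (Real.sqrt_le_sqrt ?_) h2
          linarith
        have h3 := chK_two ha N x (x+1) (by omega)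
        have e1 : chG a N x = ((N:ℝ) - x) * (1 - chK a N x x) := by
          unfold chG; rw [if_pos (by omega)]; ring
        have e2 : chG a N (x+1) = ((N:ℝ) - x - 1) * (1 - chK a N (x+1) (x+1)) := by
          have : 5 ≤ M := by
            have : (5:ℝ) ≤ M := by linarith
            exact_mod_cast this
          unfold chG; rw [if_pos (by omega)]; push_cast; ring
        calc √((x:ℝ)+1) * chK a N x (x+1) ≤ (q * ((N:ℝ) - x)) * |chK a N x (x+1)| := (mul_le_mul_of_nonneg_left hle (Real.sqrt_nonneg _)).trans (by gcongr)
          _ = q / 2 * (((N:ℝ) - x) * (2 * |chK a N x (x+1)|)) := by ring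
          _ ≤ q / 2 * (((N:ℝ) - x) * ((1 - chK a N x x) + (1 - chK a N (x+1) (x+1)))) := by
            gcongr; linarith
          _ ≤ _ := by
            gcongr
            rw [e1, e2]
            nlinarith
  have hS1 : HasSum (fun x => if x ∈ W then B * |chK a N x (x+1)| else 0) (∑ x ∈ W, B * |chK a N x (x+1)|) := by
    have := hasSum_sum_of_ne_finset_zero (f := fun x : ℕ => if x ∈ W then B * |chK a N x (x+1)| else 0) (s := W)
      (L := .unconditional ℕ) (by intro b hb; simp [hb])
    have e : ∑ x ∈ W, (if x ∈ W then B * |chK a N x (x+1)| else 0) = ∑ x ∈ W, B * |chK a N x (x+1)| :=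
      Finset.sum_congr rfl fun x hx => if_pos hx
    rw [e] at this
    exact this
  have hG := chG_hasSum ha N
  have hG1 : HasSum (fun x => chG a N (x+1)) (N * a - chG a N 0) := by
    have := (hasSum_nat_add_iff' (f := chG a N) 1).2 hG
    simpa using this
  have hS := hS1.add ((hG.add (hG1.mul_left 2)).mul_left (q/2))
  have hle := hasSum_le hpt (chK_hasSum_shift ha N) hS
  rw [hNsa, hNa, ← Finset.mul_sum] at hle
  have hg0 := chG_nonneg ha N 0
  set Sk := ∑ x ∈ W, |chK a N x (x+1)| with hSk
  have hN0 : 0 < √(N:ℝ) := by positivity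
  have hqs : q / 2 * (s ^ 2 + 2 * (s ^ 2 - chG a N 0)) ≤ s * √N / 2 := by
    calc _ ≤ q / 2 * (3 * s ^ 2) := by gcongr; linarith
      _ = _ := by rw [hq]; field_simp
  have hk : s / 2 ≤ √(3 + R * c) * Sk := by
    have : √(N:ℝ) * (s/2) ≤ √(N:ℝ) * (√(3 + R * c) * Sk) := by rw [hB] at hle; nlinarith
    exact le_of_mul_le_mul_left this hN0
  have hk2 : s ^ 2 / 4 ≤ (3 + R * c) * Sk ^ 2 := by
    have := pow_le_pow_left₀ (by positivity) hk 2
    rw [mul_pow, Real.sq_sqrt (by positivity)] at this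
    linarith
  have hcs : Sk ^ 2 ≤ W.card * ∑ x ∈ W, chK a N x (x+1) ^ 2 := by
    have := sq_sum_le_card_mul_sum_sq (s := W) (f := fun x => |chK a N x (x+1)|)
    simpa using this
  set V := ∑ x ∈ W, chK a N x (x+1) ^ 2 with hV
  have hV0 : 0 ≤ V := Finset.sum_nonneg fun _ _ => sq_nonneg _
  have hk3 : s ^ 2 / 4 ≤ (3 + R * c) * (5 * R * s * V) := by
    refine hk2.trans ?_
    gcongr
    exact hcs.trans (by gcongr)
  have hk4 : s ≤ (20 * R * (3 + R * c)) * V := by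
    have : s * s ≤ s * ((20 * R * (3 + R * c)) * V) := by nlinarith
    exact le_of_mul_le_mul_left this (by linarith)
  have hwin := chK_window ha N l hl W
  refine (det_psd_le _).trans ?_
  apply Real.exp_le_exp.2
  have e : ∑ i : Fin N, ∑ k : Fin N, (Matrix.of fun i k : Fin N => chF a k (l i)) i k ^ 2 = ∑ i, chK a N (l i) (l i) := by
    refine Finset.sum_congr rfl fun i _ => ?_
    rw [chK, ← Fin.sum_univ_eq_sum_range (fun k => chF a k (l i) * chF a k (l i))]
    simp [sq]
  rw [e]
  have : 1 / (40 * R * (3 + R * c)) * s ≤ V / 2 := by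
    rw [div_mul_eq_mul_div, div_le_iff₀ (by positivity)]
    linarith
  linarith

lemma sum_det_updateRow {N : ℕ} (A B : Matrix (Fin N) (Fin N) ℝ) :
    ∑ i, (A.updateRow i (B i)).det = (B * A.adjugate).trace := by
  rw [Matrix.trace]
  refine Finset.sum_congr rfl fun i _ => ?_
  rw [← Matrix.cramer_transpose_apply, Matrix.cramer_eq_adjugate_mulVec, Matrix.diag_apply, Matrix.mul_apply,
    Matrix.mulVec, dotProduct]
  refine Finset.sum_congr rfl fun j _ => ?_
  rw [← Matrix.adjugate_transpose, Matrix.transpose_apply, mul_comm]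

lemma sum_det_mul {N : ℕ} (A M : Matrix (Fin N) (Fin N) ℝ) :
    ∑ i, (A.updateRow i ((A * M) i)).det = M.trace * A.det := by
  rw [sum_det_updateRow, Matrix.mul_assoc, Matrix.trace_mul_comm, Matrix.mul_assoc, Matrix.adjugate_mul]
  simp [mul_comm]

def VD {N : ℕ} (v : Fin N → ℝ) : ℝ := (Matrix.vandermonde v).det

lemma VD_up {N : ℕ} (v : Fin N → ℝ) : ∑ i, VD (Function.update v i (v i + 1)) = N * VD v := by
  have h := sum_det_mul (Matrix.vandermonde v) (Matrix.of fun j k : Fin N => (((k:ℕ).choose j : ℕ) : ℝ))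
  have ht : (Matrix.of fun j k : Fin N => (((k:ℕ).choose j : ℕ) : ℝ)).trace = N := by
    simp [Matrix.trace]
  rw [ht] at h
  rw [VD, ← h]
  refine Finset.sum_congr rfl fun i _ => ?_
  rw [VD]
  congr 1
  ext r k
  by_cases hr : r = i
  · subst hr
    simp only [Matrix.vandermonde_apply, Function.update_self, Matrix.updateRow_self, Matrix.mul_apply, Matrix.of_apply]
    rw [add_pow, Fin.sum_univ_eq_sum_range (fun j => v r ^ j * (((k:ℕ).choose j : ℕ) : ℝ)) N]
    rw [← Finset.sum_subset (Finset.range_subset_range.2 (Nat.succ_le_of_lt k.2))]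
    · simp
    · intro x _ hx
      rw [Nat.choose_eq_zero_of_lt (by simpa using hx)]; simp
  · simp [Matrix.vandermonde_apply, hr]

lemma VD_desc {N : ℕ} (v : Fin N → ℝ) : VD v = (Matrix.of fun i k : Fin N => (descPochhammer ℝ k).eval (v i)).det :=
  Matrix.det_eval_matrixOfPolynomials_eq_det_vandermonde v (fun k : Fin N => descPochhammer ℝ k)
    (fun i => descPochhammer_natDegree ℝ i) (fun i => monic_descPochhammer ℝ i)

lemma VD_down {N : ℕ} (v : Fin N → ℝ) :
    ∑ i, v i * VD (Function.update v i (v i - 1)) = (∑ i, v i - N * (N - 1) / 2) * VD v := by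
  set A : Matrix (Fin N) (Fin N) ℝ := Matrix.of fun i k : Fin N => (descPochhammer ℝ k).eval (v i) with hA
  have h1 := sum_det_mul A (Matrix.diagonal fun k : Fin N => (k:ℝ))
  have ht : (Matrix.diagonal fun k : Fin N => (k:ℝ)).trace = N * (N - 1) / 2 := by
    simp only [Matrix.trace_diagonal]
    rw [Fin.sum_univ_eq_sum_range (fun k => (k:ℝ))]
    generalize N = M
    induction M with
    | zero => simp
    | succ M ih => rw [Finset.sum_range_succ, ih]; push_cast; ring
  rw [ht] at h1
  have h3 : ∀ i, v i * VD (Function.update v i (v i - 1)) = v i * A.det - (A.updateRow i ((A * Matrix.diagonal fun k : Fin N => (k:ℝ)) i)).det := by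
    intro i
    have e1 : (Matrix.of fun r k : Fin N => (descPochhammer ℝ k).eval (Function.update v i (v i - 1) r))
       = A.updateRow i (fun k => (descPochhammer ℝ k).eval (v i - 1)) := by
      ext r k
      by_cases hr : r = i
      · subst hr; simp
      · simp [hr, hA]
    rw [VD_desc, e1, ← Matrix.det_updateRow_smul]
    have e2 : (v i • fun k : Fin N => (descPochhammer ℝ k).eval (v i - 1)) = v i • A i + (-1 : ℝ) • ((A * Matrix.diagonal fun k : Fin N => (k:ℝ)) i) := by
      ext k
      have p1 := congrArg (Polynomial.eval (v i)) (descPochhammer_succ_left ℝ k)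
      have p2 := congrArg (Polynomial.eval (v i)) (descPochhammer_succ_right ℝ k)
      rw [p1] at p2
      simp at p2
      simp [hA, Matrix.mul_diagonal]
      rw [p2]; ring
    rw [e2, Matrix.det_updateRow_add, Matrix.det_updateRow_smul, Matrix.det_updateRow_smul, Matrix.updateRow_eq_self]
    ring
  simp only [h3]
  rw [Finset.sum_sub_distrib, h1, ← Finset.sum_mul, VD_desc]
  ring

def VN {N : ℕ} (l : Fin N → ℕ) : ℝ := VD (fun i => (l i : ℝ))

def SN (N m : ℕ) : ℝ := ∑ l ∈ Finset.piAntidiag (Finset.univ : Finset (Fin N)) m, VN l ^ 2 / ∏ i, ((l i).factorial : ℝ)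

lemma cast_update {N : ℕ} (l : Fin N → ℕ) (i : Fin N) (t : ℕ) :
    (fun j => ((Function.update l i t j : ℕ) : ℝ)) = Function.update (fun j => (l j : ℝ)) i (t:ℝ) := by
  ext j
  by_cases h : j = i
  · subst h; simp
  · simp [h]

lemma SN_succ (N m : ℕ) : ((m:ℝ) + 1 - N * (N - 1) / 2) * SN N (m+1) = N * SN N m := by
  have h1 : ((m:ℝ) + 1 - N * (N - 1) / 2) * SN N (m+1) =
      ∑ i : Fin N, ∑ l ∈ Finset.piAntidiag (Finset.univ : Finset (Fin N)) (m+1),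
        (l i : ℝ) * VD (Function.update (fun j => (l j : ℝ)) i ((l i : ℝ) - 1)) * VN l / ∏ i, ((l i).factorial : ℝ) := by
    rw [Finset.sum_comm, SN, Finset.mul_sum]
    refine Finset.sum_congr rfl fun l hl => ?_
    have hs : (∑ i, (l i : ℝ)) = m + 1 := by
      have := (Finset.mem_piAntidiag.1 hl).1
      exact_mod_cast this
    have h2 := VD_down (fun j => (l j : ℝ))
    rw [hs] at h2
    rw [← Finset.sum_div, ← Finset.sum_mul, h2, VN]; ring
  have h2 : N * SN N m = ∑ i : Fin N, ∑ l ∈ Finset.piAntidiag (Finset.univ : Finset (Fin N)) m,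
      VN l * VD (Function.update (fun j => (l j : ℝ)) i ((l i : ℝ) + 1)) / ∏ i, ((l i).factorial : ℝ) := by
    rw [Finset.sum_comm, SN, Finset.mul_sum]
    refine Finset.sum_congr rfl fun l hl => ?_
    rw [← Finset.sum_div, ← Finset.mul_sum, VD_up, VN]; ring
  rw [h1, h2]
  refine Finset.sum_congr rfl fun i _ => ?_
  symm
  refine Finset.sum_of_injOn (fun l => Function.update l i (l i + 1)) ?_ ?_ ?_ ?_
  · intro l _ l' _ h
    simp only at h
    ext j
    have := congrFun h j
    by_cases hj : j = i
    · subst hj; simpa using this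
    · simpa [hj] using this
  · intro l hl
    simp only [Finset.mem_coe, Finset.mem_piAntidiag] at hl ⊢
    refine ⟨?_, by simp⟩
    rw [Finset.sum_update_of_mem (Finset.mem_univ i)]
    rw [← Finset.sum_sdiff (Finset.subset_univ {i})] at hl
    simp at hl ⊢; omega
  · intro l hl hn
    have : l i = 0 := by
      by_contra h0
      apply hn
      refine ⟨Function.update l i (l i - 1), ?_, ?_⟩
      · simp only [Finset.mem_coe, Finset.mem_piAntidiag] at hl ⊢
        refine ⟨?_, by simp⟩
        rw [Finset.sum_update_of_mem (Finset.mem_univ i)]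
        rw [← Finset.sum_sdiff (Finset.subset_univ {i})] at hl
        simp at hl ⊢; omega
      · ext j
        by_cases hj : j = i
        · subst hj; simp; omega
        · simp [hj]
    simp [this]
  · intro l hl
    simp only [Function.update_self]
    have e1 : VN (Function.update l i (l i + 1)) = VD (Function.update (fun j => (l j : ℝ)) i ((l i : ℝ) + 1)) := by
      rw [VN, cast_update]; push_cast; rfl
    have e2 : Function.update (fun j => ((Function.update l i (l i + 1) j : ℕ) : ℝ)) i (((l i + 1 : ℕ) : ℝ) - 1) = fun j => (l j : ℝ) := by
      rw [cast_update]; simp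
    have e3 : ∏ j, (((Function.update l i (l i + 1)) j).factorial : ℝ) = ((l i : ℝ) + 1) * ∏ j, ((l j).factorial : ℝ) := by
      rw [← Finset.mul_prod_erase _ _ (Finset.mem_univ i), ← Finset.mul_prod_erase (Finset.univ) (fun j => ((l j).factorial : ℝ)) (Finset.mem_univ i)]
      rw [Function.update_self, Nat.factorial_succ]
      have : ∏ x ∈ Finset.univ.erase i, (((Function.update l i (l i + 1)) x).factorial : ℝ) = ∏ x ∈ Finset.univ.erase i, ((l x).factorial : ℝ) :=
        Finset.prod_congr rfl fun x hx => by rw [Function.update_of_ne (Finset.ne_of_mem_erase hx)]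
      rw [this]; push_cast; ring
    rw [e1, e2, e3]
    have : (∏ j, ((l j).factorial : ℝ)) ≠ 0 := by positivity
    have h3 : ((l i : ℝ) + 1) ≠ 0 := by positivity
    push_cast
    rw [← VN]
    field_simp

lemma VD_perm {N : ℕ} (v : Fin N → ℝ) (σ : Equiv.Perm (Fin N)) : VD (v ∘ σ) ^ 2 = VD v ^ 2 := by
  have : Matrix.vandermonde (v ∘ σ) = (Matrix.vandermonde v).submatrix σ id := by
    ext i j; simp [Matrix.vandermonde_apply]
  rw [VD, this, Matrix.det_permute, mul_pow, VD]
  have : ((Equiv.Perm.sign σ : ℤ) : ℝ)^2 = 1 := by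
    rcases Int.units_eq_one_or (Equiv.Perm.sign σ) with h | h <;> simp [h]
  rw [this, one_mul]

lemma VN_id (N : ℕ) : VN (fun i : Fin N => (i:ℕ)) = ∏ k ∈ Finset.range N, (k.factorial : ℝ) := by
  cases N with
  | zero => simp [VN, VD]
  | succ n =>
    have h := Matrix.det_vandermonde_id_eq_superFactorial (R := ℝ) n
    rw [VN, VD, h]
    rw [← Nat.prod_range_succ_factorial]; push_cast; rfl

lemma SN_zero (N : ℕ) : (N.factorial : ℝ) * ∏ k ∈ Finset.range N, (k.factorial : ℝ) ≤ SN N (N * (N - 1) / 2) := by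
  set P := (Finset.univ : Finset (Equiv.Perm (Fin N))).image (fun σ => fun i : Fin N => ((σ i : Fin N) : ℕ)) with hP
  have hinj : Function.Injective (fun σ : Equiv.Perm (Fin N) => fun i : Fin N => ((σ i : Fin N) : ℕ)) := by
    intro σ τ h
    ext i
    exact congrFun h i
  have hsub : P ⊆ Finset.piAntidiag (Finset.univ : Finset (Fin N)) (N * (N - 1) / 2) := by
    intro l hl
    obtain ⟨σ, _, rfl⟩ := Finset.mem_image.1 hl
    refine Finset.mem_piAntidiag.2 ⟨?_, by simp⟩
    rw [Equiv.sum_comp σ (fun i : Fin N => (i:ℕ)), Fin.sum_univ_eq_sum_range (fun i => i), Finset.sum_range_id]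
  have h1 : ∑ l ∈ P, VN l ^ 2 / ∏ i, ((l i).factorial : ℝ) ≤ SN N (N * (N - 1) / 2) :=
    Finset.sum_le_sum_of_subset_of_nonneg hsub fun l _ _ => by positivity
  refine le_trans (le_of_eq ?_) h1
  rw [hP, Finset.sum_image (fun _ _ _ _ h => hinj h)]
  have : ∀ σ : Equiv.Perm (Fin N), VN (fun i : Fin N => ((σ i : Fin N) : ℕ)) ^ 2 / ∏ i, (((σ i : Fin N) : ℕ).factorial : ℝ)
    = ∏ k ∈ Finset.range N, (k.factorial : ℝ) := by
    intro σ
    have e1 : VN (fun i : Fin N => ((σ i : Fin N) : ℕ)) ^ 2 = VN (fun i : Fin N => (i:ℕ)) ^ 2 :=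
      VD_perm (fun i : Fin N => ((i:ℕ):ℝ)) σ
    rw [e1, VN_id, Equiv.prod_comp σ (fun i : Fin N => ((i:ℕ).factorial : ℝ)), Fin.prod_univ_eq_prod_range (fun i => (i.factorial : ℝ))]
    have : ∏ k ∈ Finset.range N, (k.factorial : ℝ) ≠ 0 := by positivity
    field_simp
  simp only [this]
  simp [Fintype.card_perm]

lemma SN_ge (N n : ℕ) : (N.factorial : ℝ) * (∏ k ∈ Finset.range N, (k.factorial : ℝ)) * (N:ℝ) ^ n / n.factorial ≤ SN N (n + N * (N - 1) / 2) := by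
  have hT : ((N * (N - 1) / 2 : ℕ) : ℝ) = N * (N - 1) / 2 := by
    rw [Nat.cast_div (Nat.even_mul_pred_self N).two_dvd (by norm_num)]
    cases N <;> simp
  induction n with
  | zero => simpa using SN_zero N
  | succ n ih =>
    have h := SN_succ N (n + N * (N - 1) / 2)
    push_cast [hT] at h
    rw [show n + 1 + N * (N - 1) / 2 = n + N * (N - 1) / 2 + 1 by ring]
    have h2 : SN N (n + N * (N - 1) / 2 + 1) = N * SN N (n + N * (N - 1) / 2) / (n + 1) := by
      rw [eq_div_iff (by positivity), ← h]; ring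
    rw [h2, Nat.factorial_succ]
    push_cast
    calc _ = N * ((N.factorial : ℝ) * (∏ k ∈ Finset.range N, (k.factorial : ℝ)) * (N:ℝ) ^ n / n.factorial) / (n+1) := by
            field_simp; ring
      _ ≤ _ := by gcongr

lemma maya_sum (N n : ℕ) (L : Finset ℕ) (hc : L.card = N) (hs : ∑ x ∈ L, x = n + N * (N - 1) / 2) :
    ∑ x ∈ symmDiff L (Finset.range N), ((x - N) + (N - x)) = n := by
  have h1 : (∑ x ∈ L, ((x:ℤ) - N)) - ∑ x ∈ Finset.range N, ((x:ℤ) - N) = n := by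
    rw [Finset.sum_sub_distrib, Finset.sum_sub_distrib]
    have e1 : ∑ x ∈ L, (x:ℤ) = n + (N * (N - 1) / 2 : ℕ) := by rw [← Nat.cast_sum, hs, Nat.cast_add]
    have e2 : ∑ x ∈ Finset.range N, (x:ℤ) = (N * (N - 1) / 2 : ℕ) := by rw [← Nat.cast_sum, Finset.sum_range_id]
    rw [e1, e2]; simp [hc]
  rw [← Finset.sum_sdiff_sub_sum_sdiff] at h1
  have h2 : symmDiff L (Finset.range N) = (L \ Finset.range N) ∪ (Finset.range N \ L) := rfl
  rw [h2, Finset.sum_union (by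
    rw [Finset.disjoint_left]; intro x hx hx'
    simp at hx hx'; omega)]
  have h3 : ((∑ x ∈ L \ Finset.range N, ((x - N) + (N - x)) : ℕ) : ℤ) = ∑ x ∈ L \ Finset.range N, ((x:ℤ) - N) := by
    push_cast
    refine Finset.sum_congr rfl fun x hx => ?_
    simp at hx; omega
  have h4 : ((∑ x ∈ Finset.range N \ L, ((x - N) + (N - x)) : ℕ) : ℤ) = - ∑ x ∈ Finset.range N \ L, ((x:ℤ) - N) := by
    push_cast
    rw [← Finset.sum_neg_distrib]
    refine Finset.sum_congr rfl fun x hx => ?_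
    simp at hx; omega
  omega

lemma geom_bound {q : ℝ} (h0 : 0 ≤ q) (h1 : q < 1) (M : ℕ) : ∑ j ∈ Finset.range M, q ^ j ≤ 1 / (1 - q) := by
  have := (summable_geometric_of_lt_one h0 h1).sum_le_tsum (Finset.range M) (fun i _ => by positivity)
  rw [tsum_geometric_of_lt_one h0 h1] at this
  simpa using this

lemma maya_count (N n : ℕ) (hn : 0 < n) (T : Finset (Finset ℕ))
    (hT : ∀ L ∈ T, L.card = N ∧ ∑ x ∈ L, x = n + N * (N - 1) / 2) :
    (T.card : ℝ) ≤ Real.exp (5 * √(n:ℝ)) := by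
  obtain ⟨s, hs⟩ : ∃ s, s = √(n:ℝ) := ⟨_, rfl⟩
  rw [← hs]
  have hn1 : (1:ℝ) ≤ n := by exact_mod_cast hn
  have hs1 : 1 ≤ s := by rw [hs]; exact Real.one_le_sqrt.2 hn1
  have hss : s ^ 2 = n := by rw [hs]; exact Real.sq_sqrt (by linarith)
  obtain ⟨q, hq⟩ : ∃ q, q = Real.exp (-(1/s)) := ⟨_, rfl⟩
  have hq0 : 0 < q := by rw [hq]; positivity
  have hq1 : 1 / (1 - q) ≤ 2 * s ∧ q < 1 := by
    have h1 : 1/s + 1 ≤ Real.exp (1/s) := Real.add_one_le_exp _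
    have h2 : q * Real.exp (1/s) = 1 := by rw [hq, ← Real.exp_add]; simp
    have h3 : q * (1/s + 1) ≤ 1 := (mul_le_mul_of_nonneg_left h1 hq0.le).trans h2.le
    have h4 : q * (1 + s) ≤ s := by
      have := mul_le_mul_of_nonneg_right h3 (show 0 ≤ s by linarith)
      have e : q * (1/s + 1) * s = q * (1 + s) := by field_simp
      linarith
    have h5 : q < 1 := by nlinarith
    refine ⟨?_, h5⟩
    rw [div_le_iff₀ (by linarith)]
    nlinarith
  have hw : ∑ x ∈ Finset.range (N + n + 1), q ^ ((x - N) + (N - x)) ≤ 4 * s := by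
    rw [add_assoc, Finset.sum_range_add]
    have a1 : ∑ x ∈ Finset.range N, q ^ ((x - N) + (N - x)) ≤ 1 / (1 - q) := by
      rw [← Finset.sum_range_reflect]
      refine le_trans (Finset.sum_le_sum (g := fun j => q ^ j) fun j hj => ?_) (geom_bound hq0.le hq1.2 N)
      apply pow_le_pow_of_le_one hq0.le hq1.2.le
      simp at hj; omega
    have a2 : ∑ x ∈ Finset.range (n+1), q ^ ((N + x - N) + (N - (N + x))) ≤ 1 / (1 - q) := by
      refine le_trans (Finset.sum_le_sum (g := fun j => q ^ j) fun j hj => ?_) (geom_bound hq0.le hq1.2 (n+1))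
      apply pow_le_pow_of_le_one hq0.le hq1.2.le
      omega
    linarith [hq1.1]
  have hinj : Set.InjOn (fun L : Finset ℕ => symmDiff L (Finset.range N)) T := by
    intro A _ B _ h
    exact symmDiff_left_injective _ h
  have key : (T.card : ℝ) * q ^ n ≤ Real.exp (4 * s) := by
    calc (T.card : ℝ) * q ^ n = ∑ L ∈ T, ∏ x ∈ symmDiff L (Finset.range N), q ^ ((x - N) + (N - x)) := by
          rw [← nsmul_eq_mul, ← Finset.sum_const]
          refine Finset.sum_congr rfl fun L hL => ?_
          rw [Finset.prod_pow_eq_pow_sum, maya_sum N n L (hT L hL).1 (hT L hL).2]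
      _ = ∑ D ∈ T.image (fun L : Finset ℕ => symmDiff L (Finset.range N)), ∏ x ∈ D, q ^ ((x - N) + (N - x)) := by
          rw [Finset.sum_image hinj]
      _ ≤ ∑ D ∈ (Finset.range (N + n + 1)).powerset, ∏ x ∈ D, q ^ ((x - N) + (N - x)) := by
          refine Finset.sum_le_sum_of_subset_of_nonneg ?_ fun D _ _ => Finset.prod_nonneg fun x _ => by positivity
          intro D hD
          obtain ⟨L, hL, rfl⟩ := Finset.mem_image.1 hD
          rw [Finset.mem_powerset]
          intro x hx
          have := Finset.single_le_sum (f := fun x => (x - N) + (N - x)) (fun _ _ => Nat.zero_le _) hx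
          simp only [maya_sum N n L (hT L hL).1 (hT L hL).2] at this
          simp; omega
      _ = ∏ x ∈ Finset.range (N + n + 1), (1 + q ^ ((x - N) + (N - x))) := by rw [Finset.prod_one_add]
      _ ≤ ∏ x ∈ Finset.range (N + n + 1), Real.exp (q ^ ((x - N) + (N - x))) := by
          refine Finset.prod_le_prod (fun x _ => by positivity) fun x _ => ?_
          rw [add_comm]; exact Real.add_one_le_exp _
      _ = Real.exp (∑ x ∈ Finset.range (N + n + 1), q ^ ((x - N) + (N - x))) := by rw [Real.exp_sum]
      _ ≤ _ := Real.exp_le_exp.2 hw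
  have hqn : q ^ n = Real.exp (-s) := by
    rw [hq, ← Real.exp_nat_mul, ← hss]; congr 1; field_simp
  rw [hqn] at key
  calc (T.card : ℝ) = (T.card : ℝ) * Real.exp (-s) * Real.exp s := by
        rw [mul_assoc, ← Real.exp_add]; simp
    _ ≤ Real.exp (4 * s) * Real.exp s := by gcongr
    _ = _ := by rw [← Real.exp_add]; congr 1; ring

lemma VN_zero_of_not_inj {N : ℕ} (l : Fin N → ℕ) (h : ¬ Function.Injective l) : VN l = 0 := by
  by_contra h0
  apply h
  have := Matrix.det_vandermonde_ne_zero_iff.1 h0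
  intro i j hij
  exact this (by simp [hij])

lemma exists_big (N n : ℕ) (hN : 0 < N) (hn : 0 < n) : ∃ l : Fin N → ℕ, Function.Injective l ∧
    ∑ i, l i = n + N * (N - 1) / 2 ∧
    (N:ℝ) ^ n * Real.exp (-5 * √(n:ℝ)) ≤ n.factorial * VN l ^ 2 / ((∏ i, ((l i).factorial : ℝ)) * ∏ k ∈ Finset.range N, (k.factorial : ℝ)) := by
  by_contra hcon
  push Not at hcon
  set PA := Finset.piAntidiag (Finset.univ : Finset (Fin N)) (n + N * (N - 1) / 2) with hPA
  set I := PA.filter (fun l => Function.Injective l) with hI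
  set T := I.image (fun l => Finset.univ.image l) with hT
  have hTc := maya_count N n hn T (by
    intro L hL
    obtain ⟨l, hl, rfl⟩ := Finset.mem_image.1 hL
    obtain ⟨h1, h2⟩ := Finset.mem_filter.1 hl
    refine ⟨by rw [Finset.card_image_of_injective _ h2]; simp, ?_⟩
    rw [Finset.sum_image (fun _ _ _ _ h => h2 h)]
    exact (Finset.mem_piAntidiag.1 h1).1)
  have hIc : I.card ≤ N.factorial * T.card := by
    refine Finset.card_le_mul_card_image I N.factorial ?_
    intro L hL
    have : (I.filter (fun l => Finset.univ.image l = L)).card ≤ Fintype.card (Fin N ↪ L) := by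
      rw [← Fintype.card_coe]
      refine Fintype.card_le_of_injective (fun l => ⟨fun i => ⟨l.1 i, ?_⟩, ?_⟩) ?_
      · have := (Finset.mem_filter.1 l.2).2
        have hm : l.1 i ∈ Finset.univ.image l.1 := by simp
        exact this.subset hm
      · intro i j hij
        have := (Finset.mem_filter.1 (Finset.mem_filter.1 l.2).1).2
        exact this (by simpa using hij)
      · intro l l' h
        ext i
        have := congrArg (fun e : Fin N ↪ L => (e i : ℕ)) h
        exact this
    refine this.trans ?_
    rw [Fintype.card_embedding_eq]
    obtain ⟨l, hl, rfl⟩ := Finset.mem_image.1 hL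
    have : Fintype.card (Finset.univ.image l : Finset ℕ) = N := by
      rw [Fintype.card_coe, Finset.card_image_of_injective _ (Finset.mem_filter.1 hl).2]; simp
    rw [this]; simp [Nat.descFactorial_self]
  set X := (∏ k ∈ Finset.range N, (k.factorial : ℝ)) * (N:ℝ) ^ n / n.factorial * Real.exp (-5 * √(n:ℝ)) with hX
  have hX0 : 0 < X := by positivity
  have hS := SN_ge N n
  have hSe : SN N (n + N * (N - 1) / 2) = ∑ l ∈ I, VN l ^ 2 / ∏ i, ((l i).factorial : ℝ) := by
    rw [SN, hI, Finset.sum_filter]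
    refine Finset.sum_congr rfl fun l _ => ?_
    split_ifs with h
    · rfl
    · rw [VN_zero_of_not_inj l h]; simp
  have hne : I.Nonempty := by
    by_contra h
    rw [Finset.not_nonempty_iff_eq_empty] at h
    rw [hSe, h, Finset.sum_empty] at hS
    have : 0 < (N.factorial : ℝ) * (∏ k ∈ Finset.range N, (k.factorial : ℝ)) * (N:ℝ) ^ n / n.factorial := by positivity
    linarith
  have hlt : SN N (n + N * (N - 1) / 2) < ∑ l ∈ I, X := by
    rw [hSe]
    refine Finset.sum_lt_sum_of_nonempty hne fun l hl => ?_
    obtain ⟨h1, h2⟩ := Finset.mem_filter.1 hl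
    have h3 := hcon l h2 (Finset.mem_piAntidiag.1 h1).1
    have p1 : 0 < ∏ i, ((l i).factorial : ℝ) := by positivity
    have p2 : 0 < ∏ k ∈ Finset.range N, (k.factorial : ℝ) := by positivity
    have p3 : (0:ℝ) < n.factorial := by positivity
    rw [div_lt_iff₀ (by positivity)] at h3
    rw [div_lt_iff₀ p1, hX]
    have e : (∏ k ∈ Finset.range N, (k.factorial : ℝ)) * (N:ℝ) ^ n / n.factorial * Real.exp (-5 * √(n:ℝ)) * ∏ i, ((l i).factorial : ℝ)
      = ((N:ℝ) ^ n * Real.exp (-5 * √(n:ℝ)) * ((∏ i, ((l i).factorial : ℝ)) * ∏ k ∈ Finset.range N, (k.factorial : ℝ))) / n.factorial := by ring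
    rw [e, lt_div_iff₀ p3]
    linarith
  rw [Finset.sum_const, nsmul_eq_mul] at hlt
  have hfin : (I.card : ℝ) * X ≤ (N.factorial : ℝ) * (∏ k ∈ Finset.range N, (k.factorial : ℝ)) * (N:ℝ) ^ n / n.factorial := by
    calc (I.card : ℝ) * X ≤ ((N.factorial : ℝ) * T.card) * X := by
          gcongr; exact_mod_cast hIc
      _ ≤ ((N.factorial : ℝ) * Real.exp (5 * √(n:ℝ))) * X := by gcongr
      _ = (N.factorial : ℝ) * (∏ k ∈ Finset.range N, (k.factorial : ℝ)) * (N:ℝ) ^ n / n.factorial * (Real.exp (5 * √(n:ℝ)) * Real.exp (-5 * √(n:ℝ))) := by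
          rw [hX]; ring
      _ = _ := by rw [← Real.exp_add]; simp
  linarith

def rowList {n : ℕ} (lam : Nat.Partition n) : List ℕ := (lam.parts.sort (· ≤ ·)).reverse

lemma rowLen_succ {n : ℕ} (lam : Nat.Partition n) (i : ℕ) : rowLen lam (i+1) = (rowList lam).getD i 0 := rfl

lemma rowList_pw {n : ℕ} (lam : Nat.Partition n) : (rowList lam).Pairwise (· ≥ ·) := by
  unfold rowList
  rw [List.pairwise_reverse]
  exact lam.parts.pairwise_sort (· ≤ ·)

lemma rowList_coe {n : ℕ} (lam : Nat.Partition n) : (rowList lam : Multiset ℕ) = lam.parts := by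
  unfold rowList
  rw [← Multiset.coe_reverse, List.reverse_reverse, Multiset.sort_eq]

lemma rowList_len {n : ℕ} (lam : Nat.Partition n) : (rowList lam).length = lam.parts.card := by
  rw [← rowList_coe]; rfl

lemma rowList_sum {n : ℕ} (lam : Nat.Partition n) : (rowList lam).sum = n := by
  refine Eq.trans ?_ lam.parts_sum
  rw [← rowList_coe]; rfl

lemma getD_anti (L : List ℕ) (h : L.Pairwise (· ≥ ·)) {i k : ℕ} (hik : i ≤ k) : L.getD k 0 ≤ L.getD i 0 := by
  by_cases hk : k < L.length
  · rcases hik.eq_or_lt with rfl | hlt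
    · rfl
    · rw [List.getD_eq_getElem _ _ hk, List.getD_eq_getElem _ _ (hlt.trans hk)]
      exact List.pairwise_iff_getElem.1 h i k _ _ hlt
  · rw [List.getD_eq_default _ _ (by omega)]; exact Nat.zero_le _

lemma getD_sum (L : List ℕ) : ∀ N, L.length ≤ N → ∑ i ∈ Finset.range N, L.getD i 0 = L.sum := by
  induction L with
  | nil => intro N _; simp
  | cons a L ih =>
    intro N hN
    obtain ⟨M, rfl⟩ : ∃ M, N = M + 1 := ⟨N - 1, by simp at hN; omega⟩
    rw [Finset.sum_range_succ', List.sum_cons, ← ih M (by simpa using hN)]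
    simp [add_comm]

lemma getD_filter (L : List ℕ) (h : L.Pairwise (· ≥ ·)) : ∀ i, (L.filter (· ≠ 0)).getD i 0 = L.getD i 0 := by
  induction L with
  | nil => intro i; simp
  | cons a L ih =>
    rw [List.pairwise_cons] at h
    intro i
    by_cases ha : a = 0
    · subst ha
      have hz : ∀ x ∈ L, x = 0 := fun x hx => by have := h.1 x hx; omega
      have e : (0 :: L).filter (· ≠ 0) = [] := by
        rw [List.filter_eq_nil_iff]; intro x hx
        simp at hx; rcases hx with rfl | hx
        · simp
        · simp [hz x hx]
      rw [e]
      by_cases hi : i < (0 :: L).length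
      · rw [List.getD_eq_getElem _ _ hi]
        have := List.getElem_mem hi
        simp only [List.mem_cons] at this
        rcases this with h' | h'
        · simpa using h'.symm
        · simpa using (hz _ h').symm
      · rw [List.getD_eq_default (0 :: L) _ (by omega)]; simp
    · rw [List.filter_cons_of_pos (by simpa using ha)]
      cases i with
      | zero => simp
      | succ i => simpa using ih h.2 i

lemma card_parts_le {n : ℕ} (lam : Nat.Partition n) : lam.parts.card ≤ n := by
  have h := Multiset.card_nsmul_le_sum (s := lam.parts) (a := 1) (fun x hx => lam.parts_pos hx)
  rw [lam.parts_sum] at h; simpa using h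

lemma rowLen_anti {n : ℕ} (lam : Nat.Partition n) {i k : ℕ} (h1 : 1 ≤ i) (hik : i ≤ k) : rowLen lam k ≤ rowLen lam i :=
  getD_anti _ (rowList_pw lam) (by omega)

lemma rowLen_zero {n : ℕ} (lam : Nat.Partition n) {i : ℕ} (h : lam.parts.card < i) : rowLen lam i = 0 := by
  obtain ⟨j, rfl⟩ : ∃ j, i = j + 1 := ⟨i - 1, by omega⟩
  rw [rowLen_succ, List.getD_eq_default]
  rw [rowList_len]; omega

lemma rowLen_sum {n : ℕ} (lam : Nat.Partition n) {N : ℕ} (h : lam.parts.card ≤ N) :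
    ∑ i : Fin N, rowLen lam (i+1) = n := by
  rw [Fin.sum_univ_eq_sum_range (fun i => rowLen lam (i+1))]
  simp only [rowLen_succ]
  rw [getD_sum _ _ (by rwa [rowList_len]), rowList_sum]

lemma rowLen_le {n : ℕ} (lam : Nat.Partition n) {i : ℕ} (hi : 1 ≤ i) : rowLen lam i ≤ n := by
  by_cases h : lam.parts.card < i
  · rw [rowLen_zero lam h]; exact Nat.zero_le _
  · have := rowLen_sum lam (le_refl _)
    conv_rhs => rw [← this]
    have := Finset.single_le_sum (f := fun j : Fin lam.parts.card => rowLen lam (j+1)) (fun _ _ => Nat.zero_le _) (Finset.mem_univ ⟨i - 1, by omega⟩)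
    simp only [Nat.sub_add_cancel hi] at this
    exact this

lemma le_colLen {n : ℕ} (lam : Nat.Partition n) {j k : ℕ} (hj : 1 ≤ j) (hk : 1 ≤ k) :
    k ≤ colLen lam j ↔ j ≤ rowLen lam k := by
  unfold colLen
  constructor
  · intro h
    by_contra hc
    have : (Finset.Icc 1 n).filter (fun i => j ≤ rowLen lam i) ⊆ Finset.Icc 1 (k-1) := by
      intro i hi
      simp at hi
      simp
      refine ⟨hi.1.1, ?_⟩
      by_contra h'
      have := rowLen_anti lam hk (show k ≤ i by omega)
      omega
    have := Finset.card_le_card this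
    simp at this; omega
  · intro h
    have : Finset.Icc 1 k ⊆ (Finset.Icc 1 n).filter (fun i => j ≤ rowLen lam i) := by
      intro i hi
      simp at hi
      simp
      have h1 := rowLen_anti lam hi.1 hi.2
      refine ⟨⟨hi.1, ?_⟩, by omega⟩
      by_contra h'
      have := rowLen_zero lam (i := i) (by have := card_parts_le lam; omega)
      omega
    have := Finset.card_le_card this
    simpa using this

def lof {n : ℕ} (N : ℕ) (lam : Nat.Partition n) : Fin N → ℕ := fun i => rowLen lam (i+1) + (N - 1 - i)

lemma lof_lt {n N : ℕ} (lam : Nat.Partition n) {i k : Fin N} (h : i < k) : lof N lam k < lof N lam i := by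
  unfold lof
  have := rowLen_anti lam (i := i+1) (k := k+1) (by omega) (by have : (i:ℕ) < k := h; omega)
  have : (i:ℕ) < k := h
  omega

lemma lof_inj {n N : ℕ} (lam : Nat.Partition n) : Function.Injective (lof N lam) :=
  (show StrictAnti (lof N lam) from fun _ _ h => lof_lt lam h).injective

lemma lof_sum {n N : ℕ} (lam : Nat.Partition n) (h : lam.parts.card ≤ N) : ∑ i, lof N lam i = n + N * (N - 1) / 2 := by
  unfold lof
  rw [Finset.sum_add_distrib, rowLen_sum lam h, Fin.sum_univ_eq_sum_range (fun i => N - 1 - i),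
    Finset.sum_range_reflect (fun i => i), Finset.sum_range_id]

lemma prod_Icc_fact (m : ℕ) : ∏ x ∈ Finset.Icc 1 m, x = m.factorial := by
  induction m with
  | zero => simp
  | succ m ih => rw [Finset.prod_Icc_succ_top (by omega), ih, Nat.factorial_succ, mul_comm]

lemma hook_row {n N : ℕ} (lam : Nat.Partition n) (h : lam.parts.card ≤ N) (i : Fin N) :
    (∏ j ∈ Finset.Icc 1 (rowLen lam (i+1)), hookLen lam (i+1) j) * ∏ k ∈ Finset.Ioi i, (lof N lam i - lof N lam k)
      = (lof N lam i).factorial := by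
  have hcN : ∀ j, 1 ≤ j → colLen lam j ≤ N := by
    intro j hj
    by_contra hc
    have := (le_colLen lam hj (show 1 ≤ N + 1 by omega)).1 (by omega)
    rw [rowLen_zero lam (by omega)] at this; omega
  have hci : ∀ j, 1 ≤ j → j ≤ rowLen lam (i+1) → (i:ℕ)+1 ≤ colLen lam j := fun j hj h' =>
    (le_colLen lam hj (by omega)).2 h'
  have hanti : ∀ j j', 1 ≤ j → j ≤ j' → colLen lam j' ≤ colLen lam j := by
    intro j j' hj hjj
    unfold colLen
    apply Finset.card_le_card
    intro x; simp only [Finset.mem_filter]; rintro ⟨a, b⟩; exact ⟨a, by omega⟩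
  have i1 : Set.InjOn (hookLen lam (i+1)) (Finset.Icc 1 (rowLen lam (i+1)) : Finset ℕ) := by
    intro j hj j' hj' e
    simp at hj hj'
    unfold hookLen at e
    have a := hci j hj.1 hj.2
    have b := hci j' hj'.1 hj'.2
    rcases le_total j j' with hl | hl
    · have := hanti j j' hj.1 hl; omega
    · have := hanti j' j hj'.1 hl; omega
  have i2 : Set.InjOn (fun k => lof N lam i - lof N lam k) (Finset.Ioi i : Finset (Fin N)) := by
    intro k hk k' hk' e
    simp at hk hk'
    have a := lof_lt lam hk
    have b := lof_lt lam hk'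
    apply lof_inj lam
    simp only at e; omega
  have hd : Disjoint ((Finset.Icc 1 (rowLen lam (i+1))).image (hookLen lam (i+1)))
      ((Finset.Ioi i).image (fun k => lof N lam i - lof N lam k)) := by
    rw [Finset.disjoint_left]
    rintro x hx hx'
    obtain ⟨j, hj, rfl⟩ := Finset.mem_image.1 hx
    obtain ⟨k, hk, e⟩ := Finset.mem_image.1 hx'
    simp at hj hk
    have a := hci j hj.1 hj.2
    have b := lof_lt lam hk
    have hik : (i:ℕ) < k := hk
    have hkN := k.2
    have d := le_colLen lam hj.1 (show 1 ≤ (k:ℕ)+1 by omega)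
    unfold hookLen at e
    unfold lof at e b
    by_cases hkc : (k:ℕ)+1 ≤ colLen lam j
    · have := d.1 hkc; omega
    · have : ¬ j ≤ rowLen lam (k+1) := fun h => hkc (d.2 h)
      omega
  have hU : ((Finset.Icc 1 (rowLen lam (i+1))).image (hookLen lam (i+1))) ∪
      ((Finset.Ioi i).image (fun k => lof N lam i - lof N lam k)) = Finset.Icc 1 (lof N lam i) := by
    apply Finset.eq_of_subset_of_card_le
    · intro x hx
      rcases Finset.mem_union.1 hx with hx | hx
      · obtain ⟨j, hj, rfl⟩ := Finset.mem_image.1 hx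
        simp at hj
        have a := hci j hj.1 hj.2
        have b := hcN j hj.1
        simp [hookLen, lof]; omega
      · obtain ⟨k, hk, rfl⟩ := Finset.mem_image.1 hx
        simp at hk
        have b := lof_lt lam hk
        simp; omega
    · rw [Finset.card_union_of_disjoint hd, Finset.card_image_of_injOn i1, Finset.card_image_of_injOn i2]
      simp [lof]
  rw [← prod_Icc_fact, ← hU, Finset.prod_union hd, Finset.prod_image i1, Finset.prod_image i2]

lemma prod_cells {n N : ℕ} (lam : Nat.Partition n) (h : lam.parts.card ≤ N) (f : ℕ × ℕ → ℝ) :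
    ∏ p ∈ cellsOf lam, f p = ∏ i : Fin N, ∏ j ∈ Finset.Icc 1 (rowLen lam (i+1)), f (i+1, j) := by
  rw [Finset.prod_finset_product (cellsOf lam) (Finset.Ico (0+1) (N+1)) (fun i => Finset.Icc 1 (rowLen lam i))]
  · rw [← Finset.prod_Ico_add' (fun i => ∏ j ∈ Finset.Icc 1 (rowLen lam i), f (i, j)), ← Finset.range_eq_Ico,
      ← Fin.prod_univ_eq_prod_range (fun i => ∏ j ∈ Finset.Icc 1 (rowLen lam (i+1)), f (i+1, j))]
  · rintro ⟨i, j⟩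
    simp only [cellsOf, Finset.mem_filter, Finset.mem_product, Finset.mem_Icc, Finset.mem_Ico]
    constructor
    · rintro ⟨⟨⟨a, b⟩, c, d⟩, e⟩
      refine ⟨⟨by omega, ?_⟩, c, e⟩
      by_contra hc
      rw [rowLen_zero lam (by omega)] at e; omega
    · rintro ⟨⟨a, b⟩, c, d⟩
      have := rowLen_le lam (i := i) (by omega)
      refine ⟨⟨⟨by omega, ?_⟩, c, by omega⟩, d⟩
      by_contra hc
      rw [rowLen_zero lam (by have := card_parts_le lam; omega)] at d; omega

lemma prod_shift (a m : ℕ) : (∏ j ∈ Finset.Icc 1 m, ((a:ℝ) + j)) * a.factorial = (a + m).factorial := by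
  induction m with
  | zero => simp
  | succ m ih =>
    rw [Finset.prod_Icc_succ_top (by omega), mul_right_comm, ih, ← add_assoc, Nat.factorial_succ]
    push_cast; ring

lemma dimE_eq {n N : ℕ} (lam : Nat.Partition n) (h : lam.parts.card ≤ N) :
    dimE n N lam = n.factorial * VN (lof N lam) ^ 2 / ((∏ i, ((lof N lam i).factorial : ℝ)) * ∏ k ∈ Finset.range N, (k.factorial : ℝ)) := by
  have hC : (∏ p ∈ cellsOf lam, ((N : ℝ) + (p.2 : ℝ) - (p.1 : ℝ))) * ∏ k ∈ Finset.range N, (k.factorial : ℝ)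
      = ∏ i, ((lof N lam i).factorial : ℝ) := by
    rw [prod_cells lam h, ← Finset.prod_range_reflect,
      ← Fin.prod_univ_eq_prod_range (fun j => ((N - 1 - j).factorial : ℝ)), ← Finset.prod_mul_distrib]
    refine Finset.prod_congr rfl fun i _ => ?_
    have e : lof N lam i = (N - 1 - i) + rowLen lam (i+1) := add_comm _ _
    rw [e, ← prod_shift]
    congr 1
    refine Finset.prod_congr rfl fun j _ => ?_
    have := i.2
    rw [Nat.sub_sub, Nat.cast_sub (by omega)]
    push_cast; ring
  have hH : (∏ p ∈ cellsOf lam, (hookLen lam p.1 p.2 : ℝ)) * ∏ i : Fin N, ∏ k ∈ Finset.Ioi i, ((lof N lam i : ℝ) - lof N lam k)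
      = ∏ i, ((lof N lam i).factorial : ℝ) := by
    rw [prod_cells lam h, ← Finset.prod_mul_distrib]
    refine Finset.prod_congr rfl fun i _ => ?_
    rw [← hook_row lam h i]
    push_cast
    congr 1
    refine Finset.prod_congr rfl fun k hk => ?_
    rw [Nat.cast_sub (lof_lt lam (Finset.mem_Ioi.1 hk)).le]
  have hV : VN (lof N lam) ^ 2 = (∏ i : Fin N, ∏ k ∈ Finset.Ioi i, ((lof N lam i : ℝ) - lof N lam k)) ^ 2 := by
    rw [VN, VD, Matrix.det_vandermonde]
    simp only [← Finset.prod_pow]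
    refine Finset.prod_congr rfl fun i _ => Finset.prod_congr rfl fun k _ => by ring
  unfold dimE
  rw [hV]
  have p1 : 0 < ∏ i, ((lof N lam i).factorial : ℝ) := by positivity
  have p2 : 0 < ∏ k ∈ Finset.range N, (k.factorial : ℝ) := by positivity
  generalize (∏ p ∈ cellsOf lam, ((N : ℝ) + (p.2 : ℝ) - (p.1 : ℝ))) = C at *
  generalize (∏ p ∈ cellsOf lam, (hookLen lam p.1 p.2 : ℝ)) = H at *
  generalize (∏ i : Fin N, ∏ k ∈ Finset.Ioi i, ((lof N lam i : ℝ) - lof N lam k)) = V at *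
  generalize (∏ i, ((lof N lam i).factorial : ℝ)) = P at *
  generalize (∏ k ∈ Finset.range N, (k.factorial : ℝ)) = F at *
  have hH0 : H ≠ 0 := by rintro rfl; simp at hH; exact p1.ne hH
  rw [div_eq_div_iff (by positivity) (by positivity)]
  calc (n.factorial:ℝ) * C * (P * F) = n.factorial * (C * F) * P := by ring
    _ = n.factorial * (H * V) * (H * V) := by rw [hC, hH]
    _ = _ := by ring

lemma strictAnti_gap {N : ℕ} (m : Fin N → ℕ) (hm : StrictAnti m) (d : ℕ) :
    ∀ i k : Fin N, (k:ℕ) = i + d → m k + d ≤ m i := by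
  induction d with
  | zero => intro i k h; have : k = i := Fin.ext h; simp [this]
  | succ d ih =>
    intro i k h
    have := ih i ⟨i + d, by have := k.2; omega⟩ rfl
    have h2 := hm (show (⟨i + d, by have := k.2; omega⟩ : Fin N) < k from by rw [Fin.lt_def]; simp; omega)
    omega

lemma exists_lam {n N : ℕ} (m : Fin N → ℕ) (hm : StrictAnti m) (hs : ∑ i, m i = n + N * (N - 1) / 2) :
    ∃ lam : Nat.Partition n, lam.parts.card ≤ N ∧ lof N lam = m := by
  obtain ⟨v, hv⟩ : ∃ v : Fin N → ℕ, v = fun i => m i - (N - 1 - i) := ⟨_, rfl⟩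
  have hge : ∀ i : Fin N, N - 1 - i ≤ m i := by
    intro i
    have := i.2
    have := strictAnti_gap m hm (N - 1 - i) i ⟨N - 1, by omega⟩ (by simp; omega)
    omega
  have hmv : ∀ i, m i = v i + (N - 1 - i) := by intro i; rw [hv]; have := hge i; simp only; omega
  have hva : Antitone v := by
    intro i k hik
    have hik' : (i:ℕ) ≤ k := hik
    have h1 := strictAnti_gap m hm (k - i) i k (by omega)
    have h2 := hmv i
    have h3 := hmv k
    have := k.2
    omega
  have hvs : ∑ i, v i = n := by
    simp only [hmv] at hs
    rw [Finset.sum_add_distrib, Fin.sum_univ_eq_sum_range (fun i => N - 1 - i),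
      Finset.sum_range_reflect (fun i => i), Finset.sum_range_id] at hs
    omega
  have hls : (List.ofFn v).Pairwise (· ≥ ·) := by
    rw [List.pairwise_ofFn]; intro i j hij; exact hva hij.le
  obtain ⟨lam, hlam⟩ : ∃ lam : Nat.Partition n, lam.parts = ((List.ofFn v : List ℕ) : Multiset ℕ).filter (· ≠ 0) := by
    refine ⟨Nat.Partition.ofSums n (List.ofFn v : List ℕ) ?_, rfl⟩
    rw [Multiset.sum_coe, List.sum_ofFn, hvs]
  have hrl : rowList lam = (List.ofFn v).filter (· ≠ 0) := by
    refine List.Perm.eq_of_pairwise (le := (· ≥ ·)) (fun a b _ _ h1 h2 => le_antisymm h2 h1) (rowList_pw lam) (hls.filter _) ?_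
    rw [← Multiset.coe_eq_coe, rowList_coe, hlam, Multiset.filter_coe]
  refine ⟨lam, ?_, ?_⟩
  · rw [hlam]
    refine (Multiset.card_le_card (Multiset.filter_le _ _)).trans ?_
    simp
  · funext i
    rw [lof, rowLen_succ, hrl, getD_filter _ hls, hmv, List.getD_eq_getElem _ _ (by simp)]
    simp

lemma exists_lam' {n N : ℕ} (l : Fin N → ℕ) (hl : Function.Injective l) (hs : ∑ i, l i = n + N * (N - 1) / 2) :
    ∃ lam ∈ YNN n N, dimE n N lam = n.factorial * VN l ^ 2 / ((∏ i, ((l i).factorial : ℝ)) * ∏ k ∈ Finset.range N, (k.factorial : ℝ)) := by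
  obtain ⟨σ, hσ⟩ : ∃ σ : Equiv.Perm (Fin N), σ = Fin.revPerm.trans (Tuple.sort l) := ⟨_, rfl⟩
  have hmono := Tuple.monotone_sort l
  have hanti : StrictAnti (l ∘ σ) := by
    apply Antitone.strictAnti_of_injective
    · intro i k hik
      rw [hσ]
      exact hmono (Fin.rev_le_rev.2 hik)
    · exact hl.comp σ.injective
  obtain ⟨lam, h1, h2⟩ := exists_lam (n := n) (l ∘ σ) hanti (by
    rw [← hs]; exact Equiv.sum_comp σ l)
  refine ⟨lam, by simp [YNN, h1], ?_⟩
  rw [dimE_eq lam h1, h2]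
  have e1 : VN (l ∘ σ) ^ 2 = VN l ^ 2 := VD_perm (fun i => (l i : ℝ)) σ
  have e2 : ∏ i, (((l ∘ σ) i).factorial : ℝ) = ∏ i, ((l i).factorial : ℝ) := Equiv.prod_comp σ (fun i => ((l i).factorial : ℝ))
  rw [e1, e2]

lemma fact_bound (n : ℕ) (hn : 1 ≤ n) : (n.factorial : ℝ) ≤ Real.exp 1 * n * ((n:ℝ) ^ n * Real.exp (-(n:ℝ))) := by
  induction n, hn using Nat.le_induction with
  | base => simp [← Real.exp_add]
  | succ n hn ih =>
    have hn0 : (0:ℝ) < n := by exact_mod_cast hn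
    have h1 : (n:ℝ) ≤ (n+1) * Real.exp (-(1/((n:ℝ)+1))) := by
      have := Real.add_one_le_exp (-(1/((n:ℝ)+1)))
      have h2 := mul_le_mul_of_nonneg_left this (show (0:ℝ) ≤ n+1 by positivity)
      have e : ((n:ℝ)+1) * (-(1/((n:ℝ)+1)) + 1) = n := by field_simp; ring
      linarith
    have h2 : (n:ℝ)^(n+1) ≤ ((n:ℝ)+1)^(n+1) * Real.exp (-1) := by
      have := pow_le_pow_left₀ hn0.le h1 (n+1)
      rw [mul_pow, ← Real.exp_nat_mul] at this
      have e : ((n+1:ℕ):ℝ) * (-(1/((n:ℝ)+1))) = -1 := by push_cast; field_simp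
      rwa [e] at this
    rw [Nat.factorial_succ]
    push_cast
    calc ((n:ℝ)+1) * n.factorial ≤ ((n:ℝ)+1) * (Real.exp 1 * n * ((n:ℝ) ^ n * Real.exp (-(n:ℝ)))) := by gcongr
      _ = Real.exp 1 * ((n:ℝ)+1) * (n:ℝ)^(n+1) * Real.exp (-(n:ℝ)) := by ring
      _ ≤ Real.exp 1 * ((n:ℝ)+1) * (((n:ℝ)+1)^(n+1) * Real.exp (-1)) * Real.exp (-(n:ℝ)) := by gcongr
      _ = Real.exp 1 * ((n:ℝ)+1) * (((n:ℝ)+1)^(n+1) * (Real.exp (-1) * Real.exp (-(n:ℝ)))) := by ring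
      _ = _ := by rw [← Real.exp_add]; congr 4; ring

lemma det_dim (n N : ℕ) (hn : 0 < n) (hN : 0 < N) (l : Fin N → ℕ) (hs : ∑ i, l i = n + N * (N - 1) / 2) :
    (Matrix.of fun i k : Fin N => chF ((n:ℝ)/N) k (l i)).det ^ 2 =
      Real.exp (-(n:ℝ)) * ((n:ℝ)/N)^n * (VN l ^ 2 / ((∏ i, ((l i).factorial : ℝ)) * ∏ k ∈ Finset.range N, (k.factorial : ℝ))) := by
  have hn0 : (0:ℝ) < n := by exact_mod_cast hn
  have hN0 : (0:ℝ) < N := by exact_mod_cast hN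
  have ha : 0 < (n:ℝ)/N := by positivity
  rw [chF_det ha]
  have e1 : ∏ i, pw ((n:ℝ)/N) (l i) = Real.exp (-(n:ℝ)) * (((n:ℝ)/N)^n * ((n:ℝ)/N)^(N * (N - 1) / 2)) / ∏ i, ((l i).factorial : ℝ) := by
    simp only [pw]
    rw [Finset.prod_mul_distrib, Finset.prod_div_distrib, Finset.prod_pow_eq_pow_sum, hs, Finset.prod_const, ← Real.exp_nat_mul, pow_add]
    rw [show ((Finset.univ : Finset (Fin N)).card : ℝ) * -((n:ℝ)/N) = -n by simp; field_simp]
    ring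
  have e2 : ∏ k ∈ Finset.range N, (((n:ℝ)/N) ^ k * (k.factorial:ℝ)) = ((n:ℝ)/N)^(N * (N - 1) / 2) * ∏ k ∈ Finset.range N, (k.factorial : ℝ) := by
    rw [Finset.prod_mul_distrib, Finset.prod_pow_eq_pow_sum, Finset.sum_range_id]
  rw [e1, e2]
  have p1 : 0 < ∏ i, ((l i).factorial : ℝ) := by positivity
  have p2 : 0 < ∏ k ∈ Finset.range N, (k.factorial : ℝ) := by positivity
  have p3 : 0 < ((n:ℝ)/N)^(N * (N - 1) / 2) := by positivity
  change VN l ^ 2 * _ / _ = _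
  generalize ((n:ℝ)/N)^(N * (N - 1) / 2) = A at *
  generalize ((n:ℝ)/N)^n = B at *
  generalize (∏ i, ((l i).factorial : ℝ)) = P at *
  generalize (∏ k ∈ Finset.range N, (k.factorial : ℝ)) = F at *
  field_simp

lemma dim_le (n N : ℕ) (hn : 0 < n) (hN : 0 < N) (γ : ℝ) (lam : Nat.Partition n) (hl : lam.parts.card ≤ N)
    (h : (Matrix.of fun i k : Fin N => chF ((n:ℝ)/N) k (lof N lam i)).det ^ 2 ≤ Real.exp (-γ * √(n:ℝ))) :
    dimE n N lam ≤ (N:ℝ)^n * (Real.exp 1 * n * Real.exp (-γ * √(n:ℝ))) := by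
  rw [det_dim n N hn hN _ (lof_sum lam hl)] at h
  have hn0 : (0:ℝ) < n := by exact_mod_cast hn
  have hN0 : (0:ℝ) < N := by exact_mod_cast hN
  rw [dimE_eq lam hl, mul_div_assoc]
  have hq : 0 ≤ VN (lof N lam) ^ 2 / ((∏ i, ((lof N lam i).factorial : ℝ)) * ∏ k ∈ Finset.range N, (k.factorial : ℝ)) := by positivity
  generalize VN (lof N lam) ^ 2 / ((∏ i, ((lof N lam i).factorial : ℝ)) * ∏ k ∈ Finset.range N, (k.factorial : ℝ)) = Q at *
  calc (n.factorial:ℝ) * Q ≤ (Real.exp 1 * n * ((n:ℝ) ^ n * Real.exp (-(n:ℝ)))) * Q := by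
        gcongr; exact fact_bound n hn
    _ = (N:ℝ)^n * (Real.exp 1 * n * (Real.exp (-(n:ℝ)) * ((n:ℝ)/N)^n * Q)) := by
        rw [div_pow]; field_simp
    _ ≤ _ := by gcongr

lemma log_small (γ : ℝ) (hγ : 0 < γ) : ∃ n₀ : ℕ, ∀ n : ℕ, n₀ ≤ n → 0 < n ∧ 1 + Real.log n < γ / 2 * √(n:ℝ) := by
  have h1 : Tendsto (fun n : ℕ => √(n:ℝ)) atTop atTop :=
    Real.tendsto_sqrt_atTop.comp tendsto_natCast_atTop_atTop
  have h2 := Real.isLittleO_log_id_atTop.bound (show 0 < γ / 8 by positivity)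
  have h3 := h1.eventually h2
  have h4 := h1.eventually (eventually_ge_atTop (8/γ))
  obtain ⟨n₀, h⟩ := eventually_atTop.1 ((h3.and h4).and (eventually_gt_atTop 0))
  refine ⟨n₀, fun n hn => ?_⟩
  obtain ⟨⟨a, b⟩, c⟩ := h n hn
  refine ⟨c, ?_⟩
  have hc : (0:ℝ) < n := by exact_mod_cast c
  have hsq : 0 < √(n:ℝ) := Real.sqrt_pos.2 hc
  have e : Real.log n = 2 * Real.log √(n:ℝ) := by
    rw [Real.log_sqrt hc.le]; ring
  simp only [id, Real.norm_eq_abs, abs_of_pos hsq] at a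
  have a' := (le_abs_self _).trans a
  rw [div_le_iff₀ hγ] at b
  nlinarith

/-- For any `c > 0` there exist positive `α, β` such that for all
sufficiently large `n` and any positive integer `N` with `√n/N < c`,
`α < −(1/√n)·ln(max_{λ ∈ 𝕐_N^n} dim E_λ / N^n) < β`. -/
theorem max_dim_isotypic_bounds :
    ∀ c : ℝ, 0 < c → ∃ α β : ℝ, 0 < α ∧ 0 < β ∧ ∃ n₀ : ℕ, ∀ n : ℕ, n₀ ≤ n →
      ∀ N : ℕ, 0 < N → Real.sqrt n / (N : ℝ) < c →
        α < -(1 / Real.sqrt n) *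
              Real.log (sSup {x : ℝ | ∃ lam ∈ YNN n N, x = dimE n N lam} / (N : ℝ)^n) ∧
        -(1 / Real.sqrt n) *
              Real.log (sSup {x : ℝ | ∃ lam ∈ YNN n N, x = dimE n N lam} / (N : ℝ)^n) < β := by
  intro c hc
  obtain ⟨γ, hγ, hmain⟩ := ch_main c hc
  obtain ⟨n₀, hn₀⟩ := log_small γ hγ
  refine ⟨γ / 2, 6, by positivity, by norm_num, n₀, ?_⟩
  intro n hn N hN hlt
  obtain ⟨hnpos, hlog⟩ := hn₀ n hn
  have hn0 : (0:ℝ) < n := by exact_mod_cast hnpos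
  have hN0 : (0:ℝ) < N := by exact_mod_cast hN
  have hsq : 0 < √(n:ℝ) := Real.sqrt_pos.2 hn0
  rw [div_lt_iff₀ hN0] at hlt
  have hub : ∀ x ∈ {x : ℝ | ∃ lam ∈ YNN n N, x = dimE n N lam},
      x ≤ (N:ℝ)^n * (Real.exp 1 * n * Real.exp (-γ * √(n:ℝ))) := by
    rintro x ⟨lam, hlam, rfl⟩
    have hl : lam.parts.card ≤ N := by simpa [YNN] using hlam
    exact dim_le n N hnpos hN γ lam hl (hmain n N hnpos hN hlt _ (lof_inj lam))
  obtain ⟨l, hl1, hl2, hl3⟩ := exists_big N n hN hnpos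
  obtain ⟨lam, hlam, hd⟩ := exists_lam' l hl1 hl2
  rw [← hd] at hl3
  have hmem : dimE n N lam ∈ {x : ℝ | ∃ lam ∈ YNN n N, x = dimE n N lam} := ⟨lam, hlam, rfl⟩
  have hS1 := csSup_le ⟨_, hmem⟩ hub
  have hS2 := hl3.trans (le_csSup ⟨_, hub⟩ hmem)
  generalize sSup {x : ℝ | ∃ lam ∈ YNN n N, x = dimE n N lam} = S at *
  have hNn : (0:ℝ) < (N:ℝ)^n := by positivity
  have u1 : S / (N:ℝ)^n ≤ Real.exp 1 * n * Real.exp (-γ * √(n:ℝ)) := by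
    rw [div_le_iff₀ hNn]; linarith
  have u2 : Real.exp (-5 * √(n:ℝ)) ≤ S / (N:ℝ)^n := by
    rw [le_div_iff₀ hNn]; linarith
  have u0 : 0 < S / (N:ℝ)^n := (Real.exp_pos _).trans_le u2
  have v1 := Real.log_le_log u0 u1
  have v2 := Real.log_le_log (Real.exp_pos _) u2
  rw [Real.log_mul (by positivity) (by positivity), Real.log_mul (by positivity) (by positivity), Real.log_exp, Real.log_exp] at v1
  rw [Real.log_exp] at v2
  generalize Real.log (S / (N:ℝ)^n) = X at *
  have e : -(1 / √(n:ℝ)) * X = (-X) / √(n:ℝ) := by ring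
  rw [e]
  constructor
  · rw [lt_div_iff₀ hsq]; nlinarith
  · rw [div_lt_iff₀ hsq]; nlinarith
end
end

section
/- Let c > 0 and let a < min{−1+c/2, −1/(2c)} and b > 1+c/2 be real numbers. Then ∫_a^b ln(1+2cs)·(|s| − Ω_c(s)) ds = −c²/8 + [c>1]·( 1/2 − 5/(8c²) + c²/8 − (1 + 1/(2c²))·ln c ), where [c>1] equals 1 if c > 1 and 0 otherwise. -/
open MeasureTheory Real Filter Topology
open scoped Classical

noncomputable section

/-- The function `h(c,s)` defining the curved part of the limit shape, for
`2s ∈ [c−2, c+2]` (with the continuous extension at `c = 0`). -/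
def hshape (c s : ℝ) : ℝ :=
  if c = 0 then (2/π) * (s * Real.arcsin s + Real.sqrt (1 - s^2))
  else (2/π) * (s * Real.arcsin ((2*s+c)/(2*Real.sqrt (1+2*s*c)))
      + (1/(2*c)) * Real.arccos ((2+2*s*c-c^2)/(2*Real.sqrt (1+2*s*c)))
      + (1/4) * Real.sqrt (4-(2*s-c)^2))

/-- Biane's limit shape `Ω_c`. -/
def Omega (c : ℝ) (s : ℝ) : ℝ :=
  if c ≤ 1 then (if c - 2 ≤ 2*s ∧ 2*s ≤ c + 2 then hshape c s else |s|)
  else if -(1/c) ≤ 2*s ∧ 2*s ≤ c - 2 then s + 1/c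
  else if c - 2 ≤ 2*s ∧ 2*s ≤ c + 2 then hshape c s else |s|


lemma aux_Dhalf (c θ : ℝ) : 1 + c^2 + 2*c*cos θ = (1+c)^2 * cos (θ/2)^2 + (1-c)^2 * sin (θ/2)^2 := by
  have h1 : cos θ = 2 * cos (θ/2)^2 - 1 := by rw [← cos_two_mul]; ring_nf
  have h2 := sin_sq_add_cos_sq (θ/2)
  rw [h1]
  have h3 : sin (θ/2)^2 = 1 - cos (θ/2)^2 := by linarith
  rw [h3]; ring

lemma aux_cos_pos {θ : ℝ} (h : θ ∈ Set.Ioo 0 π) : 0 < cos (θ/2) :=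
  cos_pos_of_mem_Ioo ⟨by linarith [h.1, pi_pos], by linarith [h.2]⟩

lemma aux_sin_pos {θ : ℝ} (h : θ ∈ Set.Ioo 0 π) : 0 < sin (θ/2) :=
  sin_pos_of_pos_of_lt_pi (by linarith [h.1]) (by linarith [h.2, pi_pos])

lemma aux_D_pos {c θ : ℝ} (hc : 0 < c) (h : θ ∈ Set.Ioo 0 π) : 0 < 1 + c^2 + 2*c*cos θ := by
  rw [aux_Dhalf]
  have := aux_cos_pos h
  positivity

def dl (c θ : ℝ) : ℝ := arctan ((1-c)/(1+c) * tan (θ/2))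

lemma dl_hasDeriv {c θ : ℝ} (hc : 0 < c) (h : θ ∈ Set.Ioo 0 π) :
    HasDerivAt (dl c) ((1-c^2)/(2*(1 + c^2 + 2*c*cos θ))) θ := by
  have hC := aux_cos_pos h
  have h1 : HasDerivAt (fun x : ℝ => tan (x/2)) (1 / cos (θ/2)^2 * (1/2)) θ :=
    HasDerivAt.comp (h₂ := tan) (h := fun x : ℝ => x/2) θ (hasDerivAt_tan hC.ne') ((hasDerivAt_id θ).div_const 2)
  have h2 := (h1.const_mul ((1-c)/(1+c))).arctan
  refine h2.congr_deriv ?_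
  have hD := aux_D_pos hc h
  have hD2 := hD
  rw [aux_Dhalf] at hD2
  rw [aux_Dhalf, tan_eq_sin_div_cos]
  have : 1 + ((1 - c) / (1 + c) * (sin (θ / 2) / cos (θ / 2))) ^ 2 = ((1+c)^2 * cos (θ/2)^2 + (1-c)^2 * sin (θ/2)^2) / ((1+c)^2 * cos (θ/2)^2) := by
    field_simp
  rw [this]
  field_simp
  ring

lemma dl_bounds {c θ : ℝ} (hc : 0 < c) (h : θ ∈ Set.Ioo 0 π) : |dl c θ| ≤ θ/2 := by
  have hC := aux_cos_pos h
  have hS := aux_sin_pos h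
  have ht : 0 < tan (θ/2) := by rw [tan_eq_sin_div_cos]; positivity
  have h1 : arctan (tan (θ/2)) = θ/2 := arctan_tan (by linarith [h.1, pi_pos]) (by linarith [h.2])
  have hk : |(1-c)/(1+c)| ≤ 1 := by
    rw [abs_div, abs_of_pos (by linarith : 0 < 1 + c), div_le_one (by linarith), abs_le]
    constructor <;> linarith
  have hk' := abs_le.1 hk
  rw [abs_le]
  unfold dl
  constructor
  · rw [← h1, ← arctan_neg]
    conv_rhs => rw [h1]
    exact arctan_strictMono.monotone (by nlinarith)
  · conv_rhs => rw [← h1]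
    exact arctan_strictMono.monotone (by nlinarith)

lemma dl_trig {c θ : ℝ} (hc : 0 < c) (h : θ ∈ Set.Ioo 0 π) :
    cos (dl c θ) = (1+c) * cos (θ/2) / √(1 + c^2 + 2*c*cos θ) ∧
    sin (dl c θ) = (1-c) * sin (θ/2) / √(1 + c^2 + 2*c*cos θ) := by
  have hC := aux_cos_pos h
  have hD := aux_D_pos hc h
  have hD2 := hD
  rw [aux_Dhalf] at hD2
  have hs : √(1 + ((1 - c) / (1 + c) * tan (θ/2)) ^ 2) = √(1 + c^2 + 2*c*cos θ) / ((1+c) * cos (θ/2)) := by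
    rw [aux_Dhalf, eq_div_iff (by positivity), ← sqrt_sq (show 0 ≤ (1+c) * cos (θ/2) by positivity), ← sqrt_mul (by positivity), tan_eq_sin_div_cos]
    congr 1
    field_simp
  have hR : 0 < √(1 + c^2 + 2*c*cos θ) := sqrt_pos.2 hD
  constructor
  · rw [dl, cos_arctan, hs]; field_simp
  · rw [dl, sin_arctan, hs, tan_eq_sin_div_cos]; field_simp

lemma hshape_param {c θ : ℝ} (hc : 0 < c) (h : θ ∈ Set.Ioo 0 π) :
    hshape c (c/2 + cos θ) = (2/π) * ((c/2 + cos θ) * (π/2 - (θ/2 + dl c θ)) + (1/(2*c)) * (θ/2 - dl c θ) + sin θ / 2) := by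
  have hD := aux_D_pos hc h
  have hR : 0 < √(1 + c^2 + 2*c*cos θ) := sqrt_pos.2 hD
  obtain ⟨t1, t2⟩ := dl_trig hc h
  have hb := abs_le.1 (dl_bounds hc h)
  have h1 : cos θ = 2 * cos (θ/2)^2 - 1 := by rw [← cos_two_mul]; ring_nf
  have h2 := sin_sq_add_cos_sq (θ/2)
  have h3 : sin (θ/2)^2 = 1 - cos (θ/2)^2 := by linarith
  have e1 : 1 + 2*(c/2+cos θ)*c = 1 + c^2 + 2*c*cos θ := by ring
  have hα : cos (θ/2 + dl c θ) = (2*(c/2+cos θ) + c) / (2 * √(1 + c^2 + 2*c*cos θ)) := by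
    rw [cos_add, t1, t2]
    field_simp
    rw [h3, h1]; ring
  have hβ : cos (θ/2 - dl c θ) = (2 + 2*(c/2+cos θ)*c - c^2) / (2 * √(1 + c^2 + 2*c*cos θ)) := by
    rw [cos_sub, t1, t2]
    field_simp
    rw [h3, h1]; ring
  have hs : √(4 - (2*(c/2+cos θ) - c)^2) = 2 * sin θ := by
    rw [← sqrt_sq (show 0 ≤ 2 * sin θ by have := sin_pos_of_pos_of_lt_pi h.1 h.2; positivity)]
    congr 1
    have := sin_sq_add_cos_sq θ
    nlinarith
  rw [hshape, if_neg hc.ne', e1, hs, ← hα, ← hβ, arcsin_eq_pi_div_two_sub_arccos, arccos_cos (by linarith) (by linarith [h.2]), arccos_cos (by linarith) (by linarith [h.2])]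
  ring

def Pf (c D : ℝ) : ℝ := (1/(4*c^2)) * (D/2 * (D * log D) - D^2/4 - D * log D + D)
def Ff (c D : ℝ) : ℝ := (1/(2*c)) * (D * log D - D)

def Phi (c θ : ℝ) : ℝ :=
  -Pf c (1 + c^2 + 2*c*cos θ) * (π/2 - (θ/2 + dl c θ)) - Ff c (1 + c^2 + 2*c*cos θ) * (θ/2 - dl c θ) / (2*c)
  + (1/(8*c^2)) * ((c - c^3) - 3*c^2 * cos θ) * (sin θ * log (1 + c^2 + 2*c*cos θ))
  + ((c^4-4*c^2-1)/(32*c^2) * θ - 5/(8*c) * sin θ + 1/4 * (sin θ * cos θ) - (5+c^2)*(1-c^2)/(16*c^2) * dl c θ)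

lemma Pf_deriv {c D : ℝ} (hc : 0 < c) (hD : D ≠ 0) :
    HasDerivAt (Pf c) ((D-1)/(4*c^2) * log D) D := by
  have h0 := hasDerivAt_id D
  have h1 := hasDerivAt_mul_log hD
  have := (((((h0.div_const 2).mul h1).sub ((h0.pow 2).div_const 4)).sub h1).add h0).const_mul (1/(4*c^2))
  refine this.congr_deriv ?_
  simp
  field_simp
  ring

lemma Ff_deriv {c D : ℝ} (hc : 0 < c) (hD : D ≠ 0) :
    HasDerivAt (Ff c) (1/(2*c) * log D) D := by
  have h0 := hasDerivAt_id D
  have h1 := hasDerivAt_mul_log hD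
  have := (h1.sub h0).const_mul (1/(2*c))
  refine this.congr_deriv ?_
  simp

lemma Phi_deriv {c θ : ℝ} (hc : 0 < c) (h : θ ∈ Set.Ioo 0 π) :
    HasDerivAt (Phi c) (sin θ * (log (1 + c^2 + 2*c*cos θ) * ((c/2 + cos θ) * (π/2 - (θ/2 + dl c θ)) + (1/(2*c)) * (θ/2 - dl c θ) + sin θ / 2)) - (1+2*c^2)/(8*c^2) * log (1 + c^2 + 2*c*cos θ)) θ := by
  have hD := aux_D_pos hc h
  have d0 := hasDerivAt_id θ
  have dD : HasDerivAt (fun x => 1 + c^2 + 2*c*cos x) (2*c*(-sin θ)) θ :=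
    ((hasDerivAt_cos θ).const_mul (2*c)).const_add _
  have dP := (Pf_deriv hc hD.ne').comp θ dD
  have dF := (Ff_deriv hc hD.ne').comp θ dD
  have dd := dl_hasDeriv hc h
  have dL := dD.log hD.ne'
  have ds := hasDerivAt_sin θ
  have dc := hasDerivAt_cos θ
  have := ((((dP.neg.mul (((d0.div_const 2).add dd).const_sub (π/2))).sub
    ((dF.mul ((d0.div_const 2).sub dd)).div_const (2*c))).add
    ((((dc.const_mul (3*c^2)).const_sub (c - c^3)).const_mul (1/(8*c^2))).mul (ds.mul dL))).add
    ((((d0.const_mul ((c^4-4*c^2-1)/(32*c^2))).sub (ds.const_mul (5/(8*c)))).add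
      ((ds.mul dc).const_mul (1/4))).sub (dd.const_mul ((5+c^2)*(1-c^2)/(16*c^2)))))
  refine this.congr_deriv ?_
  have hs : sin θ ^ 2 = 1 - cos θ ^ 2 := by have := sin_sq_add_cos_sq θ; linarith
  simp only [id, Function.comp, Pf, Ff, Pi.neg_apply, Pi.add_apply, Pi.sub_apply, Pi.mul_apply]
  clear this dL dd dF dP dD ds dc d0
  generalize hE : 1 + c^2 + 2*c*cos θ = E at *
  generalize log E = l
  generalize dl c θ = δ
  generalize sin θ = S at *
  have hC : cos θ = (E - 1 - c^2) / (2*c) := by rw [← hE]; field_simp; ring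
  rw [hC] at hs ⊢
  have hE' : E ≠ 0 := hD.ne'
  have hc' : c ≠ 0 := hc.ne'
  field_simp at hs ⊢
  ring_nf at hs ⊢
  linear_combination (-81920 + 16384*E - 16384*E*l - 16384*c^2) * hs

lemma log_D_eq (c θ : ℝ) : log (1 + c^2 + 2*c*cos θ) = 2 * log ‖circleMap 0 1 θ + (c:ℂ)‖ := by
  have h : ‖circleMap 0 1 θ + (c:ℂ)‖^2 = 1 + c^2 + 2*c*cos θ := by
    rw [← Complex.normSq_eq_norm_sq, Complex.normSq_apply]
    have := sin_sq_add_cos_sq θ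
    simp [circleMap, Complex.exp_ofReal_mul_I_re, Complex.exp_ofReal_mul_I_im]
    nlinarith
  rw [← h, log_pow]; norm_num

lemma log_D_int2 (c : ℝ) : IntervalIntegrable (fun θ => log (1 + c^2 + 2*c*cos θ)) volume 0 (2*π) := by
  have h := circleIntegrable_log_norm_sub_const (a := -(c:ℂ)) (c := 0) 1
  simp only [CircleIntegrable, sub_neg_eq_add] at h
  simp_rw [log_D_eq]
  exact h.const_mul 2

lemma log_D_int (c : ℝ) : IntervalIntegrable (fun θ => log (1 + c^2 + 2*c*cos θ)) volume 0 π := by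
  refine (log_D_int2 c).mono_set ?_
  have := pi_pos
  rw [Set.uIcc_of_le (by linarith), Set.uIcc_of_le (by linarith)]
  exact Set.Icc_subset_Icc le_rfl (by linarith)

lemma log_D_integral (c : ℝ) (hc : 0 < c) : ∫ θ in (0:ℝ)..π, log (1 + c^2 + 2*c*cos θ) = 2 * π * posLog c := by
  have hp := pi_pos
  have h := circleAverage_log_norm_add_const_eq_posLog (a := (c:ℂ))
  rw [circleAverage_def] at h
  have h2 : ∫ θ in (0:ℝ)..(2*π), log (1 + c^2 + 2*c*cos θ) = 4 * π * posLog c := by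
    simp_rw [log_D_eq]
    rw [intervalIntegral.integral_const_mul]
    simp only [Complex.norm_real, norm_eq_abs, abs_of_pos hc, smul_eq_mul] at h
    rw [inv_mul_eq_iff_eq_mul₀ (by positivity)] at h
    rw [h]; ring
  have i2 : IntervalIntegrable (fun θ => log (1 + c^2 + 2*c*cos θ)) volume π (2*π) := by
    refine (log_D_int2 c).mono_set ?_
    rw [Set.uIcc_of_le (by linarith), Set.uIcc_of_le (by linarith)]
    exact Set.Icc_subset_Icc hp.le le_rfl
  have h3 := intervalIntegral.integral_add_adjacent_intervals (log_D_int c) i2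
  have h4 := intervalIntegral.integral_comp_sub_left (a := 0) (b := π) (fun θ => log (1 + c^2 + 2*c*cos θ)) (2*π)
  simp only [cos_two_pi_sub, sub_zero] at h4
  rw [show 2*π-π = π by ring] at h4
  linarith

lemma hshape_bound {c s : ℝ} (hc : 0 < c) : |hshape c s| ≤ (2/π) * (|s| * (π/2) + (1/(2*c)) * π + (1/4) * 2) := by
  have hp := pi_pos
  rw [hshape, if_neg hc.ne', abs_mul, abs_of_pos (show 0 < 2/π by positivity)]
  gcongr
  refine (abs_add_le _ _).trans (add_le_add ((abs_add_le _ _).trans (add_le_add ?_ ?_)) ?_)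
  · rw [abs_mul]
    gcongr
    exact abs_le.2 ⟨neg_pi_div_two_le_arcsin _, arcsin_le_pi_div_two _⟩
  · rw [abs_mul, abs_of_pos (show 0 < 1/(2*c) by positivity), abs_of_nonneg (arccos_nonneg _)]
    gcongr
    exact arccos_le_pi _
  · rw [abs_mul, abs_of_pos (show (0:ℝ) < 1/4 by positivity), abs_of_nonneg (sqrt_nonneg _)]
    gcongr
    rw [sqrt_le_left (by norm_num)]
    nlinarith [sq_nonneg (2*s-c)]

lemma hshape_meas (c : ℝ) : Measurable (hshape c) := by
  unfold hshape
  split_ifs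
  · fun_prop
  · fun_prop

lemma int_bdd_mul {f g : ℝ → ℝ} {a b K : ℝ} (hf : IntervalIntegrable f volume a b) (hg : Measurable g)
    (hK : ∀ x ∈ Set.uIoc a b, |g x| ≤ K) : IntervalIntegrable (fun x => f x * g x) volume a b := by
  rw [intervalIntegrable_iff] at hf ⊢
  refine Integrable.mul_bdd (c := K) hf hg.aestronglyMeasurable ?_
  rw [ae_restrict_iff' measurableSet_uIoc]
  exact ae_of_all _ (by simpa using hK)

lemma int_theta {c : ℝ} (hc : 0 < c) :
    IntervalIntegrable (fun θ => sin θ * (log (1 + c^2 + 2*c*cos θ) * hshape c (c/2 + cos θ))) volume 0 π := by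
  have := int_bdd_mul (log_D_int c) (g := fun θ => hshape c (c/2 + cos θ) * sin θ) (K := (2/π) * ((c/2+1) * (π/2) + (1/(2*c)) * π + (1/4) * 2)) ?_ ?_
  · convert this using 2
    ring
  · exact ((hshape_meas c).comp (by fun_prop)).mul (by fun_prop)
  · intro x _
    have hp := pi_pos
    have h1 : |c/2 + cos x| ≤ c/2 + 1 := by
      refine (abs_add_le _ _).trans ?_
      rw [abs_of_pos (by positivity : 0 < c/2)]
      linarith [abs_cos_le_one x]
    rw [abs_mul]
    refine (mul_le_of_le_one_right (abs_nonneg _) (abs_sin_le_one x)).trans ((hshape_bound hc).trans ?_)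
    gcongr

lemma Pf_cont (c : ℝ) : Continuous (Pf c) := by
  unfold Pf
  have := continuous_mul_log
  fun_prop

lemma Ff_cont (c : ℝ) : Continuous (Ff c) := by
  unfold Ff
  have := continuous_mul_log
  fun_prop

lemma Phi_tendsto_zero {c : ℝ} (hc : 0 < c) : Tendsto (Phi c) (𝓝[>] 0) (𝓝 (-Pf c ((1+c)^2) * (π/2))) := by
  have hd : ContinuousAt (dl c) 0 := by
    unfold dl
    have : ContinuousAt (fun θ : ℝ => tan (θ/2)) 0 :=
      ContinuousAt.comp (g := tan) (f := fun θ : ℝ => θ/2) (continuousAt_tan.2 (by simp)) (by fun_prop)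
    exact (continuous_arctan.continuousAt).comp (continuousAt_const.mul this)
  have hl : ContinuousAt (fun θ => log (1 + c^2 + 2*c*cos θ)) 0 :=
    ContinuousAt.log (by fun_prop) (by simp; positivity)
  have hP : ContinuousAt (fun θ => Pf c (1 + c^2 + 2*c*cos θ)) 0 := ((Pf_cont c).comp (by fun_prop)).continuousAt
  have hF : ContinuousAt (fun θ => Ff c (1 + c^2 + 2*c*cos θ)) 0 := ((Ff_cont c).comp (by fun_prop)).continuousAt
  have h : ContinuousAt (Phi c) 0 := by
    unfold Phi
    fun_prop
  have h2 : Phi c 0 = -Pf c ((1+c)^2) * (π/2) := by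
    simp [Phi, dl]
    ring_nf
  rw [← h2]
  exact h.tendsto.mono_left nhdsWithin_le_nhds

lemma sinlog_tendsto {c : ℝ} (hc : 0 < c) :
    Tendsto (fun θ => sin θ * log (1 + c^2 + 2*c*cos θ)) (𝓝[<] π) (𝓝 0) := by
  have h : ContinuousAt (fun θ => sin θ * log (1 + c^2 + 2*c*cos θ)) π := by
    by_cases h1 : c = 1
    · subst h1
      have : (fun θ => sin θ * log (1 + 1^2 + 2*1*cos θ)) = fun θ => 2 * sin (θ/2) * (2 * cos (θ/2) * log (2 * cos (θ/2))) := by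
        ext θ
        have e1 : sin θ = 2 * sin (θ/2) * cos (θ/2) := by rw [← sin_two_mul]; ring_nf
        have e2 := aux_Dhalf 1 θ
        rw [e2, show (1+1:ℝ)^2 * cos (θ/2)^2 + (1-1)^2 * sin (θ/2)^2 = (2 * cos (θ/2))^2 by ring, log_pow, e1]
        push_cast; ring
      rw [this]
      have h2 : Continuous (fun θ : ℝ => 2 * cos (θ/2) * log (2 * cos (θ/2))) :=
        continuous_mul_log.comp (f := fun θ : ℝ => 2 * cos (θ/2)) (by fun_prop)
      exact (Continuous.mul (by fun_prop) h2).continuousAt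
    · refine ContinuousAt.mul (by fun_prop) (ContinuousAt.log (by fun_prop) ?_)
      rw [cos_pi, show 1 + c^2 + 2*c*(-1) = (1-c)^2 by ring]
      exact pow_ne_zero _ (sub_ne_zero.2 (Ne.symm h1))
  have := h.tendsto.mono_left (nhdsWithin_le_nhds (s := Set.Iio π))
  simpa using this

lemma Phi_tendsto_pi {c d : ℝ} (hc : 0 < c) (hd : Tendsto (dl c) (𝓝[<] π) (𝓝 d)) :
    Tendsto (Phi c) (𝓝[<] π) (𝓝 (Pf c ((1-c)^2) * d - Ff c ((1-c)^2) * (π/2-d) / (2*c) + (c^4-4*c^2-1)/(32*c^2) * π - (5+c^2)*(1-c^2)/(16*c^2) * d)) := by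
  have key : ∀ f : ℝ → ℝ, Continuous f → Tendsto f (𝓝[<] π) (𝓝 (f π)) := fun f hf =>
    (hf.tendsto π).mono_left nhdsWithin_le_nhds
  have hP := key (fun θ => Pf c (1 + c^2 + 2*c*cos θ)) ((Pf_cont c).comp (by fun_prop))
  have hF := key (fun θ => Ff c (1 + c^2 + 2*c*cos θ)) ((Ff_cont c).comp (by fun_prop))
  have h2 := key (fun θ => θ/2) (by fun_prop)
  have h3 := key (fun θ => (c^4-4*c^2-1)/(32*c^2) * θ - 5/(8*c) * sin θ + 1/4 * (sin θ * cos θ)) (by fun_prop)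
  have h4 := key (fun θ => (1/(8*c^2)) * ((c - c^3) - 3*c^2 * cos θ)) (by fun_prop)
  have := ((((hP.neg.mul ((h2.add hd).const_sub (π/2))).sub ((hF.mul (h2.sub hd)).div_const (2*c))).add (h4.mul (sinlog_tendsto hc))).add (h3.sub (hd.const_mul ((5+c^2)*(1-c^2)/(16*c^2)))))
  refine Tendsto.congr' (Eventually.of_forall fun θ => ?_) (this.trans_eq ?_)
  · simp only [Phi]
  · simp only [cos_pi, sin_pi]
    rw [show 1 + c^2 + 2*c*(-1) = (1-c)^2 by ring]
    ring_nf

lemma theta_integral {c d : ℝ} (hc : 0 < c) (hd : Tendsto (dl c) (𝓝[<] π) (𝓝 d)) :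
    ∫ θ in (0:ℝ)..π, sin θ * (log (1 + c^2 + 2*c*cos θ) * hshape c (c/2 + cos θ)) =
    (2/π) * (Pf c ((1-c)^2) * d - Ff c ((1-c)^2) * (π/2-d) / (2*c) + (c^4-4*c^2-1)/(32*c^2) * π - (5+c^2)*(1-c^2)/(16*c^2) * d + Pf c ((1+c)^2) * (π/2)) + (1+2*c^2)/(2*c^2) * posLog c := by
  have hp := pi_pos
  have hi1 := int_theta hc
  have hi2 := (log_D_int c).const_mul ((2/π) * ((1+2*c^2)/(8*c^2)))
  have := intervalIntegral.integral_eq_sub_of_hasDerivAt_of_tendsto pi_pos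
    (f := fun θ => (2/π) * Phi c θ)
    (f' := fun θ => sin θ * (log (1 + c^2 + 2*c*cos θ) * hshape c (c/2 + cos θ)) - (2/π) * ((1+2*c^2)/(8*c^2)) * log (1 + c^2 + 2*c*cos θ))
    (fun θ hθ => ((Phi_deriv hc hθ).const_mul (2/π)).congr_deriv (by rw [hshape_param hc hθ]; ring))
    (hi1.sub hi2) ((Phi_tendsto_zero hc).const_mul _) ((Phi_tendsto_pi hc hd).const_mul _)
  rw [intervalIntegral.integral_sub hi1 hi2, intervalIntegral.integral_const_mul, log_D_integral c hc, sub_eq_iff_eq_add] at this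
  rw [this]
  field_simp
  ring

lemma s_integral {c : ℝ} :
    ∫ s in (c/2-1)..(c/2+1), log (1+2*c*s) * hshape c s =
    ∫ θ in (0:ℝ)..π, sin θ * (log (1 + c^2 + 2*c*cos θ) * hshape c (c/2 + cos θ)) := by
  have him : (fun θ => c/2 + cos θ) '' Set.Icc 0 π = Set.Icc (c/2-1) (c/2+1) := by
    have := bijOn_cos.image_eq
    rw [← Set.image_image (fun x => c/2 + x) cos, this, Set.image_const_add_Icc]
    ring_nf
  have := integral_image_eq_integral_abs_deriv_smul (s := Set.Icc 0 π) measurableSet_Icc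
    (f := fun θ => c/2 + cos θ) (f' := fun θ => -sin θ)
    (fun x _ => ((hasDerivAt_cos x).const_add (c/2)).hasDerivWithinAt)
    (fun x hx y hy hxy => injOn_cos hx hy (by simpa using hxy))
    (fun s => log (1+2*c*s) * hshape c s)
  rw [him] at this
  rw [intervalIntegral.integral_of_le (by linarith), intervalIntegral.integral_of_le pi_pos.le,
    ← integral_Icc_eq_integral_Ioc, this, ← integral_Icc_eq_integral_Ioc]
  refine setIntegral_congr_fun measurableSet_Icc fun θ hθ => ?_
  simp only [abs_neg, smul_eq_mul]
  rw [abs_of_nonneg (sin_nonneg_of_nonneg_of_le_pi hθ.1 hθ.2)]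
  congr 3
  ring

lemma tan_half_tendsto : Tendsto (fun θ : ℝ => tan (θ/2)) (𝓝[<] π) atTop := by
  refine tendsto_tan_pi_div_two.comp (tendsto_nhdsWithin_iff.2 ⟨?_, ?_⟩)
  · exact (Continuous.tendsto (by fun_prop) π).mono_left nhdsWithin_le_nhds
  · filter_upwards [self_mem_nhdsWithin] with θ hθ
    simp only [Set.mem_Iio] at *
    linarith

lemma dl_lt {c : ℝ} (hc : 0 < c) (h : c < 1) : Tendsto (dl c) (𝓝[<] π) (𝓝 (π/2)) :=
  (tendsto_nhds_of_tendsto_nhdsWithin tendsto_arctan_atTop).comp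
    (tan_half_tendsto.const_mul_atTop (div_pos (by linarith) (by linarith)))

lemma dl_gt {c : ℝ} (h : 1 < c) : Tendsto (dl c) (𝓝[<] π) (𝓝 (-(π/2))) :=
  (tendsto_nhds_of_tendsto_nhdsWithin tendsto_arctan_atBot).comp
    (tan_half_tendsto.const_mul_atTop_of_neg (div_neg_of_neg_of_pos (by linarith) (by linarith)))

lemma dl_eq : Tendsto (dl 1) (𝓝[<] π) (𝓝 0) := by
  unfold dl
  simp

lemma L_int (c a b : ℝ) : IntervalIntegrable (fun s => log (1+2*c*s)) volume a b := by
  have : MeromorphicOn (fun s : ℝ => 1+2*c*s) (Set.uIcc a b) := by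
    intro x _
    fun_prop
  exact this.intervalIntegrable_log

lemma int_Ls {c x y : ℝ} (hc : 0 < c) (hxy : x ≤ y) (hx : 0 ≤ 1+2*c*x) :
    ∫ s in x..y, log (1+2*c*s) * s = Pf c (1+2*c*y) - Pf c (1+2*c*x) := by
  refine intervalIntegral.integral_eq_sub_of_hasDerivAt_of_le hxy (f := fun s => Pf c (1+2*c*s))
    ((Pf_cont c).comp (by fun_prop)).continuousOn ?_ ((L_int c x y).mul_continuousOn (by fun_prop))
  intro s hs
  have hD : 1+2*c*s ≠ 0 := by
    have := mul_lt_mul_of_pos_left hs.1 hc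
    apply ne_of_gt; linarith
  have d : HasDerivAt (fun s => 1+2*c*s) (2*c) s := by
    simpa using ((hasDerivAt_id s).const_mul (2*c)).const_add 1
  refine (HasDerivAt.comp (h₂ := Pf c) (h := fun s => 1+2*c*s) s (Pf_deriv hc hD) d).congr_deriv ?_
  field_simp
  ring

lemma int_L {c x y : ℝ} (hc : 0 < c) (hxy : x ≤ y) (hx : 0 ≤ 1+2*c*x) :
    ∫ s in x..y, log (1+2*c*s) = Ff c (1+2*c*y) - Ff c (1+2*c*x) := by
  refine intervalIntegral.integral_eq_sub_of_hasDerivAt_of_le hxy (f := fun s => Ff c (1+2*c*s))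
    ((Ff_cont c).comp (by fun_prop)).continuousOn ?_ (L_int c x y)
  intro s hs
  have hD : 1+2*c*s ≠ 0 := by
    have := mul_lt_mul_of_pos_left hs.1 hc
    apply ne_of_gt; linarith
  have d : HasDerivAt (fun s => 1+2*c*s) (2*c) s := by
    simpa using ((hasDerivAt_id s).const_mul (2*c)).const_add 1
  refine (HasDerivAt.comp (h₂ := Ff c) (h := fun s => 1+2*c*s) s (Ff_deriv hc hD) d).congr_deriv ?_
  field_simp

lemma Labs_int (c x y : ℝ) : IntervalIntegrable (fun s => log (1+2*c*s) * |s|) volume x y :=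
  (L_int c x y).mul_continuousOn (by fun_prop)

lemma int_Labs {c x y : ℝ} (hc : 0 < c) (hx0 : x ≤ 0) (hy0 : 0 ≤ y) (hx : 0 ≤ 1+2*c*x) :
    ∫ s in x..y, log (1+2*c*s) * |s| = Pf c (1+2*c*y) + Pf c (1+2*c*x) - 2 * Pf c 1 := by
  rw [← intervalIntegral.integral_add_adjacent_intervals (Labs_int c x 0) (Labs_int c 0 y)]
  have e1 : ∫ s in x..0, log (1+2*c*s) * |s| = -∫ s in x..0, log (1+2*c*s) * s := by
    rw [← intervalIntegral.integral_neg]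
    refine intervalIntegral.integral_congr fun s hs => ?_
    rw [Set.uIcc_of_le hx0] at hs
    simp only [abs_of_nonpos hs.2]; ring
  have e2 : ∫ s in 0..y, log (1+2*c*s) * |s| = ∫ s in 0..y, log (1+2*c*s) * s := by
    refine intervalIntegral.integral_congr fun s hs => ?_
    rw [Set.uIcc_of_le hy0] at hs
    simp only [abs_of_nonneg hs.1]
  rw [e1, e2, int_Ls hc hx0 hx, int_Ls hc hy0 (by simp)]
  simp
  ring

lemma Lh_int {c : ℝ} (hc : 0 < c) (x y : ℝ) : IntervalIntegrable (fun s => log (1+2*c*s) * hshape c s) volume x y := by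
  refine int_bdd_mul (L_int c x y) (hshape_meas c) (K := (2/π) * ((|x|+|y|) * (π/2) + (1/(2*c)) * π + (1/4) * 2)) ?_
  intro s hs
  have hp := pi_pos
  refine (hshape_bound hc).trans ?_
  have : |s| ≤ |x| + |y| := by
    rw [Set.mem_uIoc] at hs
    rcases abs_cases s with h | h <;> rcases abs_cases x with h' | h' <;> rcases abs_cases y with h'' | h'' <;> rcases hs with hs | hs <;> linarith [hs.1, hs.2]
  gcongr

lemma piece {f g : ℝ → ℝ} {x y : ℝ} (hxy : x ≤ y) (hg : IntervalIntegrable g volume x y)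
    (h : ∀ s ∈ Set.Ioo x y, f s = g s) :
    IntervalIntegrable f volume x y ∧ ∫ s in x..y, f s = ∫ s in x..y, g s := by
  refine ⟨hg.congr_uIoo ?_, intervalIntegral.integral_congr_Ioo_of_le hxy h⟩
  rw [Set.uIoo_of_le hxy]
  exact fun s hs => (h s hs).symm

lemma zpiece {f : ℝ → ℝ} {x y : ℝ} (hxy : x ≤ y) (h : ∀ s ∈ Set.Ioo x y, f s = 0) :
    IntervalIntegrable f volume x y ∧ ∫ s in x..y, f s = 0 := by
  have := piece (g := fun _ => 0) hxy (by simp) h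
  simpa using this

lemma case_le {c a b : ℝ} (hc : 0 < c) (h1 : c ≤ 1) (ha : a ≤ c/2-1) (hb : c/2+1 ≤ b) :
    ∫ s in a..b, log (1+2*c*s) * (|s| - Omega c s) = Pf c ((1+c)^2) + Pf c ((1-c)^2) - 2 * Pf c 1
      - ∫ s in (c/2-1)..(c/2+1), log (1+2*c*s) * hshape c s := by
  obtain ⟨i1, e1⟩ := zpiece (f := fun s => log (1+2*c*s) * (|s| - Omega c s)) ha (by
    intro s hs
    have h : ¬ (c - 2 ≤ 2*s ∧ 2*s ≤ c + 2) := fun h => by linarith [hs.2, h.1]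
    rw [Omega, if_pos h1, if_neg h]; simp)
  obtain ⟨i3, e3⟩ := zpiece (f := fun s => log (1+2*c*s) * (|s| - Omega c s)) hb (by
    intro s hs
    have h : ¬ (c - 2 ≤ 2*s ∧ 2*s ≤ c + 2) := fun h => by linarith [hs.1, h.2]
    rw [Omega, if_pos h1, if_neg h]; simp)
  obtain ⟨i2, e2⟩ := piece (f := fun s => log (1+2*c*s) * (|s| - Omega c s))
    (by linarith : c/2-1 ≤ c/2+1) ((Labs_int c _ _).sub (Lh_int hc _ _)) (by
    intro s hs
    have h : (c - 2 ≤ 2*s ∧ 2*s ≤ c + 2) := ⟨by linarith [hs.1], by linarith [hs.2]⟩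
    rw [Omega, if_pos h1, if_pos h]; ring)
  rw [← intervalIntegral.integral_add_adjacent_intervals (i1.trans i2) i3,
    ← intervalIntegral.integral_add_adjacent_intervals i1 i2, e1, e2, e3,
    intervalIntegral.integral_sub (Labs_int c _ _) (Lh_int hc _ _),
    int_Labs hc (by linarith) (by linarith) (by nlinarith [sq_nonneg (1-c)])]
  rw [show 1 + 2*c*(c/2+1) = (1+c)^2 by ring, show 1 + 2*c*(c/2-1) = (1-c)^2 by ring]
  ring

lemma case_gt {c a b : ℝ} (h1 : 1 < c) (ha : a ≤ -(1/(2*c))) (hb : c/2+1 ≤ b) :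
    ∫ s in a..b, log (1+2*c*s) * (|s| - Omega c s) = Pf c ((1+c)^2) - 2 * Pf c 1
      - (Pf c ((1-c)^2) + (1/c) * Ff c ((1-c)^2))
      - ∫ s in (c/2-1)..(c/2+1), log (1+2*c*s) * hshape c s := by
  have hc : 0 < c := by linarith
  have h1' : ¬ c ≤ 1 := by linarith
  have hcc : 1/c = 2 * (1/(2*c)) := by field_simp
  have hq : 0 < 1/(2*c) := by positivity
  have hle : -(1/(2*c)) ≤ c/2-1 := by
    have : c/2 - 1 + 1/(2*c) = (c-1)^2/(2*c) := by field_simp; ring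
    have h2 : 0 ≤ (c-1)^2/(2*c) := by positivity
    linarith
  have hz : 1 + 2*c*(-(1/(2*c))) = 0 := by field_simp; ring
  have hL1 : ∀ x y, IntervalIntegrable (fun s => log (1+2*c*s) * s + (1/c) * log (1+2*c*s)) volume x y := fun x y =>
    ((L_int c x y).mul_continuousOn (by fun_prop)).add ((L_int c x y).const_mul _)
  obtain ⟨i1, e1⟩ := zpiece (f := fun s => log (1+2*c*s) * (|s| - Omega c s)) ha (by
    intro s hs
    have h : ¬ (c - 2 ≤ 2*s ∧ 2*s ≤ c + 2) := fun h => by linarith [hs.2, h.1]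
    have h' : ¬ (-(1/c) ≤ 2*s ∧ 2*s ≤ c - 2) := fun h => by linarith [hs.2, h.1]
    rw [Omega, if_neg h1', if_neg h', if_neg h]; simp)
  obtain ⟨i3, e3⟩ := zpiece (f := fun s => log (1+2*c*s) * (|s| - Omega c s)) hb (by
    intro s hs
    have h : ¬ (c - 2 ≤ 2*s ∧ 2*s ≤ c + 2) := fun h => by linarith [hs.1, h.2]
    have h' : ¬ (-(1/c) ≤ 2*s ∧ 2*s ≤ c - 2) := fun h => by linarith [hs.1, h.2]
    rw [Omega, if_neg h1', if_neg h', if_neg h]; simp)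
  obtain ⟨i2, e2⟩ := piece (f := fun s => log (1+2*c*s) * (|s| - Omega c s))
    (by linarith : c/2-1 ≤ c/2+1) ((Labs_int c _ _).sub (Lh_int hc _ _)) (by
    intro s hs
    have h : (c - 2 ≤ 2*s ∧ 2*s ≤ c + 2) := ⟨by linarith [hs.1], by linarith [hs.2]⟩
    have h' : ¬ (-(1/c) ≤ 2*s ∧ 2*s ≤ c - 2) := fun h => by linarith [hs.1, h.2]
    rw [Omega, if_neg h1', if_neg h', if_pos h]; ring)
  obtain ⟨i4, e4⟩ := piece (f := fun s => log (1+2*c*s) * (|s| - Omega c s))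
    hle ((Labs_int c _ _).sub (hL1 _ _)) (by
    intro s hs
    have h' : (-(1/c) ≤ 2*s ∧ 2*s ≤ c - 2) := ⟨by linarith [hs.1], by linarith [hs.2]⟩
    rw [Omega, if_neg h1', if_pos h']; ring)
  have hab := intervalIntegral.integral_add_adjacent_intervals (Labs_int c (-(1/(2*c))) (c/2-1)) (Labs_int c (c/2-1) (c/2+1))
  rw [int_Labs (x := -(1/(2*c))) (y := c/2+1) hc (by linarith) (by linarith) hz.ge, hz] at hab
  rw [← intervalIntegral.integral_add_adjacent_intervals ((i1.trans i4).trans i2) i3,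
    ← intervalIntegral.integral_add_adjacent_intervals (i1.trans i4) i2,
    ← intervalIntegral.integral_add_adjacent_intervals i1 i4, e1, e2, e3, e4,
    intervalIntegral.integral_sub (Labs_int c _ _) (Lh_int hc _ _),
    intervalIntegral.integral_sub (Labs_int c _ _) (hL1 _ _),
    intervalIntegral.integral_add ((L_int c _ _).mul_continuousOn (by fun_prop)) ((L_int c _ _).const_mul _),
    intervalIntegral.integral_const_mul, int_Ls hc hle hz.ge, int_L hc hle hz.ge, hz]
  rw [show 1 + 2*c*(c/2+1) = (1+c)^2 by ring] at hab
  rw [show 1 + 2*c*(c/2-1) = (1-c)^2 by ring]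
  have p0 : Pf c 0 = 0 := by simp [Pf]
  have f0 : Ff c 0 = 0 := by simp [Ff]
  rw [p0] at hab ⊢
  rw [f0]
  linarith

/-- For `c > 0`, `a < min(−1+c/2, −1/(2c))` and `b > 1+c/2`:
`∫_a^b ln(1+2cs)(|s| − Ω_c(s)) ds = −c²/8 + [c>1](1/2 − 5/(8c²) + c²/8 − (1+1/(2c²))·ln c)`. -/
theorem log_integral_abs_sub_Omega :
    ∀ c a b : ℝ, 0 < c → a < min (-1 + c/2) (-(1/(2*c))) → 1 + c/2 < b →
      (∫ s in a..b, Real.log (1+2*c*s) * (|s| - Omega c s)) =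
        -c^2/8 + (if 1 < c then 1/2 - 5/(8*c^2) + c^2/8 - (1 + 1/(2*c^2))*Real.log c else 0) := by
  intro c a b hc ha hb
  have hp := pi_pos
  have hp1 : Pf c 1 = 3/(16*c^2) := by simp [Pf]; field_simp; norm_num
  have ha1 := (lt_min_iff.1 ha).1
  have ha2 := (lt_min_iff.1 ha).2
  rcases lt_trichotomy c 1 with h | h | h
  · rw [case_le hc h.le (by linarith) (by linarith), s_integral, theta_integral hc (dl_lt hc h), hp1,
      if_neg (by linarith), posLog_eq_zero_iff _ |>.2 (by rw [abs_of_pos hc]; exact h.le)]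
    field_simp
    ring
  · subst h
    rw [case_le hc le_rfl (by linarith) (by linarith), s_integral, theta_integral hc dl_eq, hp1,
      if_neg (by linarith), posLog_eq_zero_iff _ |>.2 (by simp)]
    have p0 : Pf 1 0 = 0 := by simp [Pf]
    have f0 : Ff 1 0 = 0 := by simp [Ff]
    norm_num [p0, f0]
    field_simp
    ring
  · rw [case_gt h (by linarith) (by linarith), s_integral, theta_integral hc (dl_gt h), hp1,
      if_pos h, posLog_eq_log (by rw [abs_of_pos hc]; exact h.le)]
    field_simp
    ring
end
end

section
/- Let c > 0, let a < min{−1+c/2, −1/(2c)} and b > 1+c/2, and for s ∈ (a,b) set I_c(s) = ∫_a^b φ₀(s−t)·Ω_c′(t) dt, where φ₀(x) = −ln|2x|. Then for all s ∈ (a,b): I_c(s) = φ₁(a−s) + φ₁(b−s) + G_c(s) − H_c(s). -/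
open MeasureTheory Real Filter Topology
open scoped Classical

noncomputable section

/-- The inverse hyperbolic cosine `arccosh x = ln(x + √(x²−1))` (for `x ≥ 1`). -/
def arccosh (x : ℝ) : ℝ := Real.log (x + Real.sqrt (x^2 - 1))

/-- The function `H̃_c`: zero on `[−1,1]`, and the stated combination of
`arccosh` terms for `|z| > 1`. -/
def Htilde (c z : ℝ) : ℝ :=
  if |z| ≤ 1 then 0 else
    (z - (1 - c^2)/(2*c)) * arccosh |z|
    + Real.sign (1 - c) * (z + (1 + c^2)/(2*c)) *
        arccosh |(1 + ((1+c^2)/(2*c))*z)/(z + (1+c^2)/(2*c))|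
    - Real.sign z * Real.sqrt (z^2 - 1)

/-- `H_c(s) = H̃_c(s − c/2)`. -/
def Hc (c s : ℝ) : ℝ := Htilde c (s - c/2)

/-- `φ₀(x) = −ln|2x|`. -/
def phi0 (x : ℝ) : ℝ := -Real.log |2*x|

/-- `φ₁(x) = x − x·ln|2x|` (an antiderivative of `φ₀`, with `φ₁(0) = 0`). -/
def phi1 (x : ℝ) : ℝ := x - x * Real.log |2*x|

/-- `φ₂(x) = (3/4)x² − (1/2)x²·ln(2|x|)` (an antiderivative of `φ₁`, `φ₂(0) = 0`). -/
def phi2 (x : ℝ) : ℝ := (3/4)*x^2 - (1/2)*x^2*Real.log (2*|x|)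

/-- `G_c(s) = (1/c)·φ₁((1+2cs)/2) − (1−c²)/(2c)`. -/
def Gc (c s : ℝ) : ℝ := (1/c) * phi1 ((1+2*c*s)/2) - (1-c^2)/(2*c)


def lgq (q : ℂ) (θ : ℝ) : ℝ := Real.log ‖1 - q * circleMap 0 1 θ‖

def PPr (r θ : ℝ) : ℝ := (1 - r^2) / (1 - 2*r*Real.cos θ + r^2)

lemma PPr_den_pos {r : ℝ} (hr : |r| < 1) (θ : ℝ) : 0 < 1 - 2*r*Real.cos θ + r^2 := by
  have h1 := Real.sin_sq_add_cos_sq θ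
  have h3 : r^2 < 1 := by rw [← sq_abs]; nlinarith [abs_nonneg r]
  have h2 := Real.cos_sq_le_one θ
  by_cases h : r = 0
  · simp [h]
  · have : 0 < r^2 := by positivity
    nlinarith [sq_nonneg (r - Real.cos θ), sq_nonneg (r + Real.cos θ), sq_nonneg (1 - r * Real.cos θ), sq_nonneg (r*Real.sin θ), Real.neg_one_le_cos θ, Real.cos_le_one θ, abs_lt.1 hr, sq_nonneg (1 - r), sq_nonneg (1+r)]

lemma PPr_cont {r : ℝ} (hr : |r| < 1) : Continuous (PPr r) := by
  unfold PPr
  exact Continuous.div (by fun_prop) (by fun_prop) (fun θ => (PPr_den_pos hr θ).ne')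

lemma normSq_one_sub_mul (x : ℂ) : ‖1 - x‖^2 = 1 - 2 * x.re + ‖x‖^2 := by
  rw [← Complex.normSq_eq_norm_sq, ← Complex.normSq_eq_norm_sq, Complex.normSq_apply, Complex.normSq_apply]
  simp; ring

lemma circleMap_re (θ : ℝ) : (circleMap 0 1 θ).re = Real.cos θ := by
  simp [circleMap, Complex.exp_ofReal_mul_I_re]

lemma circleMap_im (θ : ℝ) : (circleMap 0 1 θ).im = Real.sin θ := by
  simp [circleMap, Complex.exp_ofReal_mul_I_im]

lemma poisson_eq (r θ : ℝ) : poissonKernel 0 (r:ℂ) (circleMap 0 1 θ) = PPr r θ := by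
  rw [poissonKernel_def, PPr]
  congr 1
  · simp
  · rw [← Complex.normSq_eq_norm_sq, Complex.normSq_apply]
    simp [circleMap_re, circleMap_im]
    nlinarith [Real.sin_sq_add_cos_sq θ]

lemma one_sub_ne {q z : ℂ} (hq : ‖q‖ < 1) (hz : ‖z‖ ≤ 1) : 1 - q * z ≠ 0 := by
  intro h
  have : q * z = 1 := (sub_eq_zero.1 h).symm
  have h2 : ‖q‖ * ‖z‖ = 1 := by rw [← norm_mul, this]; simp
  nlinarith [norm_nonneg q, norm_nonneg z]

lemma lgP {q : ℂ} (hq : ‖q‖ < 1) {r : ℝ} (hr : |r| < 1) :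
    ∫ θ in 0..2*π, lgq q θ * PPr r θ = 2 * π * Real.log ‖1 - q * r‖ := by
  have h : InnerProductSpace.HarmonicOnNhd (fun z : ℂ => Real.log ‖1 - q * z‖) (Metric.closedBall 0 1) := by
    intro z hz
    exact AnalyticAt.harmonicAt_log_norm (f := fun z => 1 - q * z) (by fun_prop) (one_sub_ne hq (by simpa using hz))
  have := h.circleAverage_poissonKernel_smul (w := (r:ℂ)) (by simpa using hr)
  rw [circleAverage_def] at this
  simp only [Pi.smul_apply', poisson_eq, smul_eq_mul] at this
  rw [← this]
  have hp := Real.pi_pos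
  field_simp
  rw [intervalIntegral.integral_congr]
  intro θ _
  simp [lgq]; ring

lemma intP {r : ℝ} (hr : |r| < 1) : ∫ θ in 0..2*π, PPr r θ = 2 * π := by
  have h : InnerProductSpace.HarmonicOnNhd (fun z : ℂ => Real.log ‖(Real.exp 1 : ℂ)‖) (Metric.closedBall 0 1) := by
    intro z hz
    exact AnalyticAt.harmonicAt_log_norm (f := fun z => (Real.exp 1 : ℂ)) (by fun_prop) (by simp)
  have := h.circleAverage_poissonKernel_smul (w := (r:ℂ)) (by simpa using hr)
  rw [circleAverage_def] at this
  simp only [Pi.smul_apply', poisson_eq, smul_eq_mul] at this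
  have hp := Real.pi_pos
  have e : Real.log ‖(Real.exp 1 : ℂ)‖ = 1 := by
    rw [Complex.norm_real]; simp
  rw [e] at this
  field_simp at this
  simpa using this

lemma lgcos {q : ℂ} (hq : ‖q‖ < 1) :
    ∫ θ in 0..2*π, lgq q θ * Real.cos θ = - (π * q.re) := by
  set F : ℂ → ℂ := fun z => Complex.log (1 - q * z) with hF
  set U : Set ℂ := {z | ‖q * z‖ < 1} with hU
  have hUo : IsOpen U := isOpen_lt (by fun_prop) continuous_const
  have hsub : Metric.closedBall (0:ℂ) 1 ⊆ U := by
    intro z hz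
    have : ‖z‖ ≤ 1 := by simpa using hz
    simp only [hU, Set.mem_ofPred_eq, norm_mul]
    nlinarith [norm_nonneg q, norm_nonneg z]
  have hFd : DifferentiableOn ℂ F U := by
    intro z hz
    have : 1 - q * z ∈ Complex.slitPlane := by
      left
      have h1 : (q*z).re < 1 := lt_of_le_of_lt (Complex.re_le_norm _) hz
      simpa using h1
    have h2 : DifferentiableAt ℂ (fun z : ℂ => 1 - q * z) z := by fun_prop
    exact (DifferentiableAt.clog h2 this).differentiableWithinAt
  have h0 : U ∈ 𝓝 (0:ℂ) := hUo.mem_nhds (by simp [hU])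
  have hD : DifferentiableOn ℂ (dslope F 0) U := (Complex.differentiableOn_dslope h0).2 hFd
  have hcl : closure (Metric.ball (0:ℂ) |1|) ⊆ U := by
    rw [abs_one, closure_ball _ one_ne_zero]; exact hsub
  have a1 := (hD.mono hcl).diffContOnCl.circleAverage
  have a2 := (((differentiable_id.differentiableOn).mul hFd).mono hcl).diffContOnCl.circleAverage
  have hd : dslope F 0 0 = -q := by
    rw [dslope_same]
    have : HasDerivAt F (-q / (1 - q * 0)) 0 := by
      apply HasDerivAt.clog
      · simpa using ((hasDerivAt_id (0:ℂ)).const_mul q).const_sub 1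
      · simp
    simpa using this.deriv
  rw [circleAverage_def] at a1 a2
  rw [hd] at a1
  simp only [Pi.mul_apply, id, zero_mul] at a2
  have hne : ∀ θ, circleMap 0 1 θ ≠ 0 := fun θ => circleMap_ne_center one_ne_zero
  have hmem : ∀ θ, circleMap (0:ℂ) 1 θ ∈ U := fun θ => hsub (by simp)
  have hcF : Continuous (fun θ => F (circleMap 0 1 θ)) :=
    hFd.continuousOn.comp_continuous (continuous_circleMap 0 1) hmem
  have hcD : Continuous (fun θ => dslope F 0 (circleMap 0 1 θ)) :=
    hD.continuousOn.comp_continuous (continuous_circleMap 0 1) hmem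
  have hcM : Continuous (fun θ => circleMap 0 1 θ * F (circleMap 0 1 θ)) :=
    (continuous_circleMap 0 1).mul hcF
  have key : ∫ θ in 0..2*π, (dslope F 0 (circleMap 0 1 θ) + circleMap 0 1 θ * F (circleMap 0 1 θ)) = 2*π*(-q) := by
    rw [intervalIntegral.integral_add (hcD.intervalIntegrable _ _) (hcM.intervalIntegrable _ _)]
    have hp := Real.pi_ne_zero
    rw [inv_smul_eq_iff₀ (by positivity)] at a1 a2
    rw [a1, a2]; simp
  have key2 := congrArg Complex.re key
  have hre : (∫ θ in 0..2*π, (dslope F 0 (circleMap 0 1 θ) + circleMap 0 1 θ * F (circleMap 0 1 θ))).re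
     = ∫ θ in 0..2*π, (dslope F 0 (circleMap 0 1 θ) + circleMap 0 1 θ * F (circleMap 0 1 θ)).re := by
    have := Complex.reCLM.intervalIntegral_comp_comm ((hcD.add ((continuous_circleMap 0 1).mul hcF)).intervalIntegrable (μ := volume) 0 (2*π))
    exact this.symm
  rw [hre] at key2
  have : ∀ θ, (dslope F 0 (circleMap 0 1 θ) + circleMap 0 1 θ * F (circleMap 0 1 θ)).re = 2 * (lgq q θ * Real.cos θ) := by
    intro θ
    rw [dslope_of_ne _ (hne θ), slope_def_field]
    have hF0 : F 0 = 0 := by simp [hF]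
    have hinv : (circleMap (0:ℂ) 1 θ)⁻¹ = (starRingEnd ℂ) (circleMap 0 1 θ) := by
      rw [Complex.inv_def, Complex.normSq_eq_norm_sq]; simp
    rw [hF0, sub_zero, sub_zero, div_eq_mul_inv, hinv]
    simp only [Complex.add_re, Complex.mul_re, Complex.conj_re, Complex.conj_im, circleMap_re, circleMap_im]
    have : (F (circleMap 0 1 θ)).re = lgq q θ := by simp [hF, lgq, Complex.log_re]
    rw [this]; ring
  simp only [this, intervalIntegral.integral_const_mul] at key2
  have e : (2 * (π:ℂ) * (-q)).re = -(2*π*q.re) := by simp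
  rw [e] at key2
  linarith

lemma lgq_ii (q : ℂ) (a b : ℝ) : IntervalIntegrable (lgq q) volume a b := by
  apply MeromorphicOn.intervalIntegrable_log_norm (f := fun θ : ℝ => 1 - q * circleMap 0 1 θ)
  intro x _
  apply AnalyticAt.meromorphicAt
  exact analyticAt_const.sub (analyticAt_const.mul (analyticOnNhd_circleMap 0 1 x (Set.mem_univ _)))

lemma ae_ne {q : ℂ} (hq0 : q ≠ 0) : ∀ᵐ θ : ℝ, 1 - q * circleMap 0 1 θ ≠ 0 := by
  have : (({x : ℝ | 1 - q * circleMap 0 1 x = 0})).Countable := by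
    have h := Set.Countable.preimage_circleMap (Set.countable_singleton (q⁻¹)) (0:ℂ) (one_ne_zero : (1:ℝ) ≠ 0)
    refine h.mono ?_
    intro x hx
    simp only [Set.mem_preimage, Set.mem_singleton_iff]
    simp only [Set.mem_ofPred_eq] at hx
    exact eq_inv_of_mul_eq_one_right (sub_eq_zero.1 hx).symm
  have := this.ae_notMem volume
  simpa using this

lemma lg_lim {q : ℂ} (hq : ‖q‖ = 1) {g : ℝ → ℝ} (hg : Continuous g) {V : ℝ → ℝ} {v : ℝ}
    (hV : ∀ ρ : ℝ, 0 < ρ → ρ < 1 → ∫ θ in 0..2*π, lgq (ρ * q) θ * g θ = V ρ)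
    (hv : Tendsto V (𝓝[<] 1) (𝓝 v)) : ∫ θ in 0..2*π, lgq q θ * g θ = v := by
  have hev : ∀ᶠ ρ : ℝ in 𝓝[<] 1, 0 < ρ ∧ ρ < 1 := by
    filter_upwards [self_mem_nhdsWithin, mem_nhdsWithin_of_mem_nhds (lt_mem_nhds (zero_lt_one))] with ρ h1 h2
    exact ⟨h2, h1⟩
  have hne : ∀ᵐ θ : ℝ, 1 - q * circleMap 0 1 θ ≠ 0 :=
    ae_ne (by intro h; simp [h] at hq)
  have T : Tendsto (fun ρ : ℝ => ∫ θ in 0..2*π, lgq (ρ * q) θ * g θ) (𝓝[<] 1) (𝓝 (∫ θ in 0..2*π, lgq q θ * g θ)) := by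
    apply intervalIntegral.tendsto_integral_filter_of_dominated_convergence
      (fun θ => (|lgq q θ| + Real.log 2) * |g θ|)
    · refine Eventually.of_forall fun ρ => ?_
      have := (lgq_ii (ρ*q) 0 (2*π)).mul_continuousOn hg.continuousOn
      exact (intervalIntegrable_iff.1 this).aestronglyMeasurable
    · filter_upwards [hev] with ρ hρ
      filter_upwards [hne] with θ hθ _
      rw [Real.norm_eq_abs, abs_mul]
      apply mul_le_mul_of_nonneg_right _ (abs_nonneg _)
      set x := q * circleMap 0 1 θ with hx
      have hxn : ‖x‖ = 1 := by simp [hx, hq]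
      have e1 : (ρ * q * circleMap 0 1 θ : ℂ) = ρ * x := by rw [hx]; ring
      have hpos : 0 < ‖1 - x‖ := norm_pos_iff.2 hθ
      have hn : ‖(ρ * x : ℂ)‖ = ρ := by simp [hxn, abs_of_pos hρ.1]
      have hd1 : 1 - ρ ≤ ‖1 - ρ * x‖ := by
        have := norm_sub_norm_le (1:ℂ) (ρ * x)
        rw [hn] at this; simpa using this
      have hd2 : ‖1 - x‖ ≤ ‖1 - ρ * x‖ + (1 - ρ) := by
        have : (1 - x) = (1 - ρ * x) - ((1 - ρ : ℝ) : ℂ) * x := by push_cast; ring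
        rw [this]
        refine (norm_sub_le _ _).trans ?_
        rw [norm_mul, hxn, Complex.norm_real, Real.norm_eq_abs, abs_of_pos (by linarith [hρ.2])]
        simp
      have hd3 : ‖1 - ρ * x‖ ≤ 2 := by
        refine (norm_sub_le _ _).trans ?_
        rw [hn]; simp; linarith [hρ.2]
      have hp2 : 0 < ‖1 - ρ * x‖ := by linarith [hρ.2]
      have l1 : Real.log ‖1 - ρ * x‖ ≤ Real.log 2 := Real.log_le_log hp2 hd3
      have l2 : Real.log ‖1 - x‖ ≤ Real.log 2 + Real.log ‖1 - ρ * x‖ := by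
        rw [← Real.log_mul (by norm_num) hp2.ne']
        exact Real.log_le_log hpos (by linarith)
      simp only [lgq, e1, ← hx]
      rw [abs_le]
      constructor
      · linarith [neg_abs_le (Real.log ‖1 - x‖)]
      · linarith [abs_nonneg (Real.log ‖1 - x‖)]
    · exact ((lgq_ii q 0 (2*π)).norm.add intervalIntegrable_const).mul_continuousOn hg.abs.continuousOn
    · filter_upwards [hne] with θ hθ _
      apply Tendsto.mul_const
      unfold lgq
      have : ContinuousAt (fun ρ : ℝ => Real.log ‖1 - ρ * q * circleMap 0 1 θ‖) 1 := by
        apply ContinuousAt.log (by fun_prop)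
        simpa using hθ
      have := this.tendsto
      simp only [Complex.ofReal_one, one_mul] at this
      exact this.mono_left nhdsWithin_le_nhds
  refine tendsto_nhds_unique T (hv.congr' ?_)
  filter_upwards [hev] with ρ hρ
  exact (hV ρ hρ.1 hρ.2).symm

lemma lgP' {q : ℂ} (hq : ‖q‖ ≤ 1) {r : ℝ} (hr : |r| < 1) :
    ∫ θ in 0..2*π, lgq q θ * PPr r θ = 2 * π * Real.log ‖1 - q * r‖ := by
  rcases hq.lt_or_eq with h | h
  · exact lgP h hr
  · refine lg_lim h (PPr_cont hr) (V := fun ρ => 2 * π * Real.log ‖1 - ρ * q * r‖) ?_ ?_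
    · intro ρ h1 h2
      exact lgP (by simp [h, abs_of_pos h1, h2]) hr
    · have : ContinuousAt (fun ρ : ℝ => 2 * π * Real.log ‖1 - ρ * q * r‖) 1 := by
        apply ContinuousAt.mul (by fun_prop)
        apply ContinuousAt.log (by fun_prop)
        rw [norm_ne_zero_iff]
        have := one_sub_ne (q := (r:ℂ)) (z := q) (by simpa using hr) hq
        simpa [mul_comm] using this
      have := this.tendsto
      simp only [Complex.ofReal_one, one_mul] at this
      exact this.mono_left nhdsWithin_le_nhds

lemma lgcos' {q : ℂ} (hq : ‖q‖ ≤ 1) :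
    ∫ θ in 0..2*π, lgq q θ * Real.cos θ = - (π * q.re) := by
  rcases hq.lt_or_eq with h | h
  · exact lgcos h
  · refine lg_lim h Real.continuous_cos (V := fun ρ => -(π * (ρ * q).re)) ?_ ?_
    · intro ρ h1 h2
      exact lgcos (by simp [h, abs_of_pos h1, h2])
    · have : ContinuousAt (fun ρ : ℝ => -(π * (ρ * q : ℂ).re)) 1 := by fun_prop
      have := this.tendsto
      simp only [Complex.ofReal_one, one_mul] at this
      exact this.mono_left nhdsWithin_le_nhds

lemma circleMap_neg_eq (θ : ℝ) : circleMap 0 1 (-θ) = (circleMap 0 1 θ)⁻¹ := by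
  simp [circleMap, Complex.exp_neg]

lemma lgq_neg_ii (q : ℂ) (a b : ℝ) : IntervalIntegrable (fun θ => lgq q (-θ)) volume a b := by
  apply MeromorphicOn.intervalIntegrable_log_norm (f := fun θ : ℝ => 1 - q * circleMap 0 1 (-θ))
  intro x _
  apply AnalyticAt.meromorphicAt
  refine analyticAt_const.sub (analyticAt_const.mul ?_)
  exact AnalyticAt.comp' (analyticOnNhd_circleMap 0 1 (-x) (Set.mem_univ _)) (by fun_prop)

lemma half_int (q : ℂ) {g : ℝ → ℝ} (hg : Continuous g) (he : ∀ θ, g (-θ) = g θ)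
    (hp : Function.Periodic g (2*π)) :
    ∫ θ in 0..π, (lgq q θ + lgq q (-θ)) * g θ = ∫ θ in 0..2*π, lgq q θ * g θ := by
  have hper : Function.Periodic (fun θ => lgq q θ * g θ) (2*π) := by
    intro θ
    simp only [hp θ, lgq, periodic_circleMap 0 1 θ]
  have h1 : ∫ θ in 0..2*π, lgq q θ * g θ = ∫ θ in (-π)..π, lgq q θ * g θ := by
    have := hper.intervalIntegral_add_eq 0 (-π)
    rw [zero_add] at this
    rw [this]; congr 1; ring
  have ii : ∀ a b, IntervalIntegrable (fun θ => lgq q θ * g θ) volume a b := fun a b =>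
    (lgq_ii q a b).mul_continuousOn hg.continuousOn
  have h2 : ∫ θ in (-π)..0, lgq q θ * g θ = ∫ θ in 0..π, lgq q (-θ) * g θ := by
    have := intervalIntegral.integral_comp_neg (a := 0) (b := π) (fun θ => lgq q θ * g θ)
    simp only [he, neg_zero] at this
    exact this.symm
  have ii2 : IntervalIntegrable (fun θ => lgq q (-θ) * g θ) volume 0 π :=
    (lgq_neg_ii q 0 π).mul_continuousOn hg.continuousOn
  rw [h1, ← intervalIntegral.integral_add_adjacent_intervals (ii (-π) 0) (ii 0 π), h2,
    ← intervalIntegral.integral_add ii2 (ii 0 π)]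
  apply intervalIntegral.integral_congr
  intro θ _
  simp only; ring

lemma ae_ne' {q : ℂ} (hq0 : q ≠ 0) : ∀ᵐ θ : ℝ, 1 - q * circleMap 0 1 (-θ) ≠ 0 := by
  filter_upwards [ae_ne (inv_ne_zero hq0)] with θ h h2
  apply h
  rw [circleMap_neg_eq] at h2
  have h3 := (sub_eq_zero.1 h2)
  have : circleMap (0:ℂ) 1 θ ≠ 0 := circleMap_ne_center one_ne_zero
  field_simp at h3 ⊢
  rw [h3]; ring

lemma L_ae {q : ℂ} (hq0 : q ≠ 0) {w : ℝ} (hw : 2 * w * q = q^2 + 1) :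
    ∀ᵐ θ : ℝ, Real.log (2 * (Real.cos θ - w)) = -Real.log ‖q‖ + (lgq q θ + lgq q (-θ)) := by
  filter_upwards [ae_ne hq0, ae_ne' hq0] with θ h1 h2
  unfold lgq
  rw [← Real.log_mul (norm_ne_zero_iff.2 h1) (norm_ne_zero_iff.2 h2), ← norm_mul]
  have hcos : (2 * Real.cos θ : ℂ) = circleMap 0 1 θ + circleMap 0 1 (-θ) := by
    push_cast
    simp [circleMap, Complex.cos]; ring_nf
  have hz : circleMap 0 1 θ * circleMap 0 1 (-θ) = 1 := by
    rw [circleMap_neg_eq, mul_inv_cancel₀ (circleMap_ne_center one_ne_zero)]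
  have e : (1 - q * circleMap 0 1 θ) * (1 - q * circleMap 0 1 (-θ)) = q * ((2 * (w - Real.cos θ) : ℝ) : ℂ) := by
    rw [Complex.ofReal_mul, Complex.ofReal_sub, Complex.ofReal_ofNat]
    linear_combination q^2 * hz - hw + q * hcos
  have hne : (2 * (w - Real.cos θ) : ℝ) ≠ 0 := by
    intro h
    rw [h] at e
    simp at e
    exact e.elim h1 h2
  rw [e, norm_mul, Real.log_mul (norm_ne_zero_iff.2 hq0) (by rw [norm_ne_zero_iff]; exact_mod_cast hne),
    Complex.norm_real, Real.norm_eq_abs, Real.log_abs, ← Real.log_neg_eq_log]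
  ring_nf

lemma Lcos_ii (w a b : ℝ) : IntervalIntegrable (fun θ => Real.log (2 * (Real.cos θ - w))) volume a b := by
  apply MeromorphicOn.intervalIntegrable_log (f := fun θ : ℝ => 2 * (Real.cos θ - w))
  intro x _
  apply AnalyticAt.meromorphicAt
  fun_prop

lemma LL {q : ℂ} (hq0 : q ≠ 0) {w : ℝ} (hw : 2 * w * q = q^2 + 1) {g : ℝ → ℝ} (hg : Continuous g)
    (he : ∀ θ, g (-θ) = g θ) (hp : Function.Periodic g (2*π)) :
    ∫ θ in 0..π, Real.log (2 * (Real.cos θ - w)) * g θ =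
      -Real.log ‖q‖ * (∫ θ in 0..π, g θ) + ∫ θ in 0..2*π, lgq q θ * g θ := by
  rw [← half_int q hg he hp, ← intervalIntegral.integral_const_mul, ← intervalIntegral.integral_add]
  · apply intervalIntegral.integral_congr_ae
    filter_upwards [L_ae hq0 hw] with θ h _
    rw [h]; ring
  · exact (hg.intervalIntegrable _ _).const_mul _
  · have h2 : IntervalIntegrable (fun θ => lgq q (-θ)) volume 0 π := lgq_neg_ii q 0 π
    exact ((lgq_ii q 0 π).add h2).mul_continuousOn hg.continuousOn

lemma PPr_even (r θ : ℝ) : PPr r (-θ) = PPr r θ := by simp [PPr]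

lemma PPr_per (r : ℝ) : Function.Periodic (PPr r) (2*π) := by
  intro θ; simp [PPr]

lemma intP_half {r : ℝ} (hr : |r| < 1) : ∫ θ in 0..π, PPr r θ = π := by
  have h1 : ∫ θ in 0..2*π, PPr r θ = ∫ θ in (-π)..π, PPr r θ := by
    have := (PPr_per r).intervalIntegral_add_eq 0 (-π)
    rw [zero_add] at this
    rw [this]; congr 1; ring
  have ii : ∀ a b, IntervalIntegrable (PPr r) volume a b := fun a b =>
    (PPr_cont hr).intervalIntegrable a b
  have h2 : ∫ θ in (-π)..0, PPr r θ = ∫ θ in 0..π, PPr r θ := by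
    have := intervalIntegral.integral_comp_neg (a := 0) (b := π) (PPr r)
    simp only [PPr_even, neg_zero] at this
    exact this.symm
  rw [intP hr, ← intervalIntegral.integral_add_adjacent_intervals (ii (-π) 0) (ii 0 π), h2] at h1
  linarith

lemma PPr_zero (θ : ℝ) : PPr 0 θ = 1 := by simp [PPr]

lemma J_eq {q : ℂ} (hq0 : q ≠ 0) (hq : ‖q‖ ≤ 1) {w : ℝ} (hw : 2 * w * q = q^2 + 1)
    {r k m σ : ℝ} (hr : |r| < 1) (hk : ∀ θ, (Real.cos θ + k) * (σ * PPr r θ) = m) :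
    ∫ θ in 0..π, phi1 (Real.cos θ - w) * (1 + σ * PPr r θ) =
      π * (-w + m - σ * (w + k) + q.re - (w - m) * Real.log ‖q‖
        + (w + k) * σ * (-Real.log ‖q‖ + 2 * Real.log ‖1 - q * r‖)) := by
  have c0 := LL hq0 hw (PPr_cont (r := 0) (by simp)) (PPr_even 0) (PPr_per 0)
  have cr := LL hq0 hw (PPr_cont hr) (PPr_even r) (PPr_per r)
  have cc := LL hq0 hw Real.continuous_cos Real.cos_neg Real.cos_periodic
  rw [lgP' hq (by simp), intP_half (by simp)] at c0
  rw [lgP' hq hr, intP_half hr] at cr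
  rw [lgcos' hq] at cc
  have icos : ∫ θ in 0..π, Real.cos θ = 0 := by simp
  rw [icos] at cc
  simp only [PPr_zero, mul_one] at c0
  set L := fun θ => Real.log (2 * (Real.cos θ - w)) with hL
  have i0 : IntervalIntegrable L volume 0 π := Lcos_ii w 0 π
  have ir : IntervalIntegrable (fun θ => L θ * PPr r θ) volume 0 π :=
    i0.mul_continuousOn (PPr_cont hr).continuousOn
  have ic : IntervalIntegrable (fun θ => L θ * Real.cos θ) volume 0 π :=
    i0.mul_continuousOn Real.continuous_cos.continuousOn
  have j0 : IntervalIntegrable (fun θ => m - w) volume 0 π := intervalIntegrable_const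
  have jr : IntervalIntegrable (PPr r) volume 0 π := (PPr_cont hr).intervalIntegrable _ _
  have jc : IntervalIntegrable Real.cos volume 0 π := Real.continuous_cos.intervalIntegrable _ _
  have e : ∀ θ, phi1 (Real.cos θ - w) * (1 + σ * PPr r θ) =
      (((((Real.cos θ + (m - w)) + (-((w + k) * σ)) * PPr r θ) + (-1) * (L θ * Real.cos θ))
        + (w - m) * L θ) + ((w + k) * σ) * (L θ * PPr r θ)) := by
    intro θ
    simp only [phi1, Real.log_abs, hL]
    linear_combination (1 - Real.log (2 * (Real.cos θ - w))) * hk θ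
  simp only [e]
  rw [intervalIntegral.integral_add ((((jc.add j0).add (jr.const_mul _)).add (ic.const_mul _)).add (i0.const_mul _)) (ir.const_mul _),
    intervalIntegral.integral_add (((jc.add j0).add (jr.const_mul _)).add (ic.const_mul _)) (i0.const_mul _),
    intervalIntegral.integral_add ((jc.add j0).add (jr.const_mul _)) (ic.const_mul _),
    intervalIntegral.integral_add (jc.add j0) (jr.const_mul _),
    intervalIntegral.integral_add jc j0]
  simp only [intervalIntegral.integral_const_mul, intervalIntegral.integral_const, smul_eq_mul]
  rw [icos, intP_half hr, cc, cr]
  have c0' : ∫ θ in 0..π, L θ = _ := c0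
  rw [c0']
  simp
  ring

def rr (c : ℝ) : ℝ := if c < 1 then -c else if c = 1 then 0 else -c⁻¹

lemma rr_lt {c : ℝ} (hc : 0 < c) : |rr c| < 1 := by
  unfold rr
  split_ifs with h1 h2
  · rw [abs_neg, abs_of_pos hc]; exact h1
  · simp
  · rw [abs_neg, abs_of_pos (inv_pos.2 hc)]
    exact inv_lt_one_of_one_lt₀ (lt_of_le_of_ne (not_lt.1 h1) (Ne.symm h2))

lemma hk_eq {c : ℝ} (hc : 0 < c) (θ : ℝ) :
    (Real.cos θ + (1+c^2)/(2*c)) * (Real.sign (1-c) * PPr (rr c) θ) = (1-c^2)/(2*c) := by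
  have hd := PPr_den_pos (rr_lt hc) θ
  unfold PPr
  unfold rr at *
  rcases lt_trichotomy c 1 with h | h | h
  · rw [Real.sign_of_pos (by linarith)]
    simp only [h, if_true] at *
    rw [one_mul, mul_div_assoc', div_eq_div_iff hd.ne' (by positivity)]
    field_simp
    ring
  · subst h; simp
  · rw [Real.sign_of_neg (by linarith)]
    simp only [not_lt.2 h.le, h.ne', if_false] at *
    have : 1 - 2 * -c⁻¹ * Real.cos θ + (-c⁻¹)^2 = (c^2 + 2 * c * Real.cos θ + 1) / c^2 := by
      field_simp; ring
    rw [this] at hd ⊢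
    have hd2 : 0 < c^2 + 2 * c * Real.cos θ + 1 := by
      by_contra hh
      exact absurd hd (not_lt.2 (div_nonpos_of_nonpos_of_nonneg (not_lt.1 hh) (by positivity)))
    generalize hD : c^2 + 2 * c * Real.cos θ + 1 = D at hd2
    have : Real.cos θ = (D - c^2 - 1) / (2*c) := by rw [← hD]; field_simp; ring
    rw [this]
    field_simp
    ring

lemma arccosh_half {y : ℝ} (hy : 1 ≤ y) : arccosh ((y + y⁻¹)/2) = Real.log y := by
  unfold arccosh
  have hy0 : 0 < y := by linarith
  have e : ((y + y⁻¹)/2)^2 - 1 = ((y - y⁻¹)/2)^2 := by field_simp; ring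
  have : y⁻¹ ≤ 1 := inv_le_one_of_one_le₀ hy
  rw [e, Real.sqrt_sq (by linarith)]
  congr 1; ring

lemma abs_add_inv (y : ℝ) : |(y + y⁻¹)/2| = (|y| + |y|⁻¹)/2 := by
  rcases lt_trichotomy y 0 with h | h | h
  · have : y⁻¹ < 0 := inv_lt_zero.2 h
    rw [abs_of_neg (by linarith), abs_of_neg h, inv_neg]; ring
  · simp [h]
  · have : 0 < y⁻¹ := inv_pos.2 h
    rw [abs_of_pos (by linarith), abs_of_pos h]

lemma arccosh_abs {y : ℝ} (hy : 1 ≤ |y|) : arccosh |(y + y⁻¹)/2| = Real.log y := by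
  rw [abs_add_inv, arccosh_half hy, Real.log_abs]

lemma exists_q {w : ℝ} (hw : 1 < |w|) : ∃ q : ℝ, q ≠ 0 ∧ |q| < 1 ∧ 2 * w * q = q^2 + 1 ∧
    Real.sign w * Real.sqrt (w^2-1) = w - q := by
  rcases lt_or_ge 0 w with h | h
  · rw [abs_of_pos h] at hw
    have h2 : 0 < w^2 - 1 := by nlinarith
    have hs := Real.sq_sqrt h2.le
    have hp := Real.sqrt_pos.2 h2
    have hlt : Real.sqrt (w^2-1) < w := by nlinarith
    have hgt : w - 1 < Real.sqrt (w^2-1) := by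
      by_contra hh
      nlinarith
    refine ⟨w - Real.sqrt (w^2-1), by linarith [hlt] |> fun h : (0:ℝ) < w - Real.sqrt (w^2-1) => h.ne', ?_, by nlinarith, ?_⟩
    · rw [abs_lt]; constructor <;> linarith
    · rw [Real.sign_of_pos h]; ring
  · rw [abs_of_nonpos h] at hw
    have h2 : 0 < w^2 - 1 := by nlinarith
    have hs := Real.sq_sqrt h2.le
    have hp := Real.sqrt_pos.2 h2
    have hlt : Real.sqrt (w^2-1) < -w := by nlinarith
    have hgt : -w - 1 < Real.sqrt (w^2-1) := by
      by_contra hh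
      nlinarith
    refine ⟨w + Real.sqrt (w^2-1), by linarith [hlt] |> fun h : w + Real.sqrt (w^2-1) < 0 => h.ne, ?_, by nlinarith, ?_⟩
    · rw [abs_lt]; constructor <;> linarith
    · rw [Real.sign_of_neg (by linarith)]; ring

lemma AC_eq {c q w : ℝ} (hc : 0 < c) (hq0 : q ≠ 0) (hq : |q| < 1) (hw : 2 * w * q = q^2 + 1)
    (hne : w + (1+c^2)/(2*c) ≠ 0) : 1 + c*q ≠ 0 ∧ q + c ≠ 0 ∧
    Real.sign (1-c) * arccosh |(1 + ((1+c^2)/(2*c))*w)/(w + (1+c^2)/(2*c))|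
      = (Real.sign (1-c))^2 * (Real.log (1 + c*q) - Real.log (q + c)) ∧
    Real.log (2 * (w + (1+c^2)/(2*c))) = Real.log (1+c*q) + Real.log (q+c) - Real.log c - Real.log q := by
  have hwq : w = (q^2+1)/(2*q) := by field_simp; linarith
  have e1 : w + (1+c^2)/(2*c) = (q+c)*(1+c*q)/(2*c*q) := by rw [hwq]; field_simp; ring
  have hn : (q+c)*(1+c*q) ≠ 0 := by
    intro h; rw [h] at e1; simp at e1; exact hne e1
  have h2 : q + c ≠ 0 := left_ne_zero_of_mul hn
  have h1 : 1 + c*q ≠ 0 := right_ne_zero_of_mul hn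
  have hq2 : q^2 < 1 := by rw [← sq_abs]; nlinarith [abs_nonneg q]
  refine ⟨h1, h2, ?_, ?_⟩
  · have e2 : (1 + ((1+c^2)/(2*c))*w)/(w + (1+c^2)/(2*c)) = ((1+c*q)/(q+c) + ((1+c*q)/(q+c))⁻¹)/2 := by
      rw [e1, hwq]; field_simp; ring
    have e3 : (1 + ((1+c^2)/(2*c))*w)/(w + (1+c^2)/(2*c)) = ((q+c)/(1+c*q) + ((q+c)/(1+c*q))⁻¹)/2 := by
      rw [e2, inv_div, inv_div, add_comm]
    rcases lt_trichotomy c 1 with h | h | h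
    · rw [Real.sign_of_pos (by linarith), e2, arccosh_abs, Real.log_div h1 h2]; · ring
      rw [abs_div, one_le_div (abs_pos.2 h2)]
      apply sq_le_sq.1
      nlinarith [mul_pos (show 0 < 1 - c^2 by nlinarith) (show 0 < 1 - q^2 by linarith)]
    · subst h; simp
    · rw [Real.sign_of_neg (by linarith), e3, arccosh_abs, Real.log_div h2 h1]; · ring
      rw [abs_div, one_le_div (abs_pos.2 h1)]
      apply sq_le_sq.1
      nlinarith [mul_pos (show 0 < c^2 - 1 by nlinarith) (show 0 < 1 - q^2 by linarith)]
  · have : 2 * (w + (1+c^2)/(2*c)) = ((1+c*q)*(q+c))/(c*q) := by rw [e1]; field_simp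
    rw [this, Real.log_div (mul_ne_zero h1 h2) (mul_ne_zero hc.ne' hq0), Real.log_mul h1 h2, Real.log_mul hc.ne' hq0]
    ring

lemma phi1_scale {c x : ℝ} (hc : 0 < c) : (1/c) * phi1 (c * x) = phi1 x - x * Real.log c := by
  by_cases hx : x = 0
  · simp [hx, phi1]
  · unfold phi1
    rw [Real.log_abs, Real.log_abs, show 2 * (c*x) = c * (2*x) by ring, Real.log_mul hc.ne' (by simpa using hx)]
    field_simp
    ring

lemma final_id {c s : ℝ} (hc : 0 < c) :
    (1 - Real.sign (1-c)) * phi1 (s + 1/(2*c)) - (1/π) *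
      ∫ θ in 0..π, phi1 (Real.cos θ - (s - c/2)) * (1 + Real.sign (1-c) * PPr (rr c) θ)
      = Gc c s - Hc c s := by
  set w := s - c/2 with hw
  set k := (1+c^2)/(2*c) with hk
  set m := (1-c^2)/(2*c) with hm
  set σ := Real.sign (1-c) with hσ
  have hp := Real.pi_ne_zero
  have e1 : s + 1/(2*c) = w + k := by rw [hw, hk]; field_simp; ring
  have e2 : Gc c s = phi1 (w+k) - (w+k) * Real.log c - m := by
    rw [← phi1_scale hc, Gc, ← hm]
    congr 3
    rw [hw, hk]; field_simp; ring
  rw [e1, e2]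
  unfold Hc Htilde
  rw [← hw, ← hk, ← hm, ← hσ]
  by_cases h1 : |w| ≤ 1
  · rw [if_pos h1]
    have hw2 : w^2 ≤ 1 := by rw [← sq_abs]; nlinarith [abs_nonneg w]
    have hs := Real.sq_sqrt (show 0 ≤ 1 - w^2 by linarith)
    set q : ℂ := ⟨w, Real.sqrt (1-w^2)⟩ with hq
    have hqn2 : ‖q‖^2 = 1 := by
      rw [← Complex.normSq_eq_norm_sq, Complex.normSq_apply]; simp only [hq]; nlinarith
    have hqn : ‖q‖ = 1 := by
      have := norm_nonneg q; nlinarith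
    have hq0 : q ≠ 0 := by intro h; rw [h] at hqn; simp at hqn
    have hqw : 2 * w * q = q^2 + 1 := by
      apply Complex.ext
      · simp only [pow_two] at hs
        simp [hq, pow_two]; linarith
      · simp [hq, pow_two]; ring
    have hJ := J_eq hq0 hqn.le hqw (rr_lt hc) (hk_eq hc)
    rw [← hk, ← hm, ← hσ] at hJ
    rw [hJ, hqn, Real.log_one]
    have hre : q.re = w := rfl
    have hlog : 2 * Real.log ‖1 - q * (rr c : ℂ)‖ = Real.log (1 - 2 * rr c * w + (rr c)^2) := by
      have := normSq_one_sub_mul (q * (rr c : ℂ))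
      rw [norm_mul, mul_pow, hqn2] at this
      rw [show (2:ℝ) * Real.log ‖1 - q * (rr c : ℂ)‖ = Real.log (‖1 - q * (rr c : ℂ)‖^2) by rw [Real.log_pow]; norm_num, this]
      congr 1
      simp [hre]; ring
    rw [hlog, hre, one_div, inv_mul_cancel_left₀ hp]
    unfold rr phi1
    rw [Real.log_abs]
    have hwl := (abs_le.1 h1).1
    rcases lt_trichotomy c 1 with h | h | h
    · have s1 : σ = 1 := Real.sign_of_pos (by linarith)
      have hpos : 0 < 2 * (w + k) := by
        have : 1 < k := by rw [hk, lt_div_iff₀ (by positivity)]; nlinarith [sq_pos_of_pos (sub_pos.2 h)]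
        linarith
      have : 1 - 2 * (-c) * w + (-c)^2 = c * (2 * (w+k)) := by rw [hk]; field_simp; ring
      simp only [h, if_true]
      rw [this, Real.log_mul hc.ne' hpos.ne', s1]
      ring
    · have s1 : σ = 0 := by rw [hσ, h]; simp
      have m1 : m = 0 := by rw [hm, h]; simp
      rw [s1, m1, h]; simp
    · have s1 : σ = -1 := Real.sign_of_neg (by linarith)
      have hpos : 0 < 2 * (w + k) := by
        have : 1 < k := by rw [hk, lt_div_iff₀ (by positivity)]; nlinarith [sq_pos_of_pos (sub_pos.2 h)]
        linarith
      have : 1 - 2 * (-c⁻¹) * w + (-c⁻¹)^2 = (2 * (w+k)) / c := by rw [hk]; field_simp; ring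
      simp only [not_lt.2 h.le, h.ne', if_false]
      rw [this, Real.log_div hpos.ne' hc.ne', s1]
      ring
  · rw [if_neg h1]
    obtain ⟨q, hq0, hq, hqw, hsq⟩ := exists_q (not_le.1 h1)
    have hJ := J_eq (q := (q:ℂ)) (w := w) (by exact_mod_cast hq0) (by simpa using hq.le) (by exact_mod_cast hqw) (rr_lt hc) (hk_eq hc)
    rw [← hk, ← hm, ← hσ] at hJ
    have hn1 : Real.log ‖(q:ℂ)‖ = Real.log q := by rw [Complex.norm_real, Real.norm_eq_abs, Real.log_abs]
    have hn2 : Real.log ‖1 - (q:ℂ) * (rr c : ℂ)‖ = Real.log (1 - q * rr c) := by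
      rw [show (1 - (q:ℂ) * (rr c : ℂ)) = ((1 - q * rr c : ℝ) : ℂ) by push_cast; ring, Complex.norm_real, Real.norm_eq_abs, Real.log_abs]
    rw [hn1, hn2, Complex.ofReal_re] at hJ
    have hA : arccosh |w| = - Real.log q := by
      rw [← Real.log_inv, ← arccosh_abs (y := q⁻¹)]
      · congr 2; field_simp; linarith
      · rw [abs_inv]; exact (one_le_inv₀ (abs_pos.2 hq0)).2 hq.le
    rw [hJ, hA, hsq, one_div, inv_mul_cancel_left₀ hp]
    by_cases hne : w + k = 0
    · rw [hne]; simp [phi1]; ring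
    · obtain ⟨n1, n2, hAC, hL⟩ := AC_eq hc hq0 hq hqw hne
      rw [← hk, ← hσ] at hAC
      rw [← hk] at hL
      rw [mul_right_comm σ (w+k), hAC]
      unfold phi1 rr
      rw [Real.log_abs, hL]
      rcases lt_trichotomy c 1 with h | h | h
      · have s1 : σ = 1 := Real.sign_of_pos (by linarith)
        simp only [h, if_true]
        rw [show 1 - q * (-c) = 1 + c*q by ring, s1]
        ring
      · have s1 : σ = 0 := by rw [hσ, h]; simp
        have m1 : m = 0 := by rw [hm, h]; simp
        rw [s1, m1, h]; simp; ring
      · have s1 : σ = -1 := Real.sign_of_neg (by linarith)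
        simp only [not_lt.2 h.le, h.ne', if_false]
        rw [show 1 - q * (-c⁻¹) = (q + c)/c by field_simp; ring, Real.log_div n2 hc.ne', s1]
        ring

lemma D_pos {c z : ℝ} (hc : 0 < c) (hz : -1 < z) : 0 < 1 + c^2 + 2*c*z := by
  nlinarith [sq_nonneg (1-c), mul_pos hc (show 0 < 1 + z by linarith)]

lemma sqrtD_deriv {c t : ℝ} (hD : 0 < 1 + 2*t*c) :
    HasDerivAt (fun t => Real.sqrt (1+2*t*c)) (c / Real.sqrt (1+2*t*c)) t := by
  have h1 : HasDerivAt (fun t : ℝ => 1+2*t*c) (2*c) t := by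
    simpa using (((hasDerivAt_id t).const_mul 2).mul_const c).const_add 1
  have := h1.sqrt hD.ne'
  convert this using 1
  field_simp

lemma arcsinA_deriv {c t : ℝ} (hc : 0 < c) (h1 : -1 < t - c/2) (h2 : t - c/2 < 1) :
    HasDerivAt (fun t => Real.arcsin ((2*t+c)/(2*Real.sqrt (1+2*t*c))))
      ((1 + c*(t-c/2))/((1+2*t*c) * Real.sqrt (1-(t-c/2)^2))) t := by
  have hD : 0 < 1 + 2*t*c := by have := D_pos hc h1; nlinarith
  have hY2 : 0 < 1 - (t-c/2)^2 := by nlinarith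
  have hS := Real.sqrt_pos.2 hD
  have hSS := Real.sq_sqrt hD.le
  have hY := Real.sqrt_pos.2 hY2
  have hYY := Real.sq_sqrt hY2.le
  have hn : HasDerivAt (fun t : ℝ => 2*t+c) 2 t := by
    simpa using ((hasDerivAt_id t).const_mul 2).add_const c
  have hA := hn.div ((sqrtD_deriv hD).const_mul 2) (by positivity)
  set S := Real.sqrt (1+2*t*c) with hSdef
  set Y := Real.sqrt (1-(t-c/2)^2) with hYdef
  have e : 1 - ((2*t+c)/(2*S))^2 = (Y/S)^2 := by
    field_simp
    nlinarith
  have hpos : 0 < Y/S := by positivity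
  have hlt : ((2*t+c)/(2*S))^2 < 1 := by nlinarith
  have hab := abs_lt.1 ((sq_lt_one_iff_abs_lt_one _).1 hlt)
  have := (Real.hasDerivAt_arcsin hab.1.ne' hab.2.ne).comp t hA
  rw [e, Real.sqrt_sq hpos.le] at this
  refine HasDerivAt.congr_deriv this ?_
  rw [← hSS]
  field_simp
  rw [hSS]
  ring

lemma arccosB_deriv {c t : ℝ} (hc : 0 < c) (h1 : -1 < t - c/2) (h2 : t - c/2 < 1) :
    HasDerivAt (fun t => Real.arccos ((2+2*t*c-c^2)/(2*Real.sqrt (1+2*t*c))))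
      (-(c*(t+c/2))/((1+2*t*c) * Real.sqrt (1-(t-c/2)^2))) t := by
  have hD : 0 < 1 + 2*t*c := by have := D_pos hc h1; nlinarith
  have hY2 : 0 < 1 - (t-c/2)^2 := by nlinarith
  have hS := Real.sqrt_pos.2 hD
  have hSS := Real.sq_sqrt hD.le
  have hY := Real.sqrt_pos.2 hY2
  have hYY := Real.sq_sqrt hY2.le
  have hn : HasDerivAt (fun t : ℝ => 2+2*t*c-c^2) (2*c) t := by
    simpa using ((((hasDerivAt_id t).const_mul 2).mul_const c).const_add 2).sub_const (c^2)
  have hA := hn.div ((sqrtD_deriv hD).const_mul 2) (by positivity)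
  set S := Real.sqrt (1+2*t*c) with hSdef
  set Y := Real.sqrt (1-(t-c/2)^2) with hYdef
  have e : 1 - ((2+2*t*c-c^2)/(2*S))^2 = (c*Y/S)^2 := by
    field_simp
    rw [hSS, hYY]
    ring
  have hpos : 0 < c*Y/S := by positivity
  have hlt : ((2+2*t*c-c^2)/(2*S))^2 < 1 := by nlinarith
  have hab := abs_lt.1 ((sq_lt_one_iff_abs_lt_one _).1 hlt)
  have := (Real.hasDerivAt_arccos hab.1.ne' hab.2.ne).comp t hA
  rw [e, Real.sqrt_sq hpos.le] at this
  refine HasDerivAt.congr_deriv this ?_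
  rw [← hSS]
  field_simp
  rw [hSS]
  ring

lemma hshape_deriv {c t : ℝ} (hc : 0 < c) (h1 : -1 < t - c/2) (h2 : t - c/2 < 1) :
    HasDerivAt (hshape c) ((2/π) * Real.arcsin ((2*t+c)/(2*Real.sqrt (1+2*t*c)))) t := by
  have hD : 0 < 1 + 2*t*c := by have := D_pos hc h1; nlinarith
  have hY2 : 0 < 1 - (t-c/2)^2 := by nlinarith
  have hY := Real.sqrt_pos.2 hY2
  have hYY := Real.sq_sqrt hY2.le
  have hfun : hshape c = fun s => (2/π) * (s * Real.arcsin ((2*s+c)/(2*Real.sqrt (1+2*s*c)))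
      + (1/(2*c)) * Real.arccos ((2+2*s*c-c^2)/(2*Real.sqrt (1+2*s*c)))
      + (1/4) * Real.sqrt (4-(2*s-c)^2)) := by
    funext s; unfold hshape; rw [if_neg hc.ne']
  have e4 : Real.sqrt (4-(2*t-c)^2) = 2 * Real.sqrt (1-(t-c/2)^2) := by
    rw [show 4-(2*t-c)^2 = 2^2 * (1-(t-c/2)^2) by ring, Real.sqrt_mul (by norm_num), Real.sqrt_sq (by norm_num)]
  have h3 : HasDerivAt (fun s => Real.sqrt (4-(2*s-c)^2)) (-(2*(t-c/2))/Real.sqrt (1-(t-c/2)^2)) t := by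
    have hn : HasDerivAt (fun s : ℝ => 4-(2*s-c)^2) (-(2*(2*t-c)*2)) t := by
      have := ((((hasDerivAt_id t).const_mul 2).sub_const c).pow 2).const_sub 4
      simpa using this
    have := hn.sqrt (by nlinarith)
    rw [e4] at this
    refine HasDerivAt.congr_deriv this ?_
    field_simp
  rw [hfun]
  have := ((((hasDerivAt_id t).mul (arcsinA_deriv hc h1 h2)).add
    ((arccosB_deriv hc h1 h2).const_mul (1/(2*c)))).add (h3.const_mul (1/4))).const_mul (2/π)
  refine HasDerivAt.congr_deriv this ?_
  congr 1
  simp only [id]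
  set Y := Real.sqrt (1-(t-c/2)^2) with hYdef
  have hz : t * ((1 + c*(t-c/2))/((1+2*t*c) * Y)) + 1/(2*c) * (-(c*(t+c/2))/((1+2*t*c) * Y))
      + 1/4 * (-(2*(t-c/2))/Y) = 0 := by
    generalize hDD : 1+2*t*c = D at hD ⊢
    field_simp
    rw [← hDD]
    ring
  linear_combination hz

def WW (c θ : ℝ) : ℝ := 1 - (1/π) * ∫ x in 0..θ, (1 + Real.sign (1-c) * PPr (rr c) x)

lemma wt_cont {c : ℝ} (hc : 0 < c) : Continuous (fun x => 1 + Real.sign (1-c) * PPr (rr c) x) :=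
  continuous_const.add (continuous_const.mul (PPr_cont (rr_lt hc)))

lemma WW_deriv {c : ℝ} (hc : 0 < c) (θ : ℝ) :
    HasDerivAt (WW c) (-((1/π) * (1 + Real.sign (1-c) * PPr (rr c) θ))) θ := by
  have := (intervalIntegral.integral_hasDerivAt_right ((wt_cont hc).intervalIntegrable 0 θ)
    ((wt_cont hc).stronglyMeasurableAtFilter _ _) (wt_cont hc).continuousAt).const_mul (1/π) |>.const_sub 1
  exact this

lemma WW_cont {c : ℝ} (hc : 0 < c) : Continuous (WW c) :=
  continuous_iff_continuousAt.2 fun θ => (WW_deriv hc θ).continuousAt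

lemma WW_zero (c : ℝ) : WW c 0 = 1 := by simp [WW]

lemma WW_pi {c : ℝ} (hc : 0 < c) : WW c π = -Real.sign (1-c) := by
  unfold WW
  rw [intervalIntegral.integral_add intervalIntegrable_const
    (((PPr_cont (rr_lt hc)).intervalIntegrable _ _).const_mul _),
    intervalIntegral.integral_const_mul, intP_half (rr_lt hc)]
  simp
  have := Real.pi_ne_zero
  field_simp
  ring

lemma arcsin_WW {c θ : ℝ} (hc : 0 < c) (h0 : 0 < θ) (hπ : θ < π) :
    (2/π) * Real.arcsin ((2*(c/2 + Real.cos θ)+c)/(2*Real.sqrt (1+2*(c/2 + Real.cos θ)*c))) = WW c θ := by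
  have hp := Real.pi_pos
  set f := fun x : ℝ => (2/π) * Real.arcsin ((2*(c/2 + Real.cos x)+c)/(2*Real.sqrt (1+2*(c/2 + Real.cos x)*c))) with hf
  have hcos : ∀ x ∈ Set.Icc 0 θ, -1 < Real.cos x := by
    intro x hx
    rw [← Real.cos_pi]
    exact Real.cos_lt_cos_of_nonneg_of_le_pi hx.1 le_rfl (lt_of_le_of_lt hx.2 hπ)
  have hDp : ∀ x ∈ Set.Icc 0 θ, 0 < 1+2*(c/2 + Real.cos x)*c := by
    intro x hx
    have := D_pos hc (hcos x hx); nlinarith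
  have hcont : ContinuousOn f (Set.Icc 0 θ) := by
    apply ContinuousOn.mul continuousOn_const
    apply Real.continuous_arcsin.comp_continuousOn
    apply ContinuousOn.div (by fun_prop) (by fun_prop)
    intro x hx
    have := Real.sqrt_pos.2 (hDp x hx)
    positivity
  have hder : ∀ x ∈ Set.Ioo 0 θ, HasDerivAt f (-((1/π) * (1 + Real.sign (1-c) * PPr (rr c) x))) x := by
    intro x hx
    have hx' := Set.Ioo_subset_Icc_self hx
    have hs : 0 < Real.sin x := Real.sin_pos_of_pos_of_lt_pi hx.1 (hx.2.trans hπ)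
    have hc1 : Real.cos x < 1 := by
      rw [← Real.cos_zero]
      exact Real.cos_lt_cos_of_nonneg_of_le_pi le_rfl (hx.2.trans hπ).le hx.1
    have hA := arcsinA_deriv (c := c) (t := c/2 + Real.cos x) hc (by simpa using hcos x hx') (by simpa using hc1)
    have hcomp := (hA.comp x ((Real.hasDerivAt_cos x).const_add (c/2))).const_mul (2/π)
    refine HasDerivAt.congr_deriv hcomp ?_
    rw [show c/2 + Real.cos x - c/2 = Real.cos x by ring]
    have : Real.sqrt (1 - Real.cos x^2) = Real.sin x := by
      rw [show 1 - Real.cos x^2 = Real.sin x^2 by linarith [Real.sin_sq_add_cos_sq x], Real.sqrt_sq hs.le]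
    rw [this]
    have hk := hk_eq hc x
    have hD := hDp x hx'
    generalize Real.sign (1-c) * PPr (rr c) x = P at *
    have hP : P = (1-c^2)/(1+2*(c/2 + Real.cos x)*c) := by
      rw [eq_div_iff hD.ne']
      field_simp at hk
      linear_combination hk
    rw [hP]
    generalize hDD : 1+2*(c/2 + Real.cos x)*c = D at hD ⊢
    field_simp
    rw [← hDD]
    ring
  have hint := intervalIntegral.integral_eq_sub_of_hasDerivAt_of_le h0.le hcont hder
    (((wt_cont hc).const_mul (1/π)).neg.intervalIntegrable _ _)
  have hf0 : f 0 = 1 := by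
    simp only [hf, Real.cos_zero]
    rw [show 1 + 2*(c/2+1)*c = (1+c)^2 by ring, Real.sqrt_sq (by linarith),
      show (2*(c/2+1)+c) = 2*(1+c) by ring, div_self (by positivity), Real.arcsin_one]
    field_simp
  rw [intervalIntegral.integral_neg, intervalIntegral.integral_const_mul, hf0] at hint
  change f θ = _
  unfold WW
  linarith

lemma phi1_cont : Continuous phi1 := by
  have : phi1 = fun x => x - (1/2) * ((2*x) * Real.log (2*x)) := by
    funext x; unfold phi1; rw [Real.log_abs]; ring
  rw [this]
  exact continuous_id.sub (continuous_const.mul (Real.continuous_mul_log.comp (by fun_prop)))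

lemma phi1_neg (x : ℝ) : phi1 (-x) = -phi1 x := by
  unfold phi1; rw [Real.log_abs, Real.log_abs, show 2 * -x = -(2*x) by ring, Real.log_neg_eq_log]; ring

lemma phi1_deriv {x : ℝ} (hx : x ≠ 0) : HasDerivAt phi1 (-Real.log (2*x)) x := by
  have h2 : (2*x) ≠ 0 := by simpa using hx
  have : phi1 = fun x => x - x * Real.log (2*x) := by
    funext x; unfold phi1; rw [Real.log_abs]
  rw [this]
  have hl : HasDerivAt (fun x : ℝ => Real.log (2*x)) (2/(2*x)) x := by
    have := ((hasDerivAt_id x).const_mul 2).log h2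
    simpa using this
  have := (hasDerivAt_id x).sub ((hasDerivAt_id x).mul hl)
  refine HasDerivAt.congr_deriv this ?_
  simp only [id]
  field_simp
  ring

lemma phi0_eq (s t : ℝ) : phi0 (s - t) = -Real.log (2*(t-s)) := by
  unfold phi0
  rw [Real.log_abs, ← Real.log_neg_eq_log]; ring_nf

lemma phi0_ii (s x y : ℝ) : IntervalIntegrable (fun t => phi0 (s - t)) volume x y := by
  simp only [phi0_eq]
  apply IntervalIntegrable.neg
  apply MeromorphicOn.intervalIntegrable_log (f := fun t : ℝ => 2 * (t - s))
  intro x _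
  apply AnalyticAt.meromorphicAt
  fun_prop

lemma phi0_int (s x y : ℝ) : ∫ t in x..y, phi0 (s - t) = phi1 (y - s) - phi1 (x - s) := by
  apply integral_eq_of_hasDerivAt_off_countable (fun t => phi1 (t - s)) _ (Set.countable_singleton s)
  · exact (phi1_cont.comp (by fun_prop)).continuousOn
  · intro t ht
    have hne : t - s ≠ 0 := sub_ne_zero.2 (by simpa using ht.2)
    have := (phi1_deriv hne).comp t ((hasDerivAt_id t).sub_const s)
    rw [phi0_eq]
    exact HasDerivAt.congr_deriv this (by simp)
  · exact phi0_ii s x y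

lemma const_piece {s x y d : ℝ} {f : ℝ → ℝ} (hxy : x ≤ y) (hf : ∀ t ∈ Set.Ioo x y, deriv f t = d) :
    IntervalIntegrable (fun t => phi0 (s - t) * deriv f t) volume x y ∧
    ∫ t in x..y, phi0 (s - t) * deriv f t = d * (phi1 (y - s) - phi1 (x - s)) := by
  have he : Set.EqOn (fun t => phi0 (s - t) * d) (fun t => phi0 (s - t) * deriv f t) (Set.Ioo x y) := by
    intro t ht
    simp only [hf t ht]
  constructor
  · have h := (phi0_ii s x y).mul_const d
    rw [intervalIntegrable_iff_integrableOn_Ioo_of_le hxy] at h ⊢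
    exact h.congr_fun he measurableSet_Ioo
  · rw [← intervalIntegral.integral_congr_Ioo_of_le hxy he, intervalIntegral.integral_mul_const, phi0_int]
    ring

lemma image_cos (c : ℝ) : (fun θ => c/2 + Real.cos θ) '' Set.Icc 0 π = Set.Icc (c/2-1) (c/2+1) := by
  have : (fun θ => c/2 + Real.cos θ) = (fun x => c/2 + x) ∘ Real.cos := rfl
  rw [this, Set.image_comp, Real.bijOn_cos.image_eq, Set.image_const_add_Icc]
  rfl

lemma theta_int {c w : ℝ} (hc : 0 < c) :
    IntervalIntegrable (fun θ => Real.sin θ * (-Real.log (2*(Real.cos θ - w)) * WW c θ)) volume 0 π ∧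
    ∫ θ in 0..π, Real.sin θ * (-Real.log (2*(Real.cos θ - w)) * WW c θ) =
      phi1 (1 - w) + Real.sign (1-c) * phi1 (-1 - w) -
      (1/π) * ∫ θ in 0..π, phi1 (Real.cos θ - w) * (1 + Real.sign (1-c) * PPr (rr c) θ) := by
  have h1 : IntervalIntegrable (fun θ => Real.sin θ * (-Real.log (2*(Real.cos θ - w)) * WW c θ)) volume 0 π :=
    (((Lcos_ii w 0 π).neg).mul_continuousOn (WW_cont hc).continuousOn).continuousOn_mul Real.continuous_sin.continuousOn
  refine ⟨h1, ?_⟩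
  have hpc : Continuous (fun θ => phi1 (Real.cos θ - w)) := phi1_cont.comp (by fun_prop)
  have h2 : IntervalIntegrable (fun θ => (1/π) * (phi1 (Real.cos θ - w) * (1 + Real.sign (1-c) * PPr (rr c) θ))) volume 0 π :=
    (continuous_const.mul (hpc.mul (wt_cont hc))).intervalIntegrable _ _
  have key := integral_eq_of_hasDerivAt_off_countable_of_le
    (fun θ => -(phi1 (Real.cos θ - w) * WW c θ))
    (fun θ => Real.sin θ * (-Real.log (2*(Real.cos θ - w)) * WW c θ) +
      (1/π) * (phi1 (Real.cos θ - w) * (1 + Real.sign (1-c) * PPr (rr c) θ)))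
    (a := 0) (b := π) (s := {θ | θ ∈ Set.Icc 0 π ∧ Real.cos θ = w}) Real.pi_pos.le ?_ ?_ ?_ (h1.add h2)
  · rw [intervalIntegral.integral_add h1 h2, intervalIntegral.integral_const_mul] at key
    rw [WW_pi hc, WW_zero, Real.cos_pi, Real.cos_zero] at key
    linarith
  · apply Set.Subsingleton.countable
    intro x hx y hy
    exact Real.injOn_cos hx.1 hy.1 (hx.2.trans hy.2.symm)
  · exact (hpc.mul (WW_cont hc)).neg.continuousOn
  · intro θ hθ
    have hne : Real.cos θ - w ≠ 0 := by
      intro h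
      exact hθ.2 ⟨Set.Ioo_subset_Icc_self hθ.1, sub_eq_zero.1 h⟩
    have := ((phi1_deriv hne).comp θ ((Real.hasDerivAt_cos θ).sub_const w)).mul (WW_deriv hc θ) |>.neg
    refine HasDerivAt.congr_deriv this ?_
    simp only [Function.comp]
    ring

lemma mid_piece {c s : ℝ} {f : ℝ → ℝ} (hc : 0 < c)
    (hf : ∀ t ∈ Set.Ioo (c/2-1) (c/2+1), deriv f t = (2/π) * Real.arcsin ((2*t+c)/(2*Real.sqrt (1+2*t*c)))) :
    IntervalIntegrable (fun t => phi0 (s - t) * deriv f t) volume (c/2-1) (c/2+1) ∧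
    ∫ t in (c/2-1)..(c/2+1), phi0 (s - t) * deriv f t =
      phi1 (1 - (s - c/2)) + Real.sign (1-c) * phi1 (-1 - (s - c/2)) -
      (1/π) * ∫ θ in 0..π, phi1 (Real.cos θ - (s - c/2)) * (1 + Real.sign (1-c) * PPr (rr c) θ) := by
  obtain ⟨i1, i2⟩ := theta_int (c := c) (w := s - c/2) hc
  have hle : c/2 - 1 ≤ c/2 + 1 := by linarith
  have hder : ∀ θ ∈ Set.Icc 0 π, HasDerivWithinAt (fun θ => c/2 + Real.cos θ) (-Real.sin θ) (Set.Icc 0 π) θ :=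
    fun θ _ => ((Real.hasDerivAt_cos θ).const_add (c/2)).hasDerivWithinAt
  have hinj : Set.InjOn (fun θ => c/2 + Real.cos θ) (Set.Icc 0 π) := by
    intro x hx y hy h
    exact Real.injOn_cos hx hy (by simpa using h)
  have he : Set.EqOn (fun θ => Real.sin θ * (-Real.log (2*(Real.cos θ - (s-c/2))) * WW c θ))
     (fun θ => |(-Real.sin θ)| • (phi0 (s - (c/2 + Real.cos θ)) * deriv f (c/2 + Real.cos θ))) (Set.Ioo 0 π) := by
    intro θ hθ
    have hs := Real.sin_pos_of_pos_of_lt_pi hθ.1 hθ.2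
    have hc0 : Real.cos θ < 1 := by
      rw [← Real.cos_zero]
      exact Real.cos_lt_cos_of_nonneg_of_le_pi le_rfl hθ.2.le hθ.1
    have hc1 : -1 < Real.cos θ := by
      rw [← Real.cos_pi]
      exact Real.cos_lt_cos_of_nonneg_of_le_pi hθ.1.le le_rfl hθ.2
    simp only [abs_neg, abs_of_pos hs, smul_eq_mul]
    rw [hf _ ⟨by linarith, by linarith⟩, arcsin_WW hc hθ.1 hθ.2, phi0_eq]
    congr 4
    ring
  constructor
  · rw [intervalIntegrable_iff_integrableOn_Icc_of_le hle, ← image_cos,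
      integrableOn_image_iff_integrableOn_abs_deriv_smul measurableSet_Icc hder hinj,
      ← intervalIntegrable_iff_integrableOn_Icc_of_le Real.pi_pos.le,
      intervalIntegrable_iff_integrableOn_Ioo_of_le Real.pi_pos.le]
    rw [intervalIntegrable_iff_integrableOn_Ioo_of_le Real.pi_pos.le] at i1
    exact i1.congr_fun he measurableSet_Ioo
  · rw [← i2, intervalIntegral.integral_congr_Ioo_of_le Real.pi_pos.le he,
      intervalIntegral.integral_of_le hle, ← integral_Icc_eq_integral_Ioc, ← image_cos,
      integral_image_eq_integral_abs_deriv_smul measurableSet_Icc hder hinj,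
      integral_Icc_eq_integral_Ioc, intervalIntegral.integral_of_le Real.pi_pos.le]

lemma deriv_of_eqOn {f g : ℝ → ℝ} {S : Set ℝ} (hS : IsOpen S) (h : Set.EqOn f g S) {t d : ℝ} (ht : t ∈ S)
    (hg : HasDerivAt g d t) : deriv f t = d :=
  (hg.congr_of_eventuallyEq (h.eventuallyEq_of_mem (hS.mem_nhds ht))).deriv

lemma Omega_mid {c t : ℝ} (hc : 0 < c) (ht : t ∈ Set.Ioo (c/2-1) (c/2+1)) :
    deriv (Omega c) t = (2/π) * Real.arcsin ((2*t+c)/(2*Real.sqrt (1+2*t*c))) := by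
  refine deriv_of_eqOn isOpen_Ioo (g := hshape c) ?_ ht (hshape_deriv hc (by linarith [ht.1]) (by linarith [ht.2]))
  intro x hx
  have h1 : c - 2 ≤ 2*x ∧ 2*x ≤ c + 2 := ⟨by linarith [hx.1], by linarith [hx.2]⟩
  have h2 : ¬ (-(1/c) ≤ 2*x ∧ 2*x ≤ c - 2) := fun h => by linarith [hx.1, h.2]
  unfold Omega
  rw [if_pos h1, if_neg h2]
  simp

lemma Omega_right {c t : ℝ} (hc : 0 < c) (ht : c/2+1 < t) : deriv (Omega c) t = 1 := by
  refine deriv_of_eqOn isOpen_Ioi (g := id) ?_ (Set.mem_Ioi.2 ht) (hasDerivAt_id t)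
  intro x hx
  have hx : c/2+1 < x := hx
  have h1 : ¬ (c - 2 ≤ 2*x ∧ 2*x ≤ c + 2) := fun h => by linarith [h.2]
  have h2 : ¬ (-(1/c) ≤ 2*x ∧ 2*x ≤ c - 2) := fun h => by linarith [h.2]
  unfold Omega
  rw [if_neg h1, if_neg h2, abs_of_pos (by linarith)]
  simp

lemma Omega_left1 {c t : ℝ} (hc : 0 < c) (hc1 : c ≤ 1) (ht : t < c/2-1) : deriv (Omega c) t = -1 := by
  refine deriv_of_eqOn isOpen_Iio (g := fun x => -x) ?_ (Set.mem_Iio.2 ht) (hasDerivAt_neg t)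
  intro x hx
  have hx : x < c/2-1 := hx
  have h1 : ¬ (c - 2 ≤ 2*x ∧ 2*x ≤ c + 2) := fun h => by linarith [h.1]
  unfold Omega
  rw [if_neg h1, if_pos hc1, abs_of_neg (by linarith)]

lemma p_lt {c : ℝ} (hc1 : 1 < c) : -(1/(2*c)) < c/2 - 1 := by
  have : c/2 - 1 + 1/(2*c) = (c-1)^2/(2*c) := by field_simp; ring
  have h2 : 0 < (c-1)^2/(2*c) := by
    have : 0 < c - 1 := by linarith
    positivity
  linarith

lemma Omega_left2 {c t : ℝ} (hc1 : 1 < c) (ht : t < -(1/(2*c))) : deriv (Omega c) t = -1 := by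
  refine deriv_of_eqOn isOpen_Iio (g := fun x => -x) ?_ (Set.mem_Iio.2 ht) (hasDerivAt_neg t)
  intro x hx
  have hx : x < -(1/(2*c)) := hx
  have e : 1/c = 2 * (1/(2*c)) := by field_simp
  have hp := p_lt hc1
  have hpos : 0 < 1/(2*c) := by positivity
  have h1 : ¬ (c - 2 ≤ 2*x ∧ 2*x ≤ c + 2) := fun h => by linarith [h.1]
  have h2 : ¬ (-(1/c) ≤ 2*x ∧ 2*x ≤ c - 2) := fun h => by linarith [h.1]
  unfold Omega
  rw [if_neg h1, if_neg (not_le.2 hc1), if_neg h2, abs_of_neg (by linarith)]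

lemma Omega_mid2 {c t : ℝ} (hc1 : 1 < c) (ht : t ∈ Set.Ioo (-(1/(2*c))) (c/2-1)) : deriv (Omega c) t = 1 := by
  refine deriv_of_eqOn isOpen_Ioo (g := fun x => x + 1/c) ?_ ht ((hasDerivAt_id t).add_const _)
  intro x hx
  have e : 1/c = 2 * (1/(2*c)) := by field_simp
  have h2 : (-(1/c) ≤ 2*x ∧ 2*x ≤ c - 2) := ⟨by linarith [hx.1], by linarith [hx.2]⟩
  unfold Omega
  rw [if_neg (not_le.2 hc1), if_pos h2]

/-- For `c > 0`, `a < min(−1+c/2, −1/(2c))`, `b > 1+c/2` and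
`s ∈ (a,b)`: `I_c(s) = ∫_a^b φ₀(s−t)·Ω_c′(t) dt = φ₁(a−s) + φ₁(b−s) + G_c(s) − H_c(s)`. -/
theorem Ic_eq_phi_add_G_sub_H :
    ∀ c a b : ℝ, 0 < c → a < min (-1 + c/2) (-(1/(2*c))) → 1 + c/2 < b →
      ∀ s ∈ Set.Ioo a b,
        (∫ t in a..b, phi0 (s - t) * deriv (Omega c) t) =
          phi1 (a - s) + phi1 (b - s) + Gc c s - Hc c s := by
  intro c a b hc ha hb s _
  have ha1 : a < c/2 - 1 := by have := lt_of_lt_of_le ha (min_le_left _ _); linarith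
  have ha2 : a < -(1/(2*c)) := lt_of_lt_of_le ha (min_le_right _ _)
  obtain ⟨m1, m2⟩ := mid_piece (s := s) hc (fun t ht => Omega_mid hc ht)
  obtain ⟨r1, r2⟩ := const_piece (s := s) (f := Omega c) (x := c/2+1) (y := b) (d := 1) (by linarith)
    (fun t ht => Omega_right hc ht.1)
  have hfin := final_id (s := s) hc
  have left : IntervalIntegrable (fun t => phi0 (s - t) * deriv (Omega c) t) volume a (c/2-1) ∧
    ∫ t in a..(c/2-1), phi0 (s - t) * deriv (Omega c) t =
      phi1 (a - s) - Real.sign (1-c) * phi1 (-1 - (s - c/2)) + (1 - Real.sign (1-c)) * phi1 (s + 1/(2*c)) := by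
    rcases le_or_gt c 1 with h | h
    · obtain ⟨l1, l2⟩ := const_piece (s := s) (f := Omega c) (x := a) (y := c/2-1) (d := -1) ha1.le
        (fun t ht => Omega_left1 hc h ht.2)
      refine ⟨l1, ?_⟩
      rw [l2]
      rcases h.lt_or_eq with h | h
      · rw [Real.sign_of_pos (by linarith), show -1 - (s - c/2) = c/2-1-s by ring]; ring
      · subst h
        rw [show (1:ℝ)/2 - 1 - s = -(s + 1/(2*1)) by ring, phi1_neg]
        simp
    · obtain ⟨l1, l2⟩ := const_piece (s := s) (f := Omega c) (x := a) (y := -(1/(2*c))) (d := -1) ha2.le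
        (fun t ht => Omega_left2 h ht.2)
      obtain ⟨n1, n2⟩ := const_piece (s := s) (f := Omega c) (x := -(1/(2*c))) (y := c/2-1) (d := 1) (p_lt h).le
        (fun t ht => Omega_mid2 h ht)
      refine ⟨l1.trans n1, ?_⟩
      rw [← intervalIntegral.integral_add_adjacent_intervals l1 n1, l2, n2,
        Real.sign_of_neg (by linarith), show -1 - (s - c/2) = c/2-1-s by ring,
        show -(1/(2*c)) - s = -(s + 1/(2*c)) by ring, phi1_neg]
      ring
  obtain ⟨l1, l2⟩ := left
  rw [← intervalIntegral.integral_add_adjacent_intervals (l1.trans m1) r1,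
    ← intervalIntegral.integral_add_adjacent_intervals l1 m1, l2, m2, r2,
    show c/2+1-s = 1 - (s - c/2) by ring]
  linarith
end
end
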